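/- arXiv:0912.1702 — 2 statements merged into one kernel-verified Lean document; each statement's English description precedes it below -/
import Mathlib

section
/- Let F_q be a finite field of odd cardinality q. Let n be a natural number, and let A be a nonzero polynomial in F_q[t] of degree smaller than n. Then there exist absolute constants C₁, C₂ > 0 (independent of q, n, A) such that |π₂(n;A,q) − q^n/n²| ≤ C₁·(n!)²·q^(n−1/2) + C₂·n·2^(binomial(n+2,2))·q^(n−1). -/
open Polynomial

namespace TwinPrime

section Stepanov

variable {F : Type*} [Field F]

lemma pow_sub_dvd_hasseDeriv_pow (f : F[X]) (N : ℕ) :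
    ∀ i ≤ N, f ^ (N - i) ∣ hasseDeriv i (f ^ N) := by
  induction N with
  | zero => intro i hi; simp
  | succ N ih =>
    intro i hi
    rw [pow_succ', hasseDeriv_mul]
    refine Finset.dvd_sum fun ab hab => ?_
    rw [Finset.HasAntidiagonal.mem_antidiagonal] at hab
    rcases Nat.eq_zero_or_pos ab.1 with h0 | h0
    · have hb : ab.2 = i := by omega
      rw [h0, hb, hasseDeriv_zero']
      rcases Nat.lt_or_ge N i with h | h
      · have : N + 1 - i = 0 := by omega
        rw [this, pow_zero]; exact one_dvd _
      · rw [show N + 1 - i = (N - i) + 1 by omega, pow_succ']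
        exact mul_dvd_mul_left _ (ih i h)
    · refine Dvd.dvd.mul_left ((pow_dvd_pow f ?_).trans (ih ab.2 (by omega))) _
      omega

/-- The cofactor of `f ^ (N - i)` in the `i`-th Hasse derivative of `f ^ N`. -/
noncomputable def hassePowCofactor (f : F[X]) (N i : ℕ) : F[X] :=
  if h : i ≤ N then (pow_sub_dvd_hasseDeriv_pow f N i h).choose else 0

lemma hasseDeriv_pow_eq (f : F[X]) {N i : ℕ} (h : i ≤ N) :
    hasseDeriv i (f ^ N) = f ^ (N - i) * hassePowCofactor f N i := by
  rw [hassePowCofactor, dif_pos h]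
  exact (pow_sub_dvd_hasseDeriv_pow f N i h).choose_spec

lemma natDegree_hassePowCofactor_le (f : F[X]) (hf : f ≠ 0) (N i : ℕ) :
    (hassePowCofactor f N i).natDegree ≤ i * f.natDegree := by
  by_cases h : i ≤ N
  · by_cases hQ : hassePowCofactor f N i = 0
    · simp [hQ]
    have h1 := natDegree_hasseDeriv_le (f ^ N) i
    rw [hasseDeriv_pow_eq f h, natDegree_mul (pow_ne_zero _ hf) hQ, natDegree_pow,
      natDegree_pow] at h1
    have h2 : N * f.natDegree = (N - i) * f.natDegree + i * f.natDegree := by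
      rw [← Nat.add_mul]; congr 1; omega
    omega
  · simp [hassePowCofactor, h]

/-- The linear map `r ↦ E_k (f ^ N r) / f ^ (N - k)` where `E_k` is the Hasse derivative. -/
noncomputable def hasseReduced (f : F[X]) (N k : ℕ) : F[X] →ₗ[F] F[X] :=
  ∑ ab ∈ Finset.HasAntidiagonal.antidiagonal k,
    LinearMap.mulLeft F (f ^ ab.2 * hassePowCofactor f N ab.1) ∘ₗ hasseDeriv ab.2

lemma hasseReduced_apply (f : F[X]) (N k : ℕ) (r : F[X]) :
    hasseReduced f N k r = ∑ ab ∈ Finset.HasAntidiagonal.antidiagonal k,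
      f ^ ab.2 * hassePowCofactor f N ab.1 * hasseDeriv ab.2 r := by
  simp [hasseReduced, LinearMap.sum_apply, mul_assoc]

lemma hasseDeriv_pow_mul (f r : F[X]) {N k : ℕ} (h : k ≤ N) :
    hasseDeriv k (f ^ N * r) = f ^ (N - k) * hasseReduced f N k r := by
  rw [hasseDeriv_mul, hasseReduced_apply, Finset.mul_sum]
  refine Finset.sum_congr rfl fun ab hab => ?_
  rw [Finset.HasAntidiagonal.mem_antidiagonal] at hab
  rw [hasseDeriv_pow_eq f (by omega : ab.1 ≤ N), show N - ab.1 = (N - k) + ab.2 by omega, pow_add]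
  ring

lemma natDegree_hasseReduced_le (f : F[X]) (hf : f ≠ 0) (N k : ℕ) (r : F[X]) :
    (hasseReduced f N k r).natDegree ≤ k * f.natDegree + r.natDegree := by
  rw [hasseReduced_apply]
  refine natDegree_sum_le_of_forall_le _ _ fun ab hab => ?_
  rw [Finset.HasAntidiagonal.mem_antidiagonal] at hab
  refine natDegree_mul_le.trans ?_
  have h1 := natDegree_mul_le (p := f ^ ab.2) (q := hassePowCofactor f N ab.1)
  have h2 := natDegree_hassePowCofactor_le f hf N ab.1
  have h3 := natDegree_hasseDeriv_le r ab.2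
  rw [natDegree_pow] at h1
  have h4 : k * f.natDegree = ab.1 * f.natDegree + ab.2 * f.natDegree := by
    rw [← hab, Nat.add_mul]
  omega

/-- If `g` has `X`-adic valuation exactly `M`, the products `X ^ (q j)` and `g X ^ (q j)` are
linearly independent over polynomials of degree less than `M`, for `q = 2 M + 1`. -/
lemma eq_zero_of_sum_X_pow_eq_zero {M : ℕ} {u : F[X]} (hu : u.coeff 0 ≠ 0) (J : ℕ) :
    ∀ r s : ℕ → F[X], (∀ j, (r j).degree < M) → (∀ j, (s j).degree < M) →
    ∑ j ∈ Finset.range J, (r j + s j * (X ^ M * u)) * (X ^ (2 * M + 1)) ^ j = 0 →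
    ∀ j < J, r j = 0 ∧ s j = 0 := by
  have small : ∀ p : F[X], p.degree < M → X ^ M ∣ p → p = 0 := fun p hp hd =>
    eq_zero_of_dvd_of_degree_lt hd (by rwa [degree_X_pow])
  have cop : IsCoprime (X : F[X]) u := by
    rw [(irreducible_X).coprime_iff_not_dvd, X_dvd_iff]; exact hu
  induction J with
  | zero => intro r s _ _ _ j hj; omega
  | succ J ih =>
    intro r s hr hs h
    rw [Finset.sum_range_succ'] at h
    simp only [pow_zero, mul_one, pow_succ] at h
    simp only [← mul_assoc, ← Finset.sum_mul] at h
    simp only [mul_assoc, ← pow_succ] at h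
    set T := ∑ j ∈ Finset.range J, (r (j + 1) + s (j + 1) * (X ^ M * u)) *
      (X ^ (2 * M + 1)) ^ j with hT
    have hr0 : r 0 = 0 := by
      refine small _ (hr 0) ?_
      have : r 0 = X ^ M * (-(T * X ^ (M + 1)) - s 0 * u) := by
        have e : (X : F[X]) ^ (2 * M + 1) = X ^ M * X ^ (M + 1) := by
          rw [← pow_add]; congr 1; omega
        rw [e] at h
        linear_combination h
      exact ⟨_, this⟩
    have e : (X : F[X]) ^ (2 * M + 1) = X ^ M * X ^ (M + 1) := by
      rw [← pow_add]; congr 1; omega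
    have hs0 : s 0 = 0 := by
      refine small _ (hs 0) ?_
      have h1 : (X : F[X]) ^ (M + 1) ∣ u * s 0 := by
        refine ⟨-T, ?_⟩
        have hX : (X : F[X]) ^ M ≠ 0 := pow_ne_zero _ X_ne_zero
        apply mul_left_cancel₀ hX
        rw [e, hr0] at h
        linear_combination h
      exact (pow_dvd_pow _ (Nat.le_succ M)).trans ((cop.pow_left).dvd_of_dvd_mul_left h1)
    have hT0 : T = 0 := by
      rw [hr0, hs0] at h
      simpa using h
    intro j hj
    rcases j with _ | j
    · exact ⟨hr0, hs0⟩
    · exact ih (fun j => r (j + 1)) (fun j => s (j + 1)) (fun j => hr _) (fun j => hs _) hT0 j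
        (by omega)

lemma X_add_C_pow_card [Fintype F] (x : F) :
    (X + C x : F[X]) ^ Fintype.card F = X ^ Fintype.card F + C x := by
  rw [← FiniteField.expand_card]
  simp

/-- Low Taylor coefficients do not see the factor `X ^ q`, up to scalars. -/
lemma coeff_taylor_mul_X_pow_card [Fintype F] (x : F) (p : F[X]) (j : ℕ) {k : ℕ}
    (hk : k < Fintype.card F) :
    (taylor x (p * (X ^ Fintype.card F) ^ j)).coeff k = (hasseDeriv k p).eval x * x ^ j := by
  rw [taylor_mul, taylor_pow, taylor_pow, taylor_X, X_add_C_pow_card]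
  obtain ⟨w, hw⟩ : (X : F[X]) ^ Fintype.card F ∣
      (X ^ Fintype.card F + C x) ^ j - C x ^ j := by
    have := sub_dvd_pow_sub_pow (X ^ Fintype.card F + C x) (C x) j
    rwa [add_sub_cancel_right] at this
  rw [sub_eq_iff_eq_add] at hw
  rw [hw, mul_add, coeff_add, ← taylor_coeff, ← C_pow, coeff_mul_C, ← mul_assoc,
    mul_comm (taylor x p), mul_assoc, coeff_X_pow_mul', if_neg (by omega), zero_add]

/-- Auxiliary polynomials in Stepanov's method. -/
lemma exists_stepanov (f : F[X]) (hf : f ≠ 0) (a : F) (M l J : ℕ)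
    (h : l * (M + l * f.natDegree + J) < 2 * (J * M)) :
    ∃ r s : ℕ → F[X], (∀ j, (r j).degree < M) ∧ (∀ j, (s j).degree < M) ∧
      (∃ j < J, ¬ (r j = 0 ∧ s j = 0)) ∧
      ∀ k < l, ∑ j ∈ Finset.range J,
        (hasseReduced f l k (r j) + C a * hasseReduced f (l + M) k (s j)) * X ^ j = 0 := by
  set B := M + l * f.natDegree + J with hB
  let V := (Fin J → degreeLT F M) × (Fin J → degreeLT F M)
  have hfin : Module.finrank F (degreeLT F M) = M := by
    rw [(degreeLTEquiv F M).finrank_eq]; simp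
  have : Module.Finite F (degreeLT F M) := Module.Finite.equiv (degreeLTEquiv F M).symm
  let P : ℕ → V →ₗ[F] F[X] := fun k => ∑ j : Fin J, LinearMap.mulRight F (X ^ (j : ℕ)) ∘ₗ
    (hasseReduced f l k ∘ₗ (degreeLT F M).subtype ∘ₗ LinearMap.proj j ∘ₗ LinearMap.fst F _ _
      + LinearMap.mulLeft F (C a) ∘ₗ hasseReduced f (l + M) k ∘ₗ (degreeLT F M).subtype ∘ₗ
        LinearMap.proj j ∘ₗ LinearMap.snd F _ _)
  let Φ : V →ₗ[F] (Fin l → Fin B → F) := LinearMap.pi fun k => LinearMap.pi fun i =>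
    lcoeff F (i : ℕ) ∘ₗ P k
  have hker : LinearMap.ker Φ ≠ ⊥ := by
    apply LinearMap.ker_ne_bot_of_finrank_lt
    simp only [V, Module.finrank_prod, Module.finrank_pi_fintype, hfin]
    simp only [Finset.sum_const, Finset.card_univ, Fintype.card_fin, smul_eq_mul,
      Module.finrank_self, mul_one]
    omega
  obtain ⟨v, hv, hv0⟩ := (Submodule.ne_bot_iff _).1 hker
  have hP : ∀ k, P k v = ∑ j : Fin J, (hasseReduced f l k (v.1 j) +
      C a * hasseReduced f (l + M) k (v.2 j)) * X ^ (j : ℕ) := by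
    intro k
    simp [P, LinearMap.sum_apply]
    rfl
  have hnd : ∀ p : degreeLT F M, (p : F[X]).degree < M := fun p => mem_degreeLT.1 p.2
  have hnd' : ∀ p : degreeLT F M, (p : F[X]).natDegree ≤ M := fun p =>
    natDegree_le_of_degree_le (hnd p).le
  refine ⟨fun j => if h : j < J then v.1 ⟨j, h⟩ else 0,
    fun j => if h : j < J then v.2 ⟨j, h⟩ else 0, ?_, ?_, ?_, ?_⟩
  · intro j; dsimp only; split_ifs
    · exact hnd _
    · simp
  · intro j; dsimp only; split_ifs
    · exact hnd _
    · simp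
  · by_contra! hcon
    apply hv0
    have : ∀ j : Fin J, v.1 j = 0 ∧ v.2 j = 0 := fun j => by
      have := hcon j j.2
      simpa using this
    exact Prod.ext (funext fun j => (this j).1) (funext fun j => (this j).2)
  · intro k hk
    rw [Finset.sum_range]
    simp only [Fin.is_lt, dite_true]
    rw [← hP]
    ext i
    rw [coeff_zero]
    by_cases hi : i < B
    · have := congrFun (congrFun (LinearMap.mem_ker.1 hv) ⟨k, hk⟩) ⟨i, hi⟩
      simpa [Φ] using this
    · apply coeff_eq_zero_of_natDegree_lt
      refine lt_of_lt_of_le ?_ (not_lt.1 hi)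
      rw [hP, ]
      have hJ : 0 < J := by
        rcases Nat.eq_zero_or_pos J with h0 | h0
        · simp [h0] at h
        · exact h0
      have hkl : k * f.natDegree ≤ l * f.natDegree := Nat.mul_le_mul_right _ hk.le
      have : (∑ j : Fin J, (hasseReduced f l k (v.1 j) +
        C a * hasseReduced f (l + M) k (v.2 j)) * X ^ (j : ℕ)).natDegree ≤ B - 1 := by
        refine natDegree_sum_le_of_forall_le _ _ fun j _ => ?_
        refine natDegree_mul_le.trans ?_
        rw [natDegree_X_pow]
        have h1 := (natDegree_hasseReduced_le f hf l k (v.1 j)).trans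
          (Nat.add_le_add_left (hnd' _) _)
        have h2 := ((natDegree_C_mul_le a _).trans
          (natDegree_hasseReduced_le f hf (l + M) k (v.2 j))).trans
          (Nat.add_le_add_left (hnd' _) _)
        have h3 := natDegree_add_le_of_degree_le h1 h2
        have := j.2
        omega
      omega

/-- Stepanov's bound for the number of `x` with `f(x) ^ M = a`. -/
lemma stepanov_card_le [Fintype F] [DecidableEq F] {M : ℕ} (hq : Fintype.card F = 2 * M + 1)
    (f : F[X]) (h0 : f.coeff 0 = 0) (h1 : f.coeff 1 ≠ 0) (a : F) (l J : ℕ)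
    (hl : l ≤ Fintype.card F)
    (h : l * (M + l * f.natDegree + J) < 2 * (J * M)) :
    l * (Finset.univ.filter fun x : F => f.eval x ^ M = a).card ≤
      l * f.natDegree + M + M * f.natDegree + Fintype.card F * J := by
  have hf : f ≠ 0 := by rintro rfl; simp at h1
  obtain ⟨r, s, hr, hs, hne, hP⟩ := exists_stepanov f hf a M l J h
  set q := Fintype.card F with hqdef
  set R : F[X] := ∑ j ∈ Finset.range J, (f ^ l * r j + f ^ (l + M) * s j) * (X ^ q) ^ j with hR
  obtain ⟨w, hw⟩ : (X : F[X]) ∣ f := X_dvd_iff.2 h0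
  have hw0 : w.coeff 0 ≠ 0 := by
    rw [hw] at h1
    rwa [coeff_X_mul] at h1
  have hR0 : R ≠ 0 := by
    intro hR0
    obtain ⟨j, hj, hj'⟩ := hne
    apply hj'
    have hu : (w ^ M).coeff 0 ≠ 0 := by
      rw [coeff_zero_eq_eval_zero, eval_pow, ← coeff_zero_eq_eval_zero]
      exact pow_ne_zero _ hw0
    refine eq_zero_of_sum_X_pow_eq_zero hu J r s hr hs ?_ j hj
    have : R = f ^ l * ∑ j ∈ Finset.range J, (r j + s j * (X ^ M * w ^ M)) *
        (X ^ (2 * M + 1)) ^ j := by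
      rw [hR, Finset.mul_sum, hq]
      refine Finset.sum_congr rfl fun j _ => ?_
      rw [← mul_pow, ← hw, pow_add]; ring
    rw [this] at hR0
    exact (mul_eq_zero.1 hR0).resolve_left (pow_ne_zero _ hf)
  have hvan : ∀ x : F, f.eval x ^ M = a → (X - C x) ^ l ∣ R := by
    intro x hx
    have key : X ^ l ∣ taylor x R := by
      rw [X_pow_dvd_iff]
      intro k hk
      have e : (taylor x R).coeff k = f.eval x ^ (l - k) * (∑ j ∈ Finset.range J,
        (hasseReduced f l k (r j) + C a * hasseReduced f (l + M) k (s j)) * X ^ j).eval x := by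
        rw [hR, map_sum, finsetSum_coeff, eval_finsetSum, Finset.mul_sum]
        refine Finset.sum_congr rfl fun j _ => ?_
        rw [coeff_taylor_mul_X_pow_card x _ _ (lt_of_lt_of_le hk hl), map_add,
          hasseDeriv_pow_mul f _ hk.le, hasseDeriv_pow_mul f _ (by omega : k ≤ l + M),
          show l + M - k = (l - k) + M by omega, pow_add]
        simp only [eval_add, eval_mul, eval_pow, eval_C, eval_X, hx]
        ring
      rw [e, hP k hk, eval_zero, mul_zero]
    obtain ⟨y, hy⟩ := key
    have := congrArg (taylor (-x)) hy
    rw [taylor_taylor, taylor_mul, taylor_pow, taylor_X, neg_add_cancel, taylor_zero, C_neg,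
      ← sub_eq_add_neg] at this
    exact ⟨_, this⟩
  have hdvd : ∏ x ∈ Finset.univ.filter (fun x : F => f.eval x ^ M = a), (X - C x) ^ l ∣ R := by
    refine Finset.prod_dvd_of_coprime ?_ fun x hx => hvan x (Finset.mem_filter.1 hx).2
    intro x _ y _ hxy
    exact (pairwise_coprime_X_sub_C Function.injective_id hxy).pow
  have hdeg := natDegree_le_of_dvd hdvd hR0
  rw [Finset.prod_pow, natDegree_pow, natDegree_prod _ _ (fun x _ => X_sub_C_ne_zero x)] at hdeg
  simp only [natDegree_X_sub_C, Finset.sum_const, smul_eq_mul, mul_one] at hdeg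
  refine hdeg.trans ?_
  have hrn : ∀ j, (r j).natDegree ≤ M := fun j => natDegree_le_of_degree_le (hr j).le
  have hsn : ∀ j, (s j).natDegree ≤ M := fun j => natDegree_le_of_degree_le (hs j).le
  refine natDegree_sum_le_of_forall_le _ _ fun j hj => ?_
  refine natDegree_mul_le.trans ?_
  have hj' : j ≤ J := (Finset.mem_range.1 hj).le
  rw [← pow_mul, natDegree_X_pow]
  have e1 : (f ^ l * r j).natDegree ≤ l * f.natDegree + M + M * f.natDegree := by
    refine natDegree_mul_le.trans ?_
    rw [natDegree_pow]; have := hrn j; omega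
  have e2 : (f ^ (l + M) * s j).natDegree ≤ l * f.natDegree + M + M * f.natDegree := by
    refine natDegree_mul_le.trans ?_
    rw [natDegree_pow, Nat.add_mul]; have := hsn j; omega
  have e3 := natDegree_add_le_of_degree_le e1 e2
  have e4 : q * j ≤ q * J := Nat.mul_le_mul_left _ hj'
  omega

variable [Fintype F] [DecidableEq F]

lemma stepanov_card_le_sqrt {M : ℕ} (hq : Fintype.card F = 2 * M + 1)
    (f : F[X]) (h0 : f.coeff 0 = 0) (h1 : f.coeff 1 ≠ 0) (a : F)
    (hJ : 19 * f.natDegree ≤ Nat.sqrt (Fintype.card F)) :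
    ((Finset.univ.filter fun x : F => f.eval x ^ M = a).card : ℝ) ≤
      Fintype.card F / 2 + 22 * f.natDegree * √(Fintype.card F) := by
  have hd : 1 ≤ f.natDegree := le_natDegree_of_ne_zero h1
  set d := f.natDegree with hd'
  set q := Fintype.card F with hq'
  set J := Nat.sqrt q with hJ'
  obtain ⟨l, hl⟩ : ∃ l, 2 * J = l + 19 * d := ⟨2 * J - 19 * d, by omega⟩
  have hJq : J * J ≤ q := Nat.sqrt_le q
  have hJq2 : q < (J + 1) * (J + 1) := Nat.lt_succ_sqrt q
  have hJl : J ≤ l := by omega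
  have hlq : l ≤ q := by nlinarith
  have hM : 1 ≤ M := by nlinarith
  have hcond : l * (M + l * d + J) < 2 * (J * M) := by
    have a1 : l * M + 19 * d * M = 2 * (J * M) := by rw [← Nat.add_mul, ← hl]; ring
    have a2 : l * (l * d + J) ≤ (2 * J) * (3 * J * d) := by
      apply Nat.mul_le_mul (by omega)
      nlinarith
    have a3 : (2 * J) * (3 * J * d) = 6 * d * (J * J) := by ring
    have a4 : 6 * d * (J * J) ≤ 6 * d * (3 * M) := Nat.mul_le_mul_left _ (by omega)
    nlinarith
  have key := stepanov_card_le hq f h0 h1 a l J hlq hcond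
  set N := (Finset.univ.filter fun x : F => f.eval x ^ M = a).card
  have key' : (l : ℝ) * N ≤ l * d + M + M * d + q * J := by exact_mod_cast key
  have hlr : 2 * (J : ℝ) = l + 19 * d := by exact_mod_cast hl
  have hqM : (q : ℝ) = 2 * M + 1 := by exact_mod_cast hq
  have hs : √(q : ℝ) * √(q : ℝ) = q := Real.mul_self_sqrt (Nat.cast_nonneg _)
  have hsJ : √(q : ℝ) ≤ J + 1 := by
    rw [Real.sqrt_le_left (by positivity)]
    have : (q : ℝ) ≤ (J + 1) * (J + 1) := by exact_mod_cast hJq2.le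
    nlinarith
  have hJ1 : (1 : ℝ) ≤ J := by
    have : 1 ≤ J := by omega
    exact_mod_cast this
  have hd1 : (1 : ℝ) ≤ d := by exact_mod_cast hd
  have hl0 : (0 : ℝ) < l := by
    have : 0 < l := by omega
    exact_mod_cast this
  have hs2l : √(q : ℝ) ≤ 2 * l := by
    have : (J : ℝ) ≤ l := by exact_mod_cast hJl
    linarith
  have hs0 := Real.sqrt_nonneg (q : ℝ)
  have hs1 : 1 ≤ √(q : ℝ) := by
    rw [Real.one_le_sqrt, hqM]; have : (0 : ℝ) ≤ M := Nat.cast_nonneg _; linarith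
  have hql : (q : ℝ) ≤ √(q : ℝ) * (2 * l) := by nlinarith
  refine le_of_mul_le_mul_left ?_ hl0
  refine key'.trans ?_
  have e1 : (q : ℝ) * J = q * l / 2 + 19 / 2 * d * q := by linear_combination (q : ℝ) / 2 * hlr
  have e2 : (M : ℝ) ≤ d * q := by nlinarith [(Nat.cast_nonneg M : (0:ℝ) ≤ M)]
  have e3 : (M : ℝ) + M * d ≤ d * q := by nlinarith [(Nat.cast_nonneg M : (0:ℝ) ≤ M)]
  have e4 : d * (q : ℝ) ≤ d * (√(q : ℝ) * (2 * l)) := by gcongr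
  have e5 : (l : ℝ) * d ≤ l * d * √(q : ℝ) := le_mul_of_one_le_right (by positivity) hs1
  nlinarith

/-- Square-root cancellation in quadratic character sums of polynomials with a simple zero
at the origin. -/
theorem abs_sum_quadraticChar_le {M : ℕ} (hq : Fintype.card F = 2 * M + 1)
    (f : F[X]) (h0 : f.coeff 0 = 0) (h1 : f.coeff 1 ≠ 0) :
    |(∑ x : F, (quadraticChar F (f.eval x) : ℝ))| ≤
      45 * f.natDegree * √(Fintype.card F) := by
  have hd : 1 ≤ f.natDegree := le_natDegree_of_ne_zero h1
  have hd1 : (1 : ℝ) ≤ f.natDegree := by exact_mod_cast hd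
  have hs : √(Fintype.card F : ℝ) * √(Fintype.card F : ℝ) = Fintype.card F :=
    Real.mul_self_sqrt (Nat.cast_nonneg _)
  have hs1 : 1 ≤ √(Fintype.card F : ℝ) := by
    rw [Real.one_le_sqrt, hq]; push_cast; have : (0 : ℝ) ≤ M := Nat.cast_nonneg _; linarith
  by_cases hJ : 19 * f.natDegree ≤ Nat.sqrt (Fintype.card F)
  · have hchar : ringChar F ≠ 2 := by
      intro h
      have := FiniteField.even_card_of_char_two h
      omega
    have hM : Fintype.card F / 2 = M := by omega
    have hne : (1 : F) ≠ -1 := (Ring.neg_one_ne_one_of_char_ne_two hchar).symm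
    set S1 := Finset.univ.filter fun x : F => f.eval x ^ M = 1 with hS1
    set S2 := Finset.univ.filter fun x : F => f.eval x ^ M = -1 with hS2
    set Z := Finset.univ.filter fun x : F => f.eval x = 0 with hZ
    have b1 := stepanov_card_le_sqrt hq f h0 h1 1 hJ
    have b2 := stepanov_card_le_sqrt hq f h0 h1 (-1) hJ
    rw [← hS1] at b1
    rw [← hS2] at b2
    have hM0 : M ≠ 0 := by
      rintro rfl
      have := Fintype.one_lt_card (α := F)
      omega
    have hpt : ∀ x : F, ((quadraticChar F (f.eval x) : ℝ) =
        (if f.eval x ^ M = 1 then 1 else 0) - (if f.eval x ^ M = -1 then 1 else 0)) ∧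
        (1 : ℝ) = (if f.eval x ^ M = 1 then 1 else 0) + (if f.eval x ^ M = -1 then 1 else 0)
          + (if f.eval x = 0 then 1 else 0) := by
      intro x
      by_cases hx : f.eval x = 0
      · simp [hx, zero_pow hM0]
      · rcases quadraticChar_dichotomy hx with h | h
        · have e := quadraticChar_eq_pow_of_char_ne_two' hchar (f.eval x)
          rw [h, hM] at e
          push_cast at e
          rw [← e, h]
          simp [hx, hne]
        · have e := quadraticChar_eq_pow_of_char_ne_two' hchar (f.eval x)
          rw [h, hM] at e
          push_cast at e
          rw [← e, h]
          simp [hx, hne.symm]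
    have hsum : ∑ x : F, (quadraticChar F (f.eval x) : ℝ) = S1.card - S2.card := by
      rw [Finset.sum_congr rfl fun x _ => (hpt x).1, Finset.sum_sub_distrib]
      simp [hS1, hS2]
    have htot : (Fintype.card F : ℝ) = S1.card + S2.card + Z.card := by
      have : ∑ x : F, (1 : ℝ) = S1.card + S2.card + Z.card := by
        rw [Finset.sum_congr rfl fun x _ => (hpt x).2, Finset.sum_add_distrib,
          Finset.sum_add_distrib]
        simp [hS1, hS2, hZ]
      simpa using this
    have hZc : (Z.card : ℝ) ≤ f.natDegree := by
      have hf : f ≠ 0 := by rintro rfl; simp at h1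
      have : Z.card ≤ f.natDegree := by
        refine card_le_degree_of_subset_roots (Z := Z) ?_
        intro x hx
        simp only [hZ, Finset.mem_val, Finset.mem_filter] at hx
        simp [hf, hx]
      exact_mod_cast this
    rw [hsum, abs_le]
    have : (f.natDegree : ℝ) ≤ f.natDegree * √(Fintype.card F : ℝ) :=
      le_mul_of_one_le_right (by positivity) hs1
    constructor <;> nlinarith
  · have h2 : Fintype.card F < (Nat.sqrt (Fintype.card F) + 1) * (Nat.sqrt (Fintype.card F) + 1) :=
      Nat.lt_succ_sqrt _
    have h3 : Nat.sqrt (Fintype.card F) + 1 ≤ 19 * f.natDegree := by omega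
    have h4 : √(Fintype.card F : ℝ) ≤ 19 * f.natDegree := by
      rw [Real.sqrt_le_left (by positivity)]
      have := h2.le.trans (Nat.mul_le_mul h3 h3)
      have : (Fintype.card F : ℝ) ≤ 19 * f.natDegree * (19 * f.natDegree) := by exact_mod_cast this
      nlinarith
    calc |(∑ x : F, (quadraticChar F (f.eval x) : ℝ))| ≤ ∑ x : F, 1 := by
          refine (Finset.abs_sum_le_sum_abs _ _).trans (Finset.sum_le_sum fun x _ => ?_)
          by_cases hx : f.eval x = 0
          · simp [hx]
          · rcases quadraticChar_dichotomy hx with h | h <;> simp [h]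
      _ = √(Fintype.card F : ℝ) * √(Fintype.card F : ℝ) := by rw [hs]; simp
      _ ≤ (19 * f.natDegree) * √(Fintype.card F : ℝ) := by gcongr
      _ ≤ _ := by gcongr; norm_num

end Stepanov

section Lines

variable {F σ : Type*} [Field F] [Fintype σ]

/-- Restriction of a multivariate polynomial to the line through `x` with direction `v`. -/
noncomputable def lineRestrict (D : MvPolynomial σ F) (x v : σ → F) : F[X] :=
  MvPolynomial.aeval (fun i => C (x i) + C (v i) * X) D

omit [Fintype σ] in
lemma eval_lineRestrict (D : MvPolynomial σ F) (x v : σ → F) (s : F) :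
    (lineRestrict D x v).eval s = MvPolynomial.eval (x + s • v) D := by
  induction D using MvPolynomial.induction_on with
  | C a => simp [lineRestrict]
  | add p q hp hq => simp only [lineRestrict, map_add, eval_add] at *; rw [hp, hq]
  | mul_X p j hp =>
    rw [lineRestrict] at hp ⊢
    rw [map_mul, eval_mul, hp, MvPolynomial.aeval_X, MvPolynomial.eval_mul, MvPolynomial.eval_X]
    congr 1
    simp only [eval_add, eval_C, eval_mul, eval_X, Pi.add_apply, Pi.smul_apply, smul_eq_mul]
    rw [mul_comm s]

omit [Fintype σ] in
lemma coeff_zero_lineRestrict (D : MvPolynomial σ F) (x v : σ → F) :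
    (lineRestrict D x v).coeff 0 = MvPolynomial.eval x D := by
  rw [coeff_zero_eq_eval_zero, eval_lineRestrict, zero_smul, add_zero]

lemma exists_coeff_one_lineRestrict (D : MvPolynomial σ F) (x : σ → F) :
    ∃ c : σ → F, ∀ v, (lineRestrict D x v).coeff 1 = ∑ i, v i * c i := by
  classical
  induction D using MvPolynomial.induction_on with
  | C a => exact ⟨0, fun v => by simp [lineRestrict]⟩
  | add p q hp hq =>
    obtain ⟨c, hc⟩ := hp
    obtain ⟨c', hc'⟩ := hq
    refine ⟨c + c', fun v => ?_⟩
    have := hc v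
    have := hc' v
    simp only [lineRestrict, map_add, coeff_add, Pi.add_apply, mul_add, Finset.sum_add_distrib] at *
    simp [*]
  | mul_X p j hp =>
    obtain ⟨c, hc⟩ := hp
    refine ⟨fun i => c i * x j + if i = j then MvPolynomial.eval x p else 0, fun v => ?_⟩
    have h1 := hc v
    have h2 := coeff_zero_lineRestrict p x v
    simp only [lineRestrict, map_mul, MvPolynomial.aeval_X, mul_coeff_one] at *
    rw [h1, h2]
    simp [mul_add, Finset.sum_add_distrib, Finset.sum_mul, mul_assoc]
    ring

omit [Fintype σ] in
lemma natDegree_lineRestrict_le (D : MvPolynomial σ F) (x v : σ → F) :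
    (lineRestrict D x v).natDegree ≤ D.totalDegree := by
  have := MvPolynomial.aeval_natDegree_le (n := 1) D le_rfl
    (fun i => C (x i) + C (v i) * X) ?_
  · rwa [mul_one] at this
  · intro i
    compute_degree

variable [Fintype F] [DecidableEq F] [DecidableEq σ]

lemma card_mul_card_filter_sum_mul_eq_zero_le (c : σ → F) (hc : c ≠ 0) :
    Fintype.card F * (Finset.univ.filter fun v : σ → F => ∑ i, v i * c i = 0).card ≤
      Fintype.card F ^ Fintype.card σ := by
  obtain ⟨i, hi⟩ := Function.ne_iff.1 hc
  rw [← Fintype.card_fun, ← Finset.card_univ, ← Finset.card_univ, ← Finset.card_product]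
  refine Finset.card_le_card_of_injOn (fun tv => tv.2 + Pi.single i tv.1) (fun _ _ =>
    Finset.mem_coe.2 (Finset.mem_univ _)) ?_
  rintro ⟨t, v⟩ h ⟨t', v'⟩ h' e
  simp only [Finset.coe_product, Finset.coe_univ, Set.mem_prod, Set.mem_univ, Finset.coe_filter,
    Finset.mem_univ, true_and, Set.mem_ofPred_eq] at h h'
  dsimp only at e
  have : t * c i = t' * c i := by
    have := congrArg (fun v : σ → F => ∑ i, v i * c i) e
    simpa [add_mul, Finset.sum_add_distrib, h, h', Pi.single_apply] using this
  have ht : t = t' := mul_right_cancel₀ hi this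
  subst ht
  simpa using e

/-- Square-root cancellation for `χ (D x)` over `F ^ σ` as soon as `D` has a rational zero with
nonzero differential. -/
theorem card_mul_abs_sum_quadraticChar_le {M : ℕ} (hq : Fintype.card F = 2 * M + 1)
    (D : MvPolynomial σ F) (d : ℕ) (hd : D.totalDegree ≤ d) (x v : σ → F)
    (h0 : MvPolynomial.eval x D = 0) (h1 : (lineRestrict D x v).coeff 1 ≠ 0) :
    Fintype.card F * |∑ y : σ → F, (quadraticChar F (MvPolynomial.eval y D) : ℝ)| ≤
      94 * d * √(Fintype.card F) * Fintype.card F ^ Fintype.card σ := by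
  have hd1 : (1 : ℝ) ≤ d := by
    have : 1 ≤ d := (le_natDegree_of_ne_zero h1).trans ((natDegree_lineRestrict_le D x v).trans hd)
    exact_mod_cast this
  set q := Fintype.card F with hqdef
  have hq3 : (3 : ℝ) ≤ q := by
    have := Fintype.one_lt_card (α := F)
    have : 3 ≤ q := by omega
    exact_mod_cast this
  have hs1 : 1 ≤ √(q : ℝ) := by rw [Real.one_le_sqrt]; linarith
  set N := Fintype.card σ
  set S := ∑ y : σ → F, (quadraticChar F (MvPolynomial.eval y D) : ℝ) with hS
  have hshift : ∀ s : F, s ≠ 0 →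
      ∑ w : σ → F, (quadraticChar F (MvPolynomial.eval (x + s • w) D) : ℝ) = S := by
    intro s hs
    have e := Equiv.sum_comp (Equiv.addLeft x)
      fun y => (quadraticChar F (MvPolynomial.eval y D) : ℝ)
    rw [hS, ← e]
    exact Equiv.sum_comp (MulAction.toPerm (Units.mk0 s hs) : Equiv.Perm (σ → F))
      fun y => (quadraticChar F (MvPolynomial.eval ((Equiv.addLeft x) y) D) : ℝ)
  have htot : ∑ w : σ → F, ∑ s : F, (quadraticChar F ((lineRestrict D x w).eval s) : ℝ) =
      (q - 1) * S := by
    rw [Finset.sum_comm, ← Finset.add_sum_erase _ _ (Finset.mem_univ (0 : F))]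
    simp only [eval_lineRestrict]
    rw [Finset.sum_congr rfl fun s hs => hshift s (Finset.ne_of_mem_erase hs)]
    simp [h0, Finset.card_erase_of_mem, Finset.card_univ, ← hqdef]
    left
    rw [Nat.cast_sub (by have : (1:ℝ) ≤ q := by linarith
                         exact_mod_cast this)]
    simp
  obtain ⟨c, hc⟩ := exists_coeff_one_lineRestrict D x
  have hc0 : c ≠ 0 := by
    rintro rfl
    apply h1
    rw [hc]; simp
  have hbad := card_mul_card_filter_sum_mul_eq_zero_le c hc0
  set B := Finset.univ.filter fun v : σ → F => ∑ i, v i * c i = 0 with hB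
  have hbad' : (q : ℝ) * B.card ≤ q ^ N := by exact_mod_cast hbad
  have hpt : ∀ w : σ → F, |∑ s : F, (quadraticChar F ((lineRestrict D x w).eval s) : ℝ)| ≤
      45 * d * √(q : ℝ) + if w ∈ B then (q : ℝ) else 0 := by
    intro w
    by_cases hw : w ∈ B
    · rw [if_pos hw]
      have : |∑ s : F, (quadraticChar F ((lineRestrict D x w).eval s) : ℝ)| ≤ ∑ s : F, 1 := by
        refine (Finset.abs_sum_le_sum_abs _ _).trans (Finset.sum_le_sum fun s _ => ?_)
        by_cases hx : (lineRestrict D x w).eval s = 0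
        · simp [hx]
        · rcases quadraticChar_dichotomy hx with h | h <;> simp [h]
      simp only [Finset.sum_const, Finset.card_univ, nsmul_eq_mul, mul_one, ← hqdef] at this
      have : 0 ≤ 45 * (d : ℝ) * √(q : ℝ) := by positivity
      linarith
    · rw [if_neg hw, add_zero]
      have hw1 : (lineRestrict D x w).coeff 1 ≠ 0 := by
        rw [hc]; simpa [hB] using hw
      refine (abs_sum_quadraticChar_le hq _ (by rw [coeff_zero_lineRestrict, h0]) hw1).trans ?_
      have : ((lineRestrict D x w).natDegree : ℝ) ≤ d := by
        exact_mod_cast (natDegree_lineRestrict_le D x w).trans hd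
      gcongr
  have hfin : (q - 1) * |S| ≤ 47 * d * √(q : ℝ) * q ^ N := by
    calc (q - 1) * |S| = |(q - 1) * S| := by rw [abs_mul, abs_of_nonneg (by linarith : (0 : ℝ) ≤ q - 1)]
      _ ≤ ∑ w : σ → F, |∑ s : F, (quadraticChar F ((lineRestrict D x w).eval s) : ℝ)| := by
          rw [← htot]; exact Finset.abs_sum_le_sum_abs _ _
      _ ≤ ∑ w : σ → F, (45 * d * √(q : ℝ) + if w ∈ B then (q : ℝ) else 0) :=
          Finset.sum_le_sum fun w _ => hpt w
      _ = 45 * d * √(q : ℝ) * q ^ N + q * B.card := by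
          rw [Finset.sum_add_distrib, ← Finset.sum_filter]
          simp [N, ← hqdef]
          ring
      _ ≤ 45 * d * √(q : ℝ) * q ^ N + 1 * q ^ N := by linarith
      _ ≤ 45 * d * √(q : ℝ) * q ^ N + (2 * d * √(q : ℝ)) * q ^ N := by
          gcongr; nlinarith
      _ = _ := by ring
  have : 0 ≤ |S| := abs_nonneg _
  nlinarith

end Lines

section Pellet

open UniqueFactorizationMonoid

lemma resultant_eq_of_monic {R : Type*} [CommRing R] {f g : R[X]} (hf : f.Monic) {n : ℕ}
    (hn : g.natDegree ≤ n) : resultant f g f.natDegree n = resultant f g := by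
  obtain ⟨k, rfl⟩ := Nat.exists_eq_add_of_le hn
  rw [resultant_add_right_deg _ _ _ _ _ le_rfl, hf.coeff_natDegree, one_pow, one_mul]

lemma resultant_mul_right_of_monic {R : Type*} [CommRing R] {f : R[X]} (hf : f.Monic)
    (g h : R[X]) : resultant f (g * h) = resultant f g * resultant f h := by
  rw [← resultant_mul_right f g h _ le_rfl, resultant_eq_of_monic hf natDegree_mul_le]

lemma resultant_mul_left_of_monic {R : Type*} [CommRing R] {f g : R[X]} (hf : f.Monic)
    (hg : g.Monic) (h : R[X]) : resultant (f * g) h = resultant f h * resultant g h := by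
  rw [← resultant_mul_left f g h _ le_rfl, hf.natDegree_mul hg]

lemma resultant_add_mul_of_monic {R : Type*} [CommRing R] {f : R[X]} (hf : f.Monic)
    (g h : R[X]) : resultant f (g + f * h) = resultant f g := by
  set n := max g.natDegree (max (g + f * h).natDegree (h.natDegree + f.natDegree))
  rw [← resultant_eq_of_monic hf (n := n) (by simp [n]),
    resultant_add_mul_right _ _ _ _ _ (by simp [n]) le_rfl,
    resultant_eq_of_monic hf (by simp [n])]

variable {F : Type*} [Field F]

/-- The sign `(-1) ^ (m (m - 1) / 2)`. -/
def choiceSign (F : Type*) [Field F] (m : ℕ) : F := (-1) ^ (m.choose 2)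

lemma choose_two_add (a b : ℕ) : (a + b).choose 2 = a.choose 2 + b.choose 2 + a * b := by
  induction b with
  | zero => simp
  | succ b ih =>
    rw [← add_assoc, Nat.choose_succ_succ' (a + b) 1, ih, Nat.choose_succ_succ' b 1]
    simp; ring

lemma choiceSign_add (a b : ℕ) :
    choiceSign F (a + b) * (-1) ^ (a * b) = choiceSign F a * choiceSign F b := by
  rw [choiceSign, choose_two_add, pow_add, pow_add, choiceSign, choiceSign, mul_assoc, ← mul_pow]
  simp

/-- The discriminant of a monic polynomial. -/
noncomputable def monicDisc (f : F[X]) : F :=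
  choiceSign F f.natDegree * resultant f (derivative f)

lemma monicDisc_mul {f g : F[X]} (hf : f.Monic) (hg : g.Monic) :
    monicDisc (f * g) = monicDisc f * monicDisc g * resultant f g ^ 2 := by
  have h1 : resultant (f * g) (derivative (f * g)) =
      resultant f (derivative f) * resultant g (derivative g) *
        (resultant f g * resultant g f) := by
    rw [resultant_mul_left_of_monic hf hg, derivative_mul, resultant_add_mul_of_monic hf,
      resultant_mul_right_of_monic hf, add_comm (derivative f * g), mul_comm (derivative f),
      resultant_add_mul_of_monic hg, resultant_mul_right_of_monic hg]
    ring
  rw [monicDisc, monicDisc, monicDisc, h1, hf.natDegree_mul hg, resultant_comm g f]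
  have := choiceSign_add (F := F) f.natDegree g.natDegree
  rw [mul_comm g.natDegree]
  linear_combination (resultant f (derivative f) * resultant g (derivative g) *
        (resultant f g * resultant f g)) * this

variable [Fintype F] [DecidableEq F]

lemma prod_Ioi_neg_one {R : Type*} [CommRing R] (m : ℕ) :
    ∏ i : Fin m, ∏ _j ∈ Finset.Ioi i, (-1 : R) = (-1) ^ (m.choose 2) := by
  simp only [Finset.prod_const, Finset.prod_pow_eq_pow_sum]
  congr 1
  induction m with
  | zero => simp
  | succ m ih =>
    rw [Fin.sum_univ_succ, Nat.choose_succ_succ' m 1, ← ih]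
    simp [Nat.sub_sub, Nat.add_comm]

lemma quadraticChar_monicDisc_of_irreducible (hF : ringChar F ≠ 2) {P : F[X]} (hP : P.Monic)
    (hirr : Irreducible P) :
    quadraticChar F (monicDisc P) = (-1) ^ (P.natDegree - 1) := by
  have := Fact.mk hirr
  let K := AdjoinRoot P
  let pb : PowerBasis F K := AdjoinRoot.powerBasis hirr.ne_zero
  have : Module.Finite F K := pb.finite
  have : Finite K := Module.finite_of_finite F
  have hrank : Module.finrank F K = P.natDegree := by
    rw [pb.finrank, AdjoinRoot.powerBasis_dim]
  set m := P.natDegree with hm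
  have hm0 : 0 < m := hirr.natDegree_pos
  let φ : K ≃ₐ[F] K := FiniteField.frobeniusAlgEquivOfAlgebraic F K
  have hord : orderOf φ = m := by
    rw [← hrank]; exact FiniteField.orderOf_frobeniusAlgEquivOfAlgebraic F K
  let α : Fin m → K := fun i => (φ ^ (i : ℕ)) (AdjoinRoot.root P)
  have hinj : Function.Injective α := by
    intro i j hij
    have h1 : φ ^ (i : ℕ) = φ ^ (j : ℕ) := by
      apply AlgEquiv.coe_toAlgHom_injective
      apply AdjoinRoot.algHom_ext
      exact hij
    exact Fin.ext (pow_injOn_Iio_orderOf (by simp [hord]) (by simp [hord]) h1)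
  have hroot : ∀ i, eval (α i) (P.map (algebraMap F K)) = 0 := by
    intro i
    have h := aeval_algHom_apply ((φ ^ (i : ℕ) : K ≃ₐ[F] K) : K →ₐ[F] K) (AdjoinRoot.root P) P
    rw [AdjoinRoot.aeval_eq, AdjoinRoot.mk_self, map_zero] at h
    rw [eval_map_algebraMap]
    exact h
  have hfac : P.map (algebraMap F K) = ∏ i, (X - C (α i)) := by
    apply eq_of_monic_of_dvd_of_natDegree_le (monic_prod_X_sub_C _ _) (hP.map _)
    · refine Finset.prod_dvd_of_coprime ?_ fun i _ => dvd_iff_isRoot.2 (hroot i)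
      intro i _ j _ hij
      exact pairwise_coprime_X_sub_C hinj hij
    · rw [natDegree_prod_of_monic _ _ fun i _ => monic_X_sub_C _, natDegree_map]
      simp [hm]
  set v : K := (Matrix.vandermonde α).det with hv
  have hv0 : v ≠ 0 := Matrix.det_vandermonde_ne_zero_iff.2 hinj
  have hdisc : algebraMap F K (monicDisc P) = v ^ 2 := by
    have h1 : algebraMap F K (resultant P (derivative P)) =
        ∏ i, ∏ j ∈ {i}ᶜ, (α i - α j) := by
      rw [← resultant_map_map, ← derivative_map]
      have hn : (derivative P).natDegree = (derivative (P.map (algebraMap F K))).natDegree := by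
        rw [derivative_map, natDegree_map]
      have hn' : P.natDegree = (P.map (algebraMap F K)).natDegree := (natDegree_map _).symm
      rw [hn, hn', hfac]
      rw [resultant_prod_left _ _ _ _ (by simp) le_rfl]
      refine Finset.prod_congr rfl fun i _ => ?_
      rw [natDegree_X_sub_C, resultant_X_sub_C_left _ _ _ le_rfl]
      have := Lagrange.eval_nodal_derivative_eval_node_eq (s := Finset.univ) (v := α)
        (Finset.mem_univ i)
      rw [Lagrange.nodal] at this
      rw [this, Lagrange.eval_nodal, Finset.compl_singleton]
    rw [← Finset.prod_prod_Ioi_mul_eq_prod_prod_off_diag] at h1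
    have h2 : ∏ i, ∏ j ∈ Finset.Ioi i, ((α i - α j) * (α j - α i)) =
        (-1) ^ (m.choose 2) * v ^ 2 := by
      rw [hv, Matrix.det_vandermonde, ← prod_Ioi_neg_one, ← Finset.prod_pow,
        ← Finset.prod_mul_distrib]
      refine Finset.prod_congr rfl fun i _ => ?_
      rw [← Finset.prod_pow, ← Finset.prod_mul_distrib]
      refine Finset.prod_congr rfl fun j _ => ?_
      ring
    rw [monicDisc, map_mul, h1, h2, choiceSign, ← hm, map_pow, map_neg, map_one, ← mul_assoc,
      ← pow_add, Even.neg_one_pow ⟨_, rfl⟩, one_mul]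
  have hfrob : v ^ Fintype.card F = (-1) ^ (m - 1) * v := by
    have h1 : φ v = v ^ Fintype.card F := rfl
    have h2 : ∀ i, φ (α i) = α (finRotate m i) := by
      intro i
      obtain ⟨k, hk⟩ : ∃ k, m = k + 1 := ⟨m - 1, by omega⟩
      have e : (φ ^ ((i : ℕ) + 1)) = φ ^ ((finRotate m i : Fin m) : ℕ) := by
        rw [pow_eq_pow_iff_modEq, hord]
        clear_value m φ α
        subst hk
        rw [finRotate_apply, Fin.val_add, Fin.val_one', Nat.add_mod_mod]
        exact (Nat.mod_modEq _ _).symm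
      have : φ (α i) = (φ ^ ((i : ℕ) + 1)) (AdjoinRoot.root P) := by
        rw [pow_succ']; rfl
      rw [this, e]
    rw [← h1, hv, AlgEquiv.map_det]
    have h3 : φ.mapMatrix (Matrix.vandermonde α) =
        (Matrix.vandermonde α).submatrix (finRotate m) id := by
      ext i j
      simp [Matrix.vandermonde_apply, h2]
    rw [h3, Matrix.det_permute, sign_finRotate]
    simp
  have hne : monicDisc P ≠ 0 := by
    intro h
    rw [h, map_zero] at hdisc
    exact hv0 (pow_eq_zero_iff two_ne_zero |>.1 hdisc.symm)
  have hodd : 2 * (Fintype.card F / 2) + 1 = Fintype.card F := by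
    have := FiniteField.odd_card_of_char_ne_two hF
    omega
  have h3 : (monicDisc P) ^ (Fintype.card F / 2) = (-1) ^ (m - 1) := by
    apply (algebraMap F K).injective
    rw [map_pow, hdisc, ← pow_mul, map_pow, map_neg, map_one]
    apply mul_right_cancel₀ hv0
    rw [← hfrob, ← pow_succ, hodd]
  rw [← quadraticChar_eq_pow_of_char_ne_two' hF] at h3
  have h11 : (1 : F) ≠ -1 := (Ring.neg_one_ne_one_of_char_ne_two hF).symm
  have h4 : ((quadraticChar F (monicDisc P) : ℤ) : F) = (((-1) ^ (m - 1) : ℤ) : F) := by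
    rw [h3]; push_cast; rfl
  rcases quadraticChar_dichotomy hne with h | h <;>
  rcases neg_one_pow_eq_or ℤ (m - 1) with h' | h' <;>
  rw [h, h'] at h4 ⊢
  · exact absurd (by simpa using h4) h11
  · exact absurd (by simpa using h4) h11.symm

lemma moebius_eq_quadraticChar (hF : ringChar F ≠ 2) {f : F[X]} (hf : f.Monic) :
    moebius f = (-1) ^ f.natDegree * quadraticChar F (monicDisc f) := by
  by_cases hsq : Squarefree f
  · induction hn : f.natDegree using Nat.strong_induction_on generalizing f with
    | _ n ih =>
      subst hn
      by_cases h1 : f = 1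
      · subst h1
        simp [monicDisc, choiceSign]
      · obtain ⟨P, hP, hPi, g, rfl⟩ := exists_monic_irreducible_factor f
          (fun h => h1 (hf.isUnit_iff.1 h))
        have hg : g.Monic := hP.of_mul_monic_left hf
        have hsq' := squarefree_mul_iff.1 hsq
        have hdeg : (P * g).natDegree = P.natDegree + g.natDegree := hP.natDegree_mul hg
        have hpos := hPi.natDegree_pos
        have hcop : IsCoprime P g := hsq'.1.isCoprime
        have hR : resultant P g ≠ 0 := by
          intro h
          exact (resultant_eq_zero_iff.1 h).2 hcop
        rw [hsq'.1.moebius_mul, ih g.natDegree (by omega) hg hsq'.2.2 rfl, monicDisc_mul hP hg,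
          map_mul, map_mul, quadraticChar_sq_one' hR, hPi.moebius_eq,
          quadraticChar_monicDisc_of_irreducible hF hP hPi, hdeg]
        obtain ⟨k, hk⟩ : ∃ k, P.natDegree = k + 1 := ⟨P.natDegree - 1, by omega⟩
        rw [hk, Nat.add_sub_cancel, pow_add, pow_add]
        have : ((-1 : ℤ) ^ k) * (-1) ^ k = 1 := by
          rw [← pow_add, Even.neg_one_pow ⟨_, rfl⟩]
        linear_combination (-(-1) ^ g.natDegree * quadraticChar F (monicDisc g)) * -this
  · have hcop : ¬ IsCoprime f (derivative f) := by
      intro h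
      exact hsq (PerfectField.separable_iff_squarefree.1 h)
    have : resultant f (derivative f) = 0 :=
      resultant_eq_zero_iff.2 ⟨Or.inl hf.ne_zero, hcop⟩
    rw [moebius_of_not_squarefree hsq, monicDisc, this]
    simp

end Pellet

section Monics

variable {S : Type*} [CommRing S]

/-- The polynomial of degree less than `m` with given coefficients. -/
noncomputable def lowPoly {m : ℕ} (a : Fin m → S) : S[X] := ∑ i : Fin m, C (a i) * X ^ (i : ℕ)

/-- The monic polynomial of degree `m` with given lower coefficients. -/
noncomputable def monicOf {m : ℕ} (a : Fin m → S) : S[X] := X ^ m + lowPoly a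

lemma coeff_lowPoly {m : ℕ} (a : Fin m → S) (k : ℕ) :
    (lowPoly a).coeff k = if h : k < m then a ⟨k, h⟩ else 0 := by
  simp only [lowPoly, finsetSum_coeff, coeff_C_mul, coeff_X_pow]
  split_ifs with h
  · rw [Finset.sum_eq_single ⟨k, h⟩]
    · simp
    · intro b _ hb
      have : k ≠ b := fun e => hb (Fin.ext e.symm)
      simp [this]
    · simp
  · refine Finset.sum_eq_zero fun i _ => ?_
    have : k ≠ i := by have := i.2; omega
    simp [this]

lemma degree_lowPoly_lt {m : ℕ} (a : Fin m → S) : (lowPoly a).degree < m := by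
  rw [degree_lt_iff_coeff_zero]
  intro k hk
  rw [coeff_lowPoly, dif_neg (by simpa using hk)]

lemma monic_monicOf {m : ℕ} (a : Fin m → S) : (monicOf a).Monic :=
  monic_X_pow_add (degree_lowPoly_lt a)

lemma natDegree_monicOf [Nontrivial S] {m : ℕ} (a : Fin m → S) : (monicOf a).natDegree = m := by
  rw [monicOf, natDegree_add_eq_left_of_degree_lt, natDegree_X_pow]
  rw [degree_X_pow]; exact degree_lowPoly_lt a

lemma lowPoly_injective (m : ℕ) : Function.Injective (lowPoly : (Fin m → S) → S[X]) := by
  intro a b h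
  funext i
  have := congrArg (fun p => coeff p i) h
  simpa [coeff_lowPoly] using this

lemma monicOf_injective (m : ℕ) : Function.Injective (monicOf : (Fin m → S) → S[X]) :=
  fun _ _ h => lowPoly_injective m (add_left_cancel h)

lemma lowPoly_coeff {m : ℕ} {p : S[X]} (hp : p.degree < m) :
    lowPoly (fun i : Fin m => p.coeff i) = p := by
  ext k
  rw [coeff_lowPoly]
  split_ifs with h
  · rfl
  · exact ((degree_lt_iff_coeff_zero _ _).1 hp k (by simpa using h)).symm

lemma monicOf_coeff {m : ℕ} {p : S[X]} (hp : p.Monic) (hm : p.natDegree = m) :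
    monicOf (fun i : Fin m => p.coeff i) = p := by
  nontriviality S
  have h : (p - X ^ m : S[X]).degree < (m : WithBot ℕ) := by
    have := degree_sub_lt_left (p := p) (q := X ^ m)
      (by rw [degree_X_pow, degree_eq_natDegree hp.ne_zero, hm]) hp.ne_zero
      (by rw [hp.leadingCoeff, (monic_X_pow m).leadingCoeff])
    rwa [degree_eq_natDegree hp.ne_zero, hm] at this
  have := lowPoly_coeff h
  have e : (fun i : Fin m => p.coeff i) = fun i : Fin m => (p - X ^ m : S[X]).coeff i := by
    funext i
    have := i.2
    simp [coeff_X_pow, this.ne]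
  rw [monicOf, e, this, add_sub_cancel]

lemma map_lowPoly {T : Type*} [CommRing T] (φ : S →+* T) {m : ℕ} (a : Fin m → S) :
    (lowPoly a).map φ = lowPoly (φ ∘ a) := by
  simp [lowPoly, Polynomial.map_sum]

lemma map_monicOf {T : Type*} [CommRing T] (φ : S →+* T) {m : ℕ} (a : Fin m → S) :
    (monicOf a).map φ = monicOf (φ ∘ a) := by
  simp [monicOf, map_lowPoly]

end Monics

section Divisors

open UniqueFactorizationMonoid

variable {F : Type*} [Field F] [Fintype F] [DecidableEq F]

/-- Monic polynomials of degree `m`. -/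
noncomputable def monics (F : Type*) [Field F] [Fintype F] [DecidableEq F] (m : ℕ) :
    Finset F[X] := Finset.univ.image (monicOf : (Fin m → F) → F[X])

lemma mem_monics {m : ℕ} {f : F[X]} : f ∈ monics F m ↔ f.Monic ∧ f.natDegree = m := by
  constructor
  · intro h
    obtain ⟨a, -, rfl⟩ := Finset.mem_image.1 h
    exact ⟨monic_monicOf a, natDegree_monicOf a⟩
  · rintro ⟨h1, h2⟩
    exact Finset.mem_image.2 ⟨_, Finset.mem_univ _, monicOf_coeff h1 h2⟩

lemma card_monics (m : ℕ) : (monics F m).card = Fintype.card F ^ m := by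
  rw [monics, Finset.card_image_of_injective _ (monicOf_injective m), Finset.card_univ,
    Fintype.card_fun, Fintype.card_fin]

lemma sum_monics {M : Type*} [AddCommMonoid M] (m : ℕ) (φ : F[X] → M) :
    ∑ G ∈ monics F m, φ G = ∑ a : Fin m → F, φ (monicOf a) :=
  Finset.sum_image fun _ _ _ _ h => monicOf_injective m h

/-- Monic divisors of a nonzero polynomial. -/
noncomputable def monicDivisors (f : F[X]) : Finset F[X] :=
  open scoped Classical in
  (Finset.range (f.natDegree + 1)).biUnion fun i => (monics F i).filter (· ∣ f)

lemma mem_monicDivisors {f G : F[X]} (hf : f ≠ 0) :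
    G ∈ monicDivisors f ↔ G.Monic ∧ G ∣ f := by
  simp only [monicDivisors, Finset.mem_biUnion, Finset.mem_range, Finset.mem_filter, mem_monics]
  constructor
  · rintro ⟨i, -, ⟨h, -⟩, h'⟩; exact ⟨h, h'⟩
  · rintro ⟨h, h'⟩
    exact ⟨_, Nat.lt_succ_of_le (natDegree_le_of_dvd h' hf), ⟨h, rfl⟩, h'⟩

lemma card_monicDivisors_le {f : F[X]} (hf : f.Monic) :
    (monicDivisors f).card ≤ 2 ^ f.natDegree := by
  induction hn : f.natDegree using Nat.strong_induction_on generalizing f with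
  | _ n ih =>
    by_cases h1 : f = 1
    · subst h1
      have : monicDivisors (1 : F[X]) ⊆ {1} := by
        intro G hG
        rw [mem_monicDivisors one_ne_zero] at hG
        exact Finset.mem_singleton.2 (hG.1.eq_one_of_isUnit (isUnit_of_dvd_one hG.2))
      exact (Finset.card_le_card this).trans Nat.one_le_two_pow
    · obtain ⟨P, hP, hPi, g, rfl⟩ := exists_monic_irreducible_factor f
        (fun h => h1 (hf.isUnit_iff.1 h))
      have hg : g.Monic := hP.of_mul_monic_left hf
      have hdeg : (P * g).natDegree = P.natDegree + g.natDegree := hP.natDegree_mul hg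
      have hpos := hPi.natDegree_pos
      have hsub : monicDivisors (P * g) ⊆ monicDivisors g ∪ (monicDivisors g).image (P * ·) := by
        intro G hG
        rw [mem_monicDivisors hf.ne_zero] at hG
        rw [Finset.mem_union]
        by_cases hPG : P ∣ G
        · right
          obtain ⟨w, rfl⟩ := hPG
          exact Finset.mem_image.2 ⟨w, (mem_monicDivisors hg.ne_zero).2
            ⟨hP.of_mul_monic_left hG.1, (mul_dvd_mul_iff_left hP.ne_zero).1 hG.2⟩, rfl⟩
        · left
          exact (mem_monicDivisors hg.ne_zero).2 ⟨hG.1,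
            ((hPi.coprime_iff_not_dvd.2 hPG).symm).dvd_of_dvd_mul_left hG.2⟩
      have h2 := ih g.natDegree (by omega) hg rfl
      calc (monicDivisors (P * g)).card
          ≤ (monicDivisors g).card + ((monicDivisors g).image (P * ·)).card :=
            (Finset.card_le_card hsub).trans (Finset.card_union_le _ _)
        _ ≤ 2 ^ g.natDegree + 2 ^ g.natDegree :=
            add_le_add h2 (Finset.card_image_le.trans h2)
        _ = 2 ^ (g.natDegree + 1) := by ring
        _ ≤ 2 ^ n := Nat.pow_le_pow_right (by norm_num) (by omega)

open scoped Classical in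
/-- Pairing off the squarefree divisors containing a given prime `P` with those that do not. -/
lemma sum_mul_moebius_eq {f P : F[X]} (hf : f.Monic) (hP : P.Monic) (hPi : Irreducible P)
    (hPf : P ∣ f) (φ : F[X] → ℤ) :
    ∑ G ∈ monicDivisors f, φ G * moebius G =
      ∑ G ∈ (monicDivisors f).filter (¬ P ∣ ·), (φ G - φ (P * G)) * moebius G := by
  rw [← Finset.sum_filter_not_add_sum_filter (monicDivisors f) (P ∣ ·)]
  have : ∑ G ∈ (monicDivisors f).filter (P ∣ ·), φ G * moebius G =
      ∑ G ∈ (monicDivisors f).filter (¬ P ∣ ·), φ (P * G) * moebius (P * G) := by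
    symm
    refine Finset.sum_bij_ne_zero (fun G _ _ => P * G) ?_ ?_ ?_ ?_
    · intro G hG _
      rw [Finset.mem_filter, mem_monicDivisors hf.ne_zero] at hG ⊢
      exact ⟨⟨hP.mul hG.1.1, (hPi.coprime_iff_not_dvd.2 hG.2).mul_dvd hPf hG.1.2⟩, dvd_mul_right _ _⟩
    · intro G _ _ G' _ _ h
      exact mul_left_cancel₀ hP.ne_zero h
    · intro G hG h0
      rw [Finset.mem_filter, mem_monicDivisors hf.ne_zero] at hG
      obtain ⟨⟨hGm, hGf⟩, w, rfl⟩ := hG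
      have hsq : Squarefree (P * w) := by
        by_contra h
        rw [moebius_of_not_squarefree h, mul_zero] at h0
        exact h0 rfl
      have hPw : ¬ P ∣ w := by
        rintro ⟨z, rfl⟩
        exact hPi.not_isUnit (hsq P ⟨z, by ring⟩)
      refine ⟨w, ?_, h0, rfl⟩
      rw [Finset.mem_filter, mem_monicDivisors hf.ne_zero]
      exact ⟨⟨hP.of_mul_monic_left hGm, (dvd_mul_left _ _).trans hGf⟩, hPw⟩
    · intro G _ _; rfl
  rw [this, ← Finset.sum_add_distrib]
  refine Finset.sum_congr rfl fun G hG => ?_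
  have hcop : IsRelPrime P G :=
    (hPi.coprime_iff_not_dvd.2 (Finset.mem_filter.1 hG).2).isRelPrime
  rw [hcop.moebius_mul, hPi.moebius_eq]
  ring

lemma sum_moebius_eq {f : F[X]} (hf : f.Monic) :
    ∑ G ∈ monicDivisors f, moebius G = if f = 1 then 1 else 0 := by
  classical
  split_ifs with h1
  · subst h1
    have : monicDivisors (1 : F[X]) = {1} := by
      ext G
      rw [mem_monicDivisors one_ne_zero, Finset.mem_singleton]
      exact ⟨fun h => h.1.eq_one_of_isUnit (isUnit_of_dvd_one h.2),
        by rintro rfl; exact ⟨monic_one, dvd_rfl⟩⟩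
    rw [this, Finset.sum_singleton, moebius_one]
  · obtain ⟨P, hP, hPi, hPf⟩ := exists_monic_irreducible_factor f
      (fun h => h1 (hf.isUnit_iff.1 h))
    have := sum_mul_moebius_eq hf hP hPi hPf (fun _ => 1)
    simpa using this

lemma sum_sub_two_mul_natDegree_mul_moebius {f : F[X]} (hf : f.Monic) (hsq : Squarefree f)
    (h1 : f ≠ 1) [Decidable (Irreducible f)] :
    ∑ G ∈ monicDivisors f, ((f.natDegree : ℤ) - 2 * G.natDegree) * moebius G =
      if Irreducible f then 2 * (f.natDegree : ℤ) else 0 := by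
  classical
  obtain ⟨P, hP, hPi, g, rfl⟩ := exists_monic_irreducible_factor f
      (fun h => h1 (hf.isUnit_iff.1 h))
  have hg : g.Monic := hP.of_mul_monic_left hf
  have hPg : ¬ P ∣ g := by
    rintro ⟨z, rfl⟩
    exact hPi.not_isUnit (hsq P ⟨z, by ring⟩)
  rw [sum_mul_moebius_eq hf hP hPi (dvd_mul_right P g)
    (fun G => ((P * g).natDegree : ℤ) - 2 * G.natDegree)]
  have hset : (monicDivisors (P * g)).filter (¬ P ∣ ·) = monicDivisors g := by
    ext G
    rw [Finset.mem_filter, mem_monicDivisors hf.ne_zero, mem_monicDivisors hg.ne_zero]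
    constructor
    · rintro ⟨⟨h, h'⟩, h''⟩
      exact ⟨h, ((hPi.coprime_iff_not_dvd.2 h'').symm).dvd_of_dvd_mul_left h'⟩
    · rintro ⟨h, h'⟩
      exact ⟨⟨h, h'.mul_left _⟩, fun h'' => hPg (h''.trans h')⟩
  rw [hset]
  have : ∀ G ∈ monicDivisors g, (((P * g).natDegree : ℤ) - 2 * G.natDegree -
      (((P * g).natDegree : ℤ) - 2 * (P * G).natDegree)) * moebius G =
      2 * P.natDegree * moebius G := by
    intro G hG
    rw [mem_monicDivisors hg.ne_zero] at hG
    rw [hP.natDegree_mul hG.1]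
    push_cast; ring
  rw [Finset.sum_congr rfl this, ← Finset.mul_sum, sum_moebius_eq hg]
  by_cases hg1 : g = 1
  · subst hg1
    simp [hPi]
  · have : ¬ Irreducible (P * g) := fun h => by
      rcases h.isUnit_or_isUnit rfl with h | h
      · exact hPi.not_isUnit h
      · exact hg1 (hg.isUnit_iff.1 h)
    simp [hg1, this]

open scoped Classical in
/-- The indicator of irreducibility in terms of the Möbius values of divisors of small degree. -/
theorem two_mul_natDegree_mul_irreducible {f : F[X]} (hf : f.Monic) (h1 : f ≠ 1) :
    (if Irreducible f then 2 * (f.natDegree : ℤ) else 0) =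
      (moebius f ^ 2 - moebius f) *
        ∑ G ∈ (monicDivisors f).filter (2 * ·.natDegree < f.natDegree),
          ((f.natDegree : ℤ) - 2 * G.natDegree) * moebius G := by
  by_cases hsq : Squarefree f
  · have hpm : moebius f = 1 ∨ moebius f = -1 := by
      rw [hsq.moebius_eq]; exact neg_one_pow_eq_or ℤ _
    rcases hpm with h | h
    · have : ¬ Irreducible f := fun hi => by rw [hi.moebius_eq] at h; norm_num at h
      rw [h, if_neg this]; norm_num
    · rw [← sum_sub_two_mul_natDegree_mul_moebius hf hsq h1, h]
      rw [← Finset.sum_filter_add_sum_filter_not (monicDivisors f) (2 * ·.natDegree < f.natDegree)]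
      have : ∑ G ∈ (monicDivisors f).filter (¬ 2 * ·.natDegree < f.natDegree),
          ((f.natDegree : ℤ) - 2 * G.natDegree) * moebius G =
          ∑ G ∈ (monicDivisors f).filter (2 * ·.natDegree < f.natDegree),
          ((f.natDegree : ℤ) - 2 * G.natDegree) * moebius G := by
        have hdvd : ∀ G, G.Monic → G ∣ f → (f /ₘ G).Monic ∧ G * (f /ₘ G) = f ∧
            f.natDegree = G.natDegree + (f /ₘ G).natDegree ∧
            moebius G * moebius (f /ₘ G) = -1 := by
          intro G hG hGf
          have e : G * (f /ₘ G) = f := by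
            have := modByMonic_add_div f G
            rwa [(modByMonic_eq_zero_iff_dvd hG).2 hGf, zero_add] at this
          have hm : (f /ₘ G).Monic := hG.of_mul_monic_left (by rwa [e])
          refine ⟨hm, e, ?_, ?_⟩
          · rw [← hG.natDegree_mul hm, e]
          · rw [← e] at hsq
            rw [← (squarefree_mul_iff.1 hsq).1.moebius_mul, e, h]
        refine Finset.sum_bij_ne_zero (fun G _ _ => f /ₘ G) ?_ ?_ ?_ ?_
        · intro G hG h0
          rw [Finset.mem_filter, mem_monicDivisors hf.ne_zero] at hG ⊢
          obtain ⟨h2, h3, h4, -⟩ := hdvd G hG.1.1 hG.1.2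
          refine ⟨⟨h2, ⟨G, by rw [mul_comm, h3]⟩⟩, ?_⟩
          have h5 : f.natDegree ≠ 2 * G.natDegree := by
            intro h5
            apply h0
            rw [h5]; push_cast; ring
          have := hG.2
          omega
        · intro G hG _ G' hG' _ e
          rw [Finset.mem_filter, mem_monicDivisors hf.ne_zero] at hG hG'
          obtain ⟨h2, h3, -, -⟩ := hdvd G hG.1.1 hG.1.2
          obtain ⟨h2', h3', -, -⟩ := hdvd G' hG'.1.1 hG'.1.2
          exact mul_right_cancel₀ h2.ne_zero (h3.trans (h3'.symm.trans (congrArg (G' * ·) e.symm)))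
        · intro G hG h0
          rw [Finset.mem_filter, mem_monicDivisors hf.ne_zero] at hG
          obtain ⟨h2, h3, h4, h5⟩ := hdvd G hG.1.1 hG.1.2
          have h6 : f /ₘ (f /ₘ G) = G := by
            have h7 := (hdvd (f /ₘ G) h2 ⟨G, by rw [mul_comm, h3]⟩).2.1
            exact mul_left_cancel₀ h2.ne_zero (h7.trans (by rw [mul_comm, h3]))
          refine ⟨f /ₘ G, ?_, ?_, h6⟩
          · rw [Finset.mem_filter, mem_monicDivisors hf.ne_zero]
            refine ⟨⟨h2, ⟨G, by rw [mul_comm, h3]⟩⟩, ?_⟩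
            have := hG.2
            omega
          · have : moebius (f /ₘ G) ≠ 0 := by
              intro h; rw [h] at h5; norm_num at h5
            refine mul_ne_zero ?_ this
            have := hG.2
            omega
        · intro G hG h0
          rw [Finset.mem_filter, mem_monicDivisors hf.ne_zero] at hG
          obtain ⟨h2, h3, h4, h5⟩ := hdvd G hG.1.1 hG.1.2
          have h6 : moebius G = - moebius (f /ₘ G) := by
            rcases Int.mul_eq_neg_one_iff_eq_one_or_neg_one.1 h5 with ⟨a, b⟩ | ⟨a, b⟩ <;>
              simp [a, b]
          rw [h6, h4]
          push_cast; ring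
      rw [this]; ring
  · have : ¬ Irreducible f := fun hi => hsq hi.squarefree
    rw [moebius_of_not_squarefree hsq, if_neg this]
    norm_num

end Divisors

section Counting

open UniqueFactorizationMonoid

variable {F : Type*} [Field F] [Fintype F] [DecidableEq F]

omit [Fintype F] in
lemma exists_monic_irreducible_dvd_of_not_isCoprime {f g : F[X]} (hf : f ≠ 0)
    (h : ¬ IsCoprime f g) : ∃ P : F[X], P.Monic ∧ Irreducible P ∧ P ∣ f ∧ P ∣ g := by
  by_contra! H
  refine h (isCoprime_of_irreducible_dvd (fun h0 => hf h0.1) fun z hz hzf hzg => ?_)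
  have ha : Associated (normalize z) z := normalize_associated z
  exact H (normalize z) (monic_normalize hz.ne_zero) (ha.symm.irreducible hz)
    (ha.dvd.trans hzf) (ha.dvd.trans hzg)

omit [Fintype F] in
lemma exists_monic_sq_dvd_of_not_squarefree {f : F[X]} (hf : f ≠ 0) (h : ¬ Squarefree f) :
    ∃ P : F[X], P.Monic ∧ Irreducible P ∧ P ^ 2 ∣ f := by
  rw [squarefree_iff_irreducible_sq_not_dvd_of_ne_zero hf] at h
  push Not at h
  obtain ⟨z, hz, hzf⟩ := h
  have ha : Associated (normalize z) z := normalize_associated z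
  refine ⟨normalize z, monic_normalize hz.ne_zero, ha.symm.irreducible hz, ?_⟩
  exact (pow_dvd_pow_of_dvd ha.dvd 2).trans (by rwa [pow_two])

lemma card_monicDivisors_le_of_ne_zero {f : F[X]} (hf : f ≠ 0) :
    (monicDivisors f).card ≤ 2 ^ f.natDegree := by
  have h : monicDivisors f = monicDivisors (normalize f) := by
    ext G
    rw [mem_monicDivisors hf, mem_monicDivisors (by simpa using hf), dvd_normalize_iff]
  rw [h, ← natDegree_eq_of_degree_eq (degree_normalize (p := f))]
  exact card_monicDivisors_le (monic_normalize hf)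

open scoped Classical in
lemma card_mul_card_filter_dvd_le {P : F[X]} (hP : P.Monic) (hP1 : 0 < P.natDegree) (m : ℕ) :
    Fintype.card F * ((monics F m).filter (P ∣ ·)).card ≤ Fintype.card F ^ m := by
  by_cases hd : P.natDegree ≤ m
  · have : (monics F m).filter (P ∣ ·) ⊆ (monics F (m - P.natDegree)).image (P * ·) := by
      intro f hf
      rw [Finset.mem_filter, mem_monics] at hf
      obtain ⟨⟨hf, hm⟩, w, rfl⟩ := hf
      have hw := hP.of_mul_monic_left hf
      rw [hP.natDegree_mul hw] at hm
      exact Finset.mem_image.2 ⟨w, mem_monics.2 ⟨hw, by omega⟩, rfl⟩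
    have h2 := (Finset.card_le_card this).trans Finset.card_image_le
    rw [card_monics] at h2
    calc _ ≤ Fintype.card F * Fintype.card F ^ (m - P.natDegree) := Nat.mul_le_mul_left _ h2
      _ = Fintype.card F ^ (m - P.natDegree + 1) := by ring
      _ ≤ _ := Nat.pow_le_pow_right Fintype.card_pos (by omega)
  · have : (monics F m).filter (P ∣ ·) = ∅ := by
      refine Finset.filter_eq_empty_iff.2 fun f hf h => ?_
      rw [mem_monics] at hf
      have := natDegree_le_of_dvd h hf.1.ne_zero
      omega
    simp [this]

open scoped Classical in
lemma card_mul_card_not_isCoprime_le {A : F[X]} (hA : A ≠ 0) (m : ℕ) :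
    Fintype.card F * ((monics F m).filter (¬ IsCoprime · A)).card ≤
      2 ^ A.natDegree * Fintype.card F ^ m := by
  have hsub : (monics F m).filter (¬ IsCoprime · A) ⊆
      ((monicDivisors A).filter (0 < ·.natDegree)).biUnion
        fun P => (monics F m).filter (P ∣ ·) := by
    intro f hf
    rw [Finset.mem_filter] at hf
    have hf0 : f ≠ 0 := (mem_monics.1 hf.1).1.ne_zero
    obtain ⟨P, hP, hPi, hPf, hPA⟩ := exists_monic_irreducible_dvd_of_not_isCoprime hf0 hf.2
    refine Finset.mem_biUnion.2 ⟨P, ?_, Finset.mem_filter.2 ⟨hf.1, hPf⟩⟩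
    exact Finset.mem_filter.2 ⟨(mem_monicDivisors hA).2 ⟨hP, hPA⟩, hPi.natDegree_pos⟩
  calc _ ≤ Fintype.card F * ∑ P ∈ (monicDivisors A).filter (0 < ·.natDegree),
        ((monics F m).filter (P ∣ ·)).card :=
        Nat.mul_le_mul_left _ ((Finset.card_le_card hsub).trans Finset.card_biUnion_le)
    _ = ∑ P ∈ (monicDivisors A).filter (0 < ·.natDegree),
        Fintype.card F * ((monics F m).filter (P ∣ ·)).card := Finset.mul_sum _ _ _
    _ ≤ ∑ P ∈ (monicDivisors A).filter (0 < ·.natDegree), Fintype.card F ^ m := by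
        refine Finset.sum_le_sum fun P hP => ?_
        rw [Finset.mem_filter, mem_monicDivisors hA] at hP
        exact card_mul_card_filter_dvd_le hP.1.1 hP.2 m
    _ ≤ _ := by
        rw [Finset.sum_const, smul_eq_mul]
        exact Nat.mul_le_mul_right _ ((Finset.card_filter_le _ _).trans
          (card_monicDivisors_le_of_ne_zero hA))

open scoped Classical in
lemma card_mul_card_not_squarefree_le (m : ℕ) :
    Fintype.card F * ((monics F m).filter (¬ Squarefree ·)).card ≤ m * Fintype.card F ^ m := by
  have hsub : (monics F m).filter (¬ Squarefree ·) ⊆ ((Finset.Icc 1 m).filter (2 * · ≤ m)).biUnion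
      fun d => (monics F d ×ˢ monics F (m - 2 * d)).image fun p => p.1 ^ 2 * p.2 := by
    intro f hf
    rw [Finset.mem_filter, mem_monics] at hf
    obtain ⟨P, hP, hPi, w, rfl⟩ := exists_monic_sq_dvd_of_not_squarefree hf.1.1.ne_zero hf.2
    have hw := (hP.pow 2).of_mul_monic_left hf.1.1
    have hd := hf.1.2
    rw [(hP.pow 2).natDegree_mul hw, hP.natDegree_pow] at hd
    have := hPi.natDegree_pos
    refine Finset.mem_biUnion.2 ⟨P.natDegree, ?_, Finset.mem_image.2 ⟨(P, w), ?_, rfl⟩⟩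
    · rw [Finset.mem_filter, Finset.mem_Icc]; omega
    · rw [Finset.mem_product, mem_monics, mem_monics]
      exact ⟨⟨hP, rfl⟩, hw, by simp only; omega⟩
  calc _ ≤ Fintype.card F * ∑ d ∈ (Finset.Icc 1 m).filter (2 * · ≤ m),
        Fintype.card F ^ d * Fintype.card F ^ (m - 2 * d) := by
        refine Nat.mul_le_mul_left _ ((Finset.card_le_card hsub).trans
          (Finset.card_biUnion_le.trans (Finset.sum_le_sum fun d _ => ?_)))
        refine Finset.card_image_le.trans ?_
        rw [Finset.card_product, card_monics, card_monics]
    _ = ∑ d ∈ (Finset.Icc 1 m).filter (2 * · ≤ m), Fintype.card F ^ (1 + d + (m - 2 * d)) := by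
        rw [Finset.mul_sum]
        exact Finset.sum_congr rfl fun d _ => by ring
    _ ≤ ∑ d ∈ (Finset.Icc 1 m).filter (2 * · ≤ m), Fintype.card F ^ m := by
        refine Finset.sum_le_sum fun d hd => Nat.pow_le_pow_right Fintype.card_pos ?_
        rw [Finset.mem_filter, Finset.mem_Icc] at hd
        omega
    _ ≤ _ := by
        rw [Finset.sum_const, smul_eq_mul]
        exact Nat.mul_le_mul_right _ ((Finset.card_filter_le _ _).trans (by simp))

open scoped Classical in
lemma card_mul_card_pairs_not_isCoprime_le (a b : ℕ) :
    Fintype.card F * ((monics F a ×ˢ monics F b).filter fun p => ¬ IsCoprime p.1 p.2).card ≤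
      a * Fintype.card F ^ (a + b) := by
  have hsub : (monics F a ×ˢ monics F b).filter (fun p => ¬ IsCoprime p.1 p.2) ⊆
      ((Finset.Icc 1 a).filter (· ≤ b)).biUnion fun d =>
        (monics F d ×ˢ (monics F (a - d) ×ˢ monics F (b - d))).image
          fun p => (p.1 * p.2.1, p.1 * p.2.2) := by
    rintro ⟨f, g⟩ hf
    rw [Finset.mem_filter, Finset.mem_product, mem_monics, mem_monics] at hf
    obtain ⟨⟨⟨hf, hfd⟩, hg, hgd⟩, h⟩ := hf
    obtain ⟨P, hP, hPi, ⟨w, rfl⟩, z, rfl⟩ :=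
      exists_monic_irreducible_dvd_of_not_isCoprime hf.ne_zero h
    have hw := hP.of_mul_monic_left hf
    have hz := hP.of_mul_monic_left hg
    rw [hP.natDegree_mul hw] at hfd
    rw [hP.natDegree_mul hz] at hgd
    have := hPi.natDegree_pos
    refine Finset.mem_biUnion.2 ⟨P.natDegree, ?_, Finset.mem_image.2 ⟨(P, w, z), ?_, rfl⟩⟩
    · rw [Finset.mem_filter, Finset.mem_Icc]; omega
    · rw [Finset.mem_product, Finset.mem_product, mem_monics, mem_monics, mem_monics]
      exact ⟨⟨hP, rfl⟩, ⟨hw, by simp only; omega⟩, hz, by simp only; omega⟩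
  calc _ ≤ Fintype.card F * ∑ d ∈ (Finset.Icc 1 a).filter (· ≤ b),
        Fintype.card F ^ d * (Fintype.card F ^ (a - d) * Fintype.card F ^ (b - d)) := by
        refine Nat.mul_le_mul_left _ ((Finset.card_le_card hsub).trans
          (Finset.card_biUnion_le.trans (Finset.sum_le_sum fun d _ => ?_)))
        refine Finset.card_image_le.trans ?_
        rw [Finset.card_product, Finset.card_product, card_monics, card_monics, card_monics]
    _ = ∑ d ∈ (Finset.Icc 1 a).filter (· ≤ b),
        Fintype.card F ^ (1 + d + ((a - d) + (b - d))) := by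
        rw [Finset.mul_sum]
        exact Finset.sum_congr rfl fun d _ => by ring
    _ ≤ ∑ d ∈ (Finset.Icc 1 a).filter (· ≤ b), Fintype.card F ^ (a + b) := by
        refine Finset.sum_le_sum fun d hd => Nat.pow_le_pow_right Fintype.card_pos ?_
        rw [Finset.mem_filter, Finset.mem_Icc] at hd
        omega
    _ ≤ _ := by
        rw [Finset.sum_const, smul_eq_mul]
        exact Nat.mul_le_mul_right _ ((Finset.card_filter_le _ _).trans (by simp))

lemma card_monics_mul_sum_moebius (n : ℕ) :
    ∑ i ∈ Finset.range (n + 1), (Fintype.card F : ℤ) ^ (n - i) * ∑ G ∈ monics F i, moebius G =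
      if n = 0 then 1 else 0 := by
  classical
  have h1 : ∑ f ∈ monics F n, ∑ G ∈ monicDivisors f, moebius G = if n = 0 then 1 else 0 := by
    rw [Finset.sum_congr rfl fun f hf => sum_moebius_eq (mem_monics.1 hf).1, Finset.sum_ite_eq']
    simp only [mem_monics, monic_one, natDegree_one, true_and, eq_comm]
  rw [← h1]
  have h2 : ∀ f ∈ monics F n, ∑ G ∈ monicDivisors f, moebius G =
      ∑ i ∈ Finset.range (n + 1), ∑ G ∈ (monics F i).filter (· ∣ f), moebius G := by
    intro f hf
    rw [monicDivisors, (mem_monics.1 hf).2, Finset.sum_biUnion]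
    intro i _ j _ hij
    refine Finset.disjoint_left.2 fun G hG hG' => hij ?_
    rw [Finset.mem_filter, mem_monics] at hG hG'
    exact hG.1.2.symm.trans hG'.1.2
  rw [Finset.sum_congr rfl h2, Finset.sum_comm]
  refine Finset.sum_congr rfl fun i hi => ?_
  rw [Finset.mem_range] at hi
  simp only [Finset.sum_filter]
  rw [Finset.sum_comm, Finset.mul_sum]
  refine Finset.sum_congr rfl fun G hG => ?_
  rw [← Finset.sum_filter, Finset.sum_const, nsmul_eq_mul]
  congr 1
  rw [mem_monics] at hG
  have : (monics F n).filter (G ∣ ·) = (monics F (n - i)).image (G * ·) := by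
    ext f
    simp only [Finset.mem_filter, Finset.mem_image, mem_monics]
    constructor
    · rintro ⟨⟨hf, hd⟩, w, rfl⟩
      have hw := hG.1.of_mul_monic_left hf
      rw [hG.1.natDegree_mul hw] at hd
      exact ⟨w, ⟨hw, by omega⟩, rfl⟩
    · rintro ⟨w, ⟨hw, hd⟩, rfl⟩
      exact ⟨⟨hG.1.mul hw, by rw [hG.1.natDegree_mul hw]; omega⟩, dvd_mul_right _ _⟩
  rw [this, Finset.card_image_of_injective _ (mul_right_injective₀ hG.1.ne_zero), card_monics]
  push_cast; rfl

/-- The sum of the Möbius function over monic polynomials of degree `i`. -/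
lemma sum_monics_moebius (i : ℕ) : ∑ G ∈ monics F i, moebius G =
    if i = 0 then 1 else if i = 1 then -(Fintype.card F : ℤ) else 0 := by
  have h0 := card_monics_mul_sum_moebius (F := F) 0
  have h1 := card_monics_mul_sum_moebius (F := F) 1
  simp only [zero_add, Finset.sum_range_succ, Finset.range_zero,
    Finset.sum_empty] at h0 h1
  norm_num at h0 h1
  obtain _ | _ | i := i
  · simpa using h0
  · rw [h0] at h1
    simp only [zero_add, one_ne_zero, if_false, if_true]
    linarith
  · have h2 := card_monics_mul_sum_moebius (F := F) (i + 1)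
    have h3 := card_monics_mul_sum_moebius (F := F) (i + 1 + 1)
    rw [Finset.sum_range_succ] at h3
    have h4 : ∑ k ∈ Finset.range (i + 1 + 1), (Fintype.card F : ℤ) ^ (i + 1 + 1 - k) *
        ∑ G ∈ monics F k, moebius G = Fintype.card F * ∑ k ∈ Finset.range (i + 1 + 1),
          (Fintype.card F : ℤ) ^ (i + 1 - k) * ∑ G ∈ monics F k, moebius G := by
      rw [Finset.mul_sum]
      refine Finset.sum_congr rfl fun k hk => ?_
      rw [Finset.mem_range] at hk
      rw [show i + 1 + 1 - k = (i + 1 - k) + 1 by omega]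
      ring
    rw [h4, h2] at h3
    simpa using h3

end Counting

section DualNumbers

open TrivSqZeroExt

/-- The resultant of `f` and its derivative, for `f` of formal degree `n`. -/
noncomputable def derivResultant {R : Type*} [CommRing R] (f : R[X]) (n : ℕ) : R :=
  resultant f (derivative f) n (n - 1)

lemma map_derivResultant {R S : Type*} [CommRing R] [CommRing S] (φ : R →+* S) (f : R[X]) (n : ℕ) :
    φ (derivResultant f n) = derivResultant (f.map φ) n := by
  rw [derivResultant, derivResultant, derivative_map, resultant_map_map]

lemma derivResultant_eq_of_monic {R : Type*} [CommRing R] {f : R[X]} (hf : f.Monic) :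
    derivResultant f f.natDegree = resultant f (derivative f) :=
  resultant_eq_of_monic hf (natDegree_derivative_le f)

lemma derivResultant_C_mul {R : Type*} [CommRing R] (c : R) (f : R[X]) {n : ℕ} (hn : 1 ≤ n) :
    derivResultant (C c * f) n = c ^ (2 * n - 1) * derivResultant f n := by
  rw [derivResultant, derivative_C_mul, resultant_C_mul_left, resultant_C_mul_right, ← mul_assoc,
    ← pow_add, derivResultant]
  congr 2
  omega

lemma resultant_derivative_mul {R : Type*} [CommRing R] {f g : R[X]} (hf : f.Monic)
    (hg : g.Monic) : resultant (f * g) (derivative (f * g)) =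
      resultant f (derivative f) * resultant g (derivative g) *
        (resultant f g * resultant g f) := by
  rw [resultant_mul_left_of_monic hf hg, derivative_mul, resultant_add_mul_of_monic hf,
    add_comm, mul_comm f (derivative g), mul_comm (derivative f) g, resultant_add_mul_of_monic hg,
    resultant_mul_right_of_monic hf, resultant_mul_right_of_monic hg]
  ring

variable {F : Type*} [Field F]

lemma derivResultant_ne_zero_of_squarefree [PerfectField F] {f : F[X]} (hf : f.Monic)
    (hsq : Squarefree f) : derivResultant f f.natDegree ≠ 0 := by
  rw [derivResultant_eq_of_monic hf]
  exact resultant_ne_zero _ _ (PerfectField.separable_iff_squarefree.2 hsq)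

lemma fst_resultant (f g : (DualNumber F)[X]) (m n : ℕ) :
    fst (resultant f g m n) = resultant (f.map (fstHom F F F).toRingHom)
      (g.map (fstHom F F F).toRingHom) m n := by
  rw [resultant_map_map]; rfl

lemma fst_derivResultant (f : (DualNumber F)[X]) (n : ℕ) :
    fst (derivResultant f n) = derivResultant (f.map (fstHom F F F).toRingHom) n := by
  rw [← map_derivResultant]; rfl

lemma map_fst_map_inl (f : F[X]) :
    (f.map (inlHom F F)).map (fstHom F F F).toRingHom = f := by
  rw [Polynomial.map_map]
  exact Polynomial.map_id

lemma snd_mul_of_fst_eq_zero (x y : DualNumber F) (h : fst y = 0) :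
    snd (x * y) = fst x * snd y := by
  rw [snd_mul, h]; simp

lemma map_fst_add_eps (f g : F[X]) :
    (f.map (inlHom F F) + C DualNumber.eps * g.map (inlHom F F)).map
      (fstHom F F F).toRingHom = f := by
  rw [Polynomial.map_add, Polynomial.map_mul, map_fst_map_inl, map_C]
  have : (fstHom F F F).toRingHom (DualNumber.eps : DualNumber F) = 0 := by
    simp
  rw [this, C_0, zero_mul, add_zero]

lemma monic_add_eps {f g : F[X]} (hf : f.Monic) (hg : g.degree < f.degree) :
    (f.map (inlHom F F) + C DualNumber.eps * g.map (inlHom F F)).Monic ∧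
    (f.map (inlHom F F) + C DualNumber.eps * g.map (inlHom F F)).natDegree = f.natDegree := by
  have h1 : (C (DualNumber.eps : DualNumber F) * g.map (inlHom F F)).degree <
      (f.map (inlHom F F)).degree := by
    rw [hf.degree_map]
    refine lt_of_le_of_lt ?_ hg
    rw [← smul_eq_C_mul]
    exact (degree_smul_le _ _).trans degree_map_le
  refine ⟨(hf.map _).add_of_left h1, ?_⟩
  rw [natDegree_add_eq_left_of_degree_lt h1, hf.natDegree_map]

/-- The discriminant vanishes to first order exactly at polynomials with one double root, when
moving in a direction that does not vanish at that root. -/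
theorem snd_derivResultant_ne_zero [PerfectField F] (h2 : (2 : F) ≠ 0) {E g : F[X]} {τ : F}
    (hE : E.Monic) (hsq : Squarefree E) (hEτ : E.eval τ ≠ 0)
    (hg : g.degree < ((X - C τ) ^ 2 * E).degree) (hgτ : g.eval τ ≠ 0) :
    snd (derivResultant (((X - C τ) ^ 2 * E).map (inlHom F F) +
      C DualNumber.eps * g.map (inlHom F F)) ((X - C τ) ^ 2 * E).natDegree) ≠ 0 := by
  have hQ : ((X - C τ) ^ 2 : F[X]).Monic := (monic_X_sub_C τ).pow 2
  have hQd : ((X - C τ) ^ 2 : F[X]).natDegree = 2 := by simp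
  have hcop : IsCoprime ((X - C τ) ^ 2) E := by
    refine IsCoprime.pow_left ?_
    rw [(irreducible_X_sub_C τ).coprime_iff_not_dvd, dvd_iff_isRoot]
    exact hEτ
  obtain ⟨s, t, hst⟩ := hcop
  set r := (g * t) %ₘ (X - C τ) ^ 2 with hr
  have hrd : r.degree < ((X - C τ) ^ 2 : F[X]).degree := degree_modByMonic_lt _ hQ
  have hrd2 : r.degree < 2 := by simpa using hrd
  obtain ⟨K, hK⟩ : (X - C τ) ^ 2 ∣ g - r * E := by
    have h1 : r = g * t - (X - C τ) ^ 2 * ((g * t) /ₘ (X - C τ) ^ 2) :=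
      (eq_sub_of_add_eq (modByMonic_add_div _ _))
    rw [h1]
    refine ⟨g * s + ((g * t) /ₘ (X - C τ) ^ 2) * E, ?_⟩
    linear_combination (-g) * hst
  have hrτ : r.eval τ * E.eval τ = g.eval τ := by
    have := congrArg (eval τ) hK
    simp at this
    linear_combination -this
  have hr0 : r.eval τ ≠ 0 := fun h => hgτ (by rw [← hrτ, h, zero_mul])
  have hKd : K.degree < E.degree := by
    have h1 : (g - r * E).degree < ((X - C τ) ^ 2 * E).degree := by
      refine (degree_sub_le _ _).trans_lt (max_lt hg ?_)
      rw [degree_mul, degree_mul]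
      exact WithBot.add_lt_add_right (by simpa using hE.ne_zero) hrd
    rw [hK, degree_mul, degree_mul] at h1
    exact lt_of_add_lt_add_left h1
  set u := ((X - C τ) ^ 2 : F[X]).map (inlHom F F) + C DualNumber.eps * r.map (inlHom F F) with hu
  set w := E.map (inlHom F F) + C DualNumber.eps * K.map (inlHom F F) with hw
  have hε : (C DualNumber.eps * C DualNumber.eps : (DualNumber F)[X]) = 0 := by
    rw [← C_mul, DualNumber.eps_mul_eps, C_0]
  have huw : (((X - C τ) ^ 2 * E).map (inlHom F F) + C DualNumber.eps * g.map (inlHom F F)) =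
      u * w := by
    have h1 : g = r * E + (X - C τ) ^ 2 * K := by rw [← hK]; ring
    rw [hu, hw, h1]
    simp only [Polynomial.map_mul, Polynomial.map_add]
    linear_combination (-(r.map (inlHom F F)) * K.map (inlHom F F)) * hε
  obtain ⟨hum, hud⟩ := monic_add_eps hQ hrd
  obtain ⟨hwm, hwd⟩ := monic_add_eps hE hKd
  rw [← hu] at hum hud
  rw [← hw] at hwm hwd
  have hd : ((X - C τ) ^ 2 * E).natDegree = (u * w).natDegree := by
    rw [hQ.natDegree_mul hE, hum.natDegree_mul hwm, hud, hwd]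
  rw [huw, hd, derivResultant_eq_of_monic (hum.mul hwm), resultant_derivative_mul hum hwm]
  have hr1 : r = C (r.coeff 1) * X + C (r.coeff 0) :=
    eq_X_add_C_of_degree_le_one (Order.le_of_lt_succ hrd2)
  have hu2 : u.degree = 2 := by
    rw [degree_eq_natDegree hum.ne_zero, hud, hQd]; rfl
  have hdisc : resultant u (derivative u) = -(u.coeff 1 ^ 2 - 4 * u.coeff 0 * u.coeff 2) := by
    rw [← derivResultant_eq_of_monic hum, derivResultant, resultant_deriv (by rw [hu2]; norm_num),
      discr_of_degree_eq_two hu2, hum.leadingCoeff, hud, hQd]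
    norm_num
  have huX : ((X - C τ) ^ 2 : F[X]) = X ^ 2 + (C (-2 * τ) * X + C (τ ^ 2)) := by
    simp only [C_mul, C_neg, C_pow]
    rw [show (C (2 : F)) = 2 from rfl]
    ring
  have hue : u = X ^ 2 + (C (inl (-2 * τ) + DualNumber.eps * inl (r.coeff 1)) * X +
      C (inl (τ ^ 2) + DualNumber.eps * inl (r.coeff 0))) := by
    rw [hu, huX, hr1]
    simp only [Polynomial.map_add, Polynomial.map_mul, Polynomial.map_pow, map_X, map_C, C_add,
      C_mul, coeff_add, coeff_C_mul, coeff_X_one, coeff_X_zero, coeff_C_zero, inlHom_apply]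
    simp
    ring
  have hc0 : u.coeff 0 = inl (τ ^ 2) + DualNumber.eps * inl (r.coeff 0) := by
    rw [hue]; simp
  have hc1 : u.coeff 1 = inl (-2 * τ) + DualNumber.eps * inl (r.coeff 1) := by
    rw [hue]; simp [coeff_C]
  have hc2 : u.coeff 2 = 1 := by
    have := hum.coeff_natDegree
    rwa [hud, hQd] at this
  have hres : resultant u (derivative u) = DualNumber.eps * inl (4 * r.eval τ) := by
    rw [hdisc, hc0, hc1, hc2]
    have : r.eval τ = r.coeff 1 * τ + r.coeff 0 := by
      conv_lhs => rw [hr1]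
      simp
    have h4 : (4 : DualNumber F) = inl 4 := (map_ofNat (inlHom F F) 4).symm
    rw [this, h4]
    ext
    · simp; ring
    · simp [pow_two]; ring
  have hfst1 : fst (resultant u (derivative u)) = 0 := by
    rw [hres]; simp
  have hsnd1 : snd (resultant u (derivative u)) = 4 * r.eval τ := by
    rw [hres]; simp
  rw [mul_assoc, mul_comm, snd_mul_of_fst_eq_zero _ _ hfst1, hsnd1]
  have h4 : (4 : F) ≠ 0 := by
    rw [show (4 : F) = 2 * 2 by norm_num]; exact mul_ne_zero h2 h2
  refine mul_ne_zero ?_ (mul_ne_zero h4 hr0)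
  have hmu : u.map (fstHom F F F).toRingHom = (X - C τ) ^ 2 := map_fst_add_eps _ _
  have hmw : w.map (fstHom F F F).toRingHom = E := map_fst_add_eps _ _
  have hcop : IsCoprime ((X - C τ) ^ 2) E := ⟨s, t, hst⟩
  rw [← derivResultant_eq_of_monic hwm, fst_mul, fst_mul, fst_resultant, fst_resultant,
    fst_derivResultant, hmu, hmw, hud, hwd]
  exact mul_ne_zero (derivResultant_ne_zero_of_squarefree hE hsq)
    (mul_ne_zero (resultant_ne_zero _ _ hcop) (resultant_ne_zero _ _ hcop.symm))

end DualNumbers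

section Bezout

open Matrix

variable {S T : Type*} [CommRing S] [CommRing T]

/-- The first cofactor, read off from the adjugate of the Sylvester matrix, that expresses
`Res(f, g) * A` as a combination of `f` and `g`. -/
noncomputable def bezoutLow (f g A : S[X]) (m n : ℕ) : S[X] :=
  lowPoly fun r : Fin m => ((sylvester f g m n).adjugate *ᵥ fun s => A.coeff s) (Fin.castAdd n r)

lemma coeff_mul_lowPoly {g : S[X]} {n m : ℕ} (hg : g.natDegree ≤ n) (c : Fin m → S) (t : ℕ) :
    (g * lowPoly c).coeff t =
      ∑ r : Fin m, (if t ∈ Set.Icc (r : ℕ) (r + n) then g.coeff (t - r) else 0) * c r := by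
  rw [lowPoly, Finset.mul_sum, finsetSum_coeff]
  refine Finset.sum_congr rfl fun r _ => ?_
  rw [mul_left_comm, coeff_C_mul, coeff_mul_X_pow', mul_comm]
  congr 1
  by_cases h1 : (r : ℕ) ≤ t
  · by_cases h2 : t ≤ r + n
    · rw [if_pos h1, if_pos ⟨h1, h2⟩]
    · rw [if_pos h1, if_neg fun h => h2 h.2]
      exact coeff_eq_zero_of_natDegree_lt (by omega)
  · rw [if_neg h1, if_neg fun h => h1 h.1]

lemma exists_mul_add_mul_bezoutLow {f g A : S[X]} {m n : ℕ} (hf : f.natDegree ≤ m)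
    (hg : g.natDegree ≤ n) (hA : A.degree < (m + n : ℕ)) :
    ∃ q, f * q + g * bezoutLow f g A m n = C (resultant f g m n) * A := by
  set v := (sylvester f g m n).adjugate *ᵥ (fun s : Fin (m + n) => A.coeff s) with hv
  have hMv : sylvester f g m n *ᵥ v = fun s : Fin (m + n) => resultant f g m n * A.coeff s := by
    rw [hv, mulVec_mulVec, mul_adjugate, smul_mulVec, one_mulVec]
    rfl
  refine ⟨lowPoly fun r : Fin n => v (Fin.natAdd m r), ?_⟩
  ext t
  rw [coeff_add, coeff_mul_lowPoly hf, bezoutLow, coeff_mul_lowPoly hg, coeff_C_mul]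
  by_cases ht : t < m + n
  · have := congrFun hMv ⟨t, ht⟩
    rw [← this, mulVec, dotProduct, Fin.sum_univ_add, add_comm]
    congr 1 <;> refine Finset.sum_congr rfl fun r _ => ?_
    · simp [sylvester, hv]
    · simp [sylvester]
  · rw [(degree_lt_iff_coeff_zero _ _).1 hA t (by simpa using ht), mul_zero,
      Finset.sum_eq_zero, Finset.sum_eq_zero, add_zero]
    · intro r _
      rw [if_neg, zero_mul]
      rintro ⟨_, h2⟩
      have := r.2
      omega
    · intro r _
      rw [if_neg, zero_mul]
      rintro ⟨_, h2⟩
      have := r.2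
      omega

lemma map_bezoutLow (φ : S →+* T) (f g A : S[X]) (m n : ℕ) :
    (bezoutLow f g A m n).map φ = bezoutLow (f.map φ) (g.map φ) (A.map φ) m n := by
  rw [bezoutLow, bezoutLow, map_lowPoly]
  congr 1
  funext r
  rw [Function.comp_apply, RingHom.map_mulVec, sylvester_map_map, ← RingHom.map_adjugate]
  congr 1
  funext s
  simp

variable {i j k : ℕ}

/-- The resultant of the two monic polynomials with given coefficients, the first one being
regarded as of degree `i + k`. -/
noncomputable def paramRes (k : ℕ) (a : Fin i → S) (b : Fin j → S) : S :=
  resultant (monicOf b) (monicOf a) j (i + k)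

/-- A denominator-free parametrization of the solutions of `G ∣ f` and `G' ∣ f + A`. -/
noncomputable def paramPoly (A : S[X]) (a : Fin i → S) (b : Fin j → S) (l : Fin k → S) : S[X] :=
  C (paramRes k a b) * (monicOf a * monicOf b * monicOf l) -
    monicOf a * bezoutLow (monicOf b) (monicOf a) A j (i + k)

/-- The polynomial in the parameters whose quadratic character is, up to sign, a product of
Möbius values. -/
noncomputable def paramDisc (e : ℕ) (A : S[X]) (a : Fin i → S) (b : Fin j → S) (l : Fin k → S) : S :=
  paramRes k a b ^ (1 + e) * derivResultant (monicOf a) i * derivResultant (monicOf b) j *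
    derivResultant (paramPoly A a b l + C (paramRes k a b) * A) (i + j + k) ^ e *
    derivResultant (paramPoly A a b l) (i + j + k)

lemma map_paramRes (φ : S →+* T) (k : ℕ) (a : Fin i → S) (b : Fin j → S) :
    φ (paramRes k a b) = paramRes k (φ ∘ a) (φ ∘ b) := by
  rw [paramRes, paramRes, ← map_monicOf, ← map_monicOf, resultant_map_map]

lemma map_paramPoly (φ : S →+* T) (A : S[X]) (a : Fin i → S) (b : Fin j → S) (l : Fin k → S) :
    (paramPoly A a b l).map φ = paramPoly (A.map φ) (φ ∘ a) (φ ∘ b) (φ ∘ l) := by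
  simp only [paramPoly, Polynomial.map_sub, Polynomial.map_mul, Polynomial.map_C, map_monicOf,
    map_bezoutLow, ← map_paramRes φ]

lemma map_paramDisc (φ : S →+* T) (e : ℕ) (A : S[X]) (a : Fin i → S) (b : Fin j → S)
    (l : Fin k → S) :
    φ (paramDisc e A a b l) = paramDisc e (A.map φ) (φ ∘ a) (φ ∘ b) (φ ∘ l) := by
  simp only [paramDisc, map_mul, map_pow, map_derivResultant, Polynomial.map_add,
    Polynomial.map_mul, map_paramPoly, Polynomial.map_C, ← map_paramRes φ, map_monicOf]

end Bezout

section TotalDegree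

open Matrix

variable {σ F : Type*} [Field F]

lemma totalDegree_det_le {ι : Type*} [Fintype ι] [DecidableEq ι]
    (M : Matrix ι ι (MvPolynomial σ F)) {d : ℕ} (h : ∀ r s, (M r s).totalDegree ≤ d) :
    M.det.totalDegree ≤ Fintype.card ι * d := by
  rw [det_apply]
  refine MvPolynomial.totalDegree_finsetSum_le fun p _ => ?_
  have h1 : (∏ r, M (p r) r).totalDegree ≤ Fintype.card ι * d := by
    refine (MvPolynomial.totalDegree_finsetProd _ _).trans ?_
    refine (Finset.sum_le_sum fun r _ => h (p r) r).trans ?_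
    simp
  rcases Int.units_eq_one_or (Equiv.Perm.sign p) with h2 | h2 <;> rw [h2]
  · simpa using h1
  · simpa using h1

lemma totalDegree_adjugate_le {ι : Type*} [Fintype ι] [DecidableEq ι]
    (M : Matrix ι ι (MvPolynomial σ F)) {d : ℕ} (h : ∀ r s, (M r s).totalDegree ≤ d) (r s : ι) :
    (M.adjugate r s).totalDegree ≤ Fintype.card ι * d := by
  rw [adjugate_apply]
  refine totalDegree_det_le _ fun t u => ?_
  rw [updateRow_apply]
  split_ifs
  · rw [Pi.single_apply]
    split_ifs <;> simp
  · exact h t u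

/-- All coefficients have total degree at most `d`. -/
def CoeffDegLE (d : ℕ) (p : (MvPolynomial σ F)[X]) : Prop := ∀ t, (p.coeff t).totalDegree ≤ d

namespace CoeffDegLE

variable {d e : ℕ} {p q : (MvPolynomial σ F)[X]}

lemma mono (hp : CoeffDegLE d p) (h : d ≤ e) : CoeffDegLE e p := fun t => (hp t).trans h

lemma add (hp : CoeffDegLE d p) (hq : CoeffDegLE d q) : CoeffDegLE d (p + q) := fun t => by
  rw [coeff_add]
  exact (MvPolynomial.totalDegree_add _ _).trans (max_le (hp t) (hq t))

lemma sub (hp : CoeffDegLE d p) (hq : CoeffDegLE d q) : CoeffDegLE d (p - q) := fun t => by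
  rw [coeff_sub]
  exact (MvPolynomial.totalDegree_sub _ _).trans (max_le (hp t) (hq t))

lemma mul (hp : CoeffDegLE d p) (hq : CoeffDegLE e q) : CoeffDegLE (d + e) (p * q) := fun t => by
  rw [coeff_mul]
  exact MvPolynomial.totalDegree_finsetSum_le fun x _ =>
    (MvPolynomial.totalDegree_mul _ _).trans (add_le_add (hp _) (hq _))

lemma C_of_le {c : MvPolynomial σ F} (h : c.totalDegree ≤ d) : CoeffDegLE d (C c) := fun t => by
  rw [coeff_C]
  split_ifs <;> simp [h]

lemma derivative (hp : CoeffDegLE d p) : CoeffDegLE d (derivative p) := fun t => by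
  rw [coeff_derivative]
  refine (MvPolynomial.totalDegree_mul _ _).trans ?_
  have : ((t : MvPolynomial σ F) + 1) = MvPolynomial.C ((t : F) + 1) := by simp
  rw [this, MvPolynomial.totalDegree_C, add_zero]
  exact hp _

lemma map_C (A : F[X]) : CoeffDegLE 0 (A.map (MvPolynomial.C (σ := σ))) := fun t => by
  rw [coeff_map, MvPolynomial.totalDegree_C]

lemma lowPoly {m : ℕ} {a : Fin m → MvPolynomial σ F} (h : ∀ r, (a r).totalDegree ≤ d) :
    CoeffDegLE d (lowPoly a) := fun t => by
  rw [coeff_lowPoly]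
  split_ifs
  · exact h _
  · simp

lemma monicOf {m : ℕ} {a : Fin m → MvPolynomial σ F} (h : ∀ r, (a r).totalDegree ≤ d) :
    CoeffDegLE d (monicOf a) := by
  refine add (fun t => ?_) (lowPoly h)
  rw [coeff_X_pow]
  split_ifs <;> simp

lemma totalDegree_sylvester_le (hp : CoeffDegLE d p) (hq : CoeffDegLE d q) (m n : ℕ)
    (r s : Fin (m + n)) : (sylvester p q m n r s).totalDegree ≤ d := by
  induction s using Fin.addCases with
  | left s => simp only [sylvester, of_apply, Fin.addCases_left]; split_ifs <;> simp [hq _]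
  | right s => simp only [sylvester, of_apply, Fin.addCases_right]; split_ifs <;> simp [hp _]

lemma totalDegree_resultant_le (hp : CoeffDegLE d p) (hq : CoeffDegLE d q) (m n : ℕ) :
    (resultant p q m n).totalDegree ≤ (m + n) * d := by
  have := totalDegree_det_le _ (totalDegree_sylvester_le hp hq m n)
  rwa [Fintype.card_fin] at this

lemma totalDegree_derivResultant_le (hp : CoeffDegLE d p) (n : ℕ) :
    (derivResultant p n).totalDegree ≤ 2 * n * d :=
  (totalDegree_resultant_le hp hp.derivative _ _).trans (Nat.mul_le_mul_right _ (by omega))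

lemma bezoutLow {A : F[X]} (hp : CoeffDegLE 1 p) (hq : CoeffDegLE 1 q) (m n : ℕ) :
    CoeffDegLE (m + n) (bezoutLow p q (A.map (MvPolynomial.C (σ := σ))) m n) := by
  refine lowPoly fun r => ?_
  rw [mulVec, dotProduct]
  refine MvPolynomial.totalDegree_finsetSum_le fun s _ => ?_
  refine (MvPolynomial.totalDegree_mul _ _).trans ?_
  rw [coeff_map, MvPolynomial.totalDegree_C, add_zero]
  simpa using totalDegree_adjugate_le _ (totalDegree_sylvester_le hp hq m n) (Fin.castAdd n r) s

end CoeffDegLE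

lemma totalDegree_paramDisc_le {i j k e : ℕ} (he : e ≤ 1) {A : F[X]}
    {a : Fin i → MvPolynomial σ F} {b : Fin j → MvPolynomial σ F} {l : Fin k → MvPolynomial σ F}
    (ha : ∀ r, (a r).totalDegree ≤ 1) (hb : ∀ r, (b r).totalDegree ≤ 1)
    (hl : ∀ r, (l r).totalDegree ≤ 1) :
    (paramDisc e (A.map MvPolynomial.C) a b l).totalDegree ≤ 20 * (i + j + k) ^ 2 := by
  have hG := CoeffDegLE.monicOf ha
  have hG' := CoeffDegLE.monicOf hb
  have hL := CoeffDegLE.monicOf hl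
  set n := i + j + k with hn
  have hρ : (paramRes k a b).totalDegree ≤ n :=
    (CoeffDegLE.totalDegree_resultant_le hG' hG j (i + k)).trans (by omega)
  have hF : CoeffDegLE (n + 3) (paramPoly (A.map MvPolynomial.C) a b l) := by
    refine CoeffDegLE.sub ?_ ?_
    · exact ((CoeffDegLE.C_of_le hρ).mul ((hG.mul hG').mul hL)).mono (by omega)
    · exact (hG.mul (CoeffDegLE.bezoutLow hG' hG j (i + k))).mono (by omega)
  have hFA : CoeffDegLE (n + 3) (paramPoly (A.map MvPolynomial.C) a b l +
      C (paramRes k a b) * A.map MvPolynomial.C) :=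
    hF.add (((CoeffDegLE.C_of_le hρ).mul (CoeffDegLE.map_C A)).mono (by omega))
  have h1 := CoeffDegLE.totalDegree_derivResultant_le hG i
  have h2 := CoeffDegLE.totalDegree_derivResultant_le hG' j
  have h3 := CoeffDegLE.totalDegree_derivResultant_le hF n
  have h4 := CoeffDegLE.totalDegree_derivResultant_le hFA n
  rw [paramDisc]
  refine (MvPolynomial.totalDegree_mul _ _).trans ?_
  refine (add_le_add_left (MvPolynomial.totalDegree_mul _ _) _).trans ?_
  refine (add_le_add_left (add_le_add_left (MvPolynomial.totalDegree_mul _ _) _) _).trans ?_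
  refine (add_le_add_left (add_le_add_left (add_le_add_left
    (MvPolynomial.totalDegree_mul _ _) _) _) _).trans ?_
  have h5 := (MvPolynomial.totalDegree_pow (paramRes k a b) (1 + e)).trans
    (Nat.mul_le_mul (show 1 + e ≤ 2 by omega) hρ)
  have h6 := (MvPolynomial.totalDegree_pow (derivResultant (paramPoly (A.map MvPolynomial.C) a b l +
      C (paramRes k a b) * A.map MvPolynomial.C) n) e).trans (Nat.mul_le_mul he h4)
  have h7 : n ≤ n ^ 2 := Nat.le_self_pow (by norm_num) n
  have h8 : i + j ≤ n := by omega
  nlinarith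

end TotalDegree

section Param

open TrivSqZeroExt

variable {F : Type*} [Field F] {i j k : ℕ}

lemma paramRes_ne_zero_iff (k : ℕ) (a : Fin i → F) (b : Fin j → F) :
    paramRes k a b ≠ 0 ↔ IsCoprime (monicOf a) (monicOf b) := by
  have h : paramRes k a b = resultant (monicOf b) (monicOf a) := by
    have := resultant_eq_of_monic (monic_monicOf b) (g := monicOf a) (n := i + k)
      (by rw [natDegree_monicOf]; omega)
    rw [paramRes]
    simpa only [natDegree_monicOf] using this
  rw [h, Ne, resultant_eq_zero_iff, isCoprime_comm]
  simp [(monic_monicOf b).ne_zero]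

/-- The monic solutions of `G ∣ f` and `G' ∣ f + A` with `G`, `G'` coprime. -/
noncomputable def crtPoly (A : F[X]) (a : Fin i → F) (b : Fin j → F) (l : Fin k → F) : F[X] :=
  monicOf a * monicOf b * monicOf l -
    C (paramRes k a b)⁻¹ * (monicOf a * bezoutLow (monicOf b) (monicOf a) A j (i + k))

lemma paramPoly_eq_C_mul_crtPoly (A : F[X]) {a : Fin i → F} {b : Fin j → F} (l : Fin k → F)
    (h : paramRes k a b ≠ 0) : paramPoly A a b l = C (paramRes k a b) * crtPoly A a b l := by
  have : C (paramRes k a b) * C (paramRes k a b)⁻¹ = 1 := by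
    rw [← C_mul, mul_inv_cancel₀ h, C_1]
  rw [paramPoly, crtPoly]
  linear_combination (monicOf a * bezoutLow (monicOf b) (monicOf a) A j (i + k)) * this

lemma exists_mul_add_crtPoly {A : F[X]} (hA : A.degree < (i + j + k : ℕ)) {a : Fin i → F}
    {b : Fin j → F} (h : paramRes k a b ≠ 0) :
    ∃ q, monicOf b * q =
      A - C (paramRes k a b)⁻¹ * (monicOf a * bezoutLow (monicOf b) (monicOf a) A j (i + k)) := by
  obtain ⟨q, hq⟩ := exists_mul_add_mul_bezoutLow (f := monicOf b) (g := monicOf a) (A := A)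
    (m := j) (n := i + k) (natDegree_monicOf b).le (by rw [natDegree_monicOf]; omega)
    (by convert hA using 2; omega)
  have : C (paramRes k a b) * C (paramRes k a b)⁻¹ = 1 := by
    rw [← C_mul, mul_inv_cancel₀ h, C_1]
  refine ⟨C (paramRes k a b)⁻¹ * q, ?_⟩
  rw [← paramRes] at hq
  linear_combination C (paramRes k a b)⁻¹ * hq + A * this

lemma degree_monicOf_mul_bezoutLow_lt (A : F[X]) (a : Fin i → F) (b : Fin j → F) (c : F) :
    (C c * (monicOf a * bezoutLow (monicOf b) (monicOf a) A j (i + k))).degree <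
      (i + j + k : ℕ) := by
  rw [← smul_eq_C_mul]
  refine (degree_smul_le _ _).trans_lt ?_
  rw [degree_mul, degree_eq_natDegree (monic_monicOf a).ne_zero, natDegree_monicOf]
  have h1 : (bezoutLow (monicOf b) (monicOf a) A j (i + k)).degree < j := degree_lowPoly_lt _
  calc (i : WithBot ℕ) + (bezoutLow (monicOf b) (monicOf a) A j (i + k)).degree
      < i + j := WithBot.add_lt_add_left (WithBot.coe_ne_bot) h1
    _ ≤ ((i + j + k : ℕ) : WithBot ℕ) := by norm_cast; omega

lemma monic_prod_monicOf (a : Fin i → F) (b : Fin j → F) (l : Fin k → F) :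
    (monicOf a * monicOf b * monicOf l).Monic :=
  ((monic_monicOf a).mul (monic_monicOf b)).mul (monic_monicOf l)

lemma degree_prod_monicOf (a : Fin i → F) (b : Fin j → F) (l : Fin k → F) :
    (monicOf a * monicOf b * monicOf l).degree = (i + j + k : ℕ) := by
  rw [degree_eq_natDegree (monic_prod_monicOf a b l).ne_zero,
    ((monic_monicOf a).mul (monic_monicOf b)).natDegree_mul (monic_monicOf l),
    (monic_monicOf a).natDegree_mul (monic_monicOf b), natDegree_monicOf, natDegree_monicOf,
    natDegree_monicOf]

lemma monic_crtPoly (A : F[X]) (a : Fin i → F) (b : Fin j → F) (l : Fin k → F) :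
    (crtPoly A a b l).Monic := by
  refine (monic_prod_monicOf a b l).sub_of_left ?_
  rw [degree_prod_monicOf]
  exact degree_monicOf_mul_bezoutLow_lt A a b _

lemma natDegree_crtPoly (A : F[X]) (a : Fin i → F) (b : Fin j → F) (l : Fin k → F) :
    (crtPoly A a b l).natDegree = i + j + k := by
  refine natDegree_eq_of_degree_eq_some ?_
  rw [crtPoly, degree_sub_eq_left_of_degree_lt, degree_prod_monicOf]
  rw [degree_prod_monicOf]
  exact degree_monicOf_mul_bezoutLow_lt A a b _

lemma crtPoly_injective (A : F[X]) (a : Fin i → F) (b : Fin j → F) :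
    Function.Injective (crtPoly A a b : (Fin k → F) → F[X]) := by
  intro l l' h
  have h1 := sub_left_injective h
  exact monicOf_injective k
    (mul_left_cancel₀ ((monic_monicOf a).mul (monic_monicOf b)).ne_zero h1)

open scoped Classical in
lemma filter_dvd_eq_image_crtPoly [Fintype F] [DecidableEq F] {A : F[X]}
    (hA : A.degree < (i + j + k : ℕ)) {a : Fin i → F} {b : Fin j → F}
    (h : IsCoprime (monicOf a) (monicOf b)) :
    (monics F (i + j + k)).filter (fun f => monicOf a ∣ f ∧ monicOf b ∣ f + A) =
      Finset.univ.image (crtPoly A a b : (Fin k → F) → F[X]) := by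
  have hρ := (paramRes_ne_zero_iff k a b).2 h
  obtain ⟨q, hq⟩ := exists_mul_add_crtPoly hA hρ
  ext f
  simp only [Finset.mem_filter, mem_monics, Finset.mem_image, Finset.mem_univ, true_and]
  constructor
  · rintro ⟨⟨hf, hfd⟩, ⟨u, hu⟩, ⟨w, hw⟩⟩
    set g := f + C (paramRes k a b)⁻¹ *
      (monicOf a * bezoutLow (monicOf b) (monicOf a) A j (i + k)) with hg
    have h1 : monicOf a ∣ g :=
      ⟨u + C (paramRes k a b)⁻¹ * bezoutLow (monicOf b) (monicOf a) A j (i + k), by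
        rw [hg, hu]; ring⟩
    have h2 : monicOf b ∣ g := ⟨w - q, by rw [hg]; linear_combination hw + hq⟩
    obtain ⟨L, hL⟩ := h.mul_dvd h1 h2
    have hlt := degree_monicOf_mul_bezoutLow_lt (k := k) A a b (paramRes k a b)⁻¹
    have hfdeg : f.degree = (i + j + k : ℕ) := by
      rw [degree_eq_natDegree hf.ne_zero, hfd]
    rw [← hfdeg] at hlt
    have hgm : g.Monic := hf.add_of_left hlt
    have hgd : g.natDegree = i + j + k := by
      rw [hg, natDegree_add_eq_left_of_degree_lt hlt, hfd]
    have hab := (monic_monicOf a).mul (monic_monicOf b)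
    have hLm : L.Monic := hab.of_mul_monic_left (hL ▸ hgm)
    have hLd : L.natDegree = k := by
      rw [hL, hab.natDegree_mul hLm, (monic_monicOf a).natDegree_mul (monic_monicOf b),
        natDegree_monicOf, natDegree_monicOf] at hgd
      omega
    refine ⟨fun r => L.coeff r, ?_⟩
    rw [crtPoly, monicOf_coeff hLm hLd, ← hL, hg]
    ring
  · rintro ⟨l, rfl⟩
    refine ⟨⟨monic_crtPoly A a b l, natDegree_crtPoly A a b l⟩, ?_, ?_⟩
    · exact dvd_sub ⟨_, mul_assoc _ _ _⟩ ⟨C (paramRes k a b)⁻¹ *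
        bezoutLow (monicOf b) (monicOf a) A j (i + k), by ring⟩
    · exact ⟨monicOf a * monicOf l + q, by rw [crtPoly]; linear_combination -hq⟩

open scoped Classical in
lemma sum_filter_dvd_eq_sum_crtPoly [Fintype F] [DecidableEq F] {M : Type*} [AddCommMonoid M]
    {A : F[X]} (hA : A.degree < (i + j + k : ℕ)) {a : Fin i → F} {b : Fin j → F}
    (h : IsCoprime (monicOf a) (monicOf b)) (φ : F[X] → M) :
    ∑ f ∈ (monics F (i + j + k)).filter (fun f => monicOf a ∣ f ∧ monicOf b ∣ f + A), φ f =
      ∑ l : Fin k → F, φ (crtPoly A a b l) := by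
  rw [filter_dvd_eq_image_crtPoly hA h, Finset.sum_image fun _ _ _ _ h => crtPoly_injective A a b h]

lemma natDegree_add_of_monic {A f : F[X]} (hA : A.degree < f.natDegree) (hf : f.Monic) :
    (f + A).Monic ∧ (f + A).natDegree = f.natDegree := by
  rw [← degree_eq_natDegree hf.ne_zero] at hA
  exact ⟨hf.add_of_left hA, natDegree_add_eq_left_of_degree_lt hA⟩

lemma paramDisc_eq (e : ℕ) (A : F[X]) {a : Fin i → F} {b : Fin j → F} (l : Fin k → F)
    (hk : 1 ≤ k) (h : paramRes k a b ≠ 0) :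
    paramDisc e A a b l = (paramRes k a b ^ ((i + j + k) * (1 + e))) ^ 2 *
      (derivResultant (monicOf a) i * derivResultant (monicOf b) j *
      derivResultant (crtPoly A a b l + A) (i + j + k) ^ e *
      derivResultant (crtPoly A a b l) (i + j + k)) := by
  have hn : 1 ≤ i + j + k := by omega
  rw [paramDisc, paramPoly_eq_C_mul_crtPoly A l h, ← mul_add, derivResultant_C_mul _ _ hn,
    derivResultant_C_mul _ _ hn]
  have : (paramRes k a b ^ ((i + j + k) * (1 + e))) ^ 2 = paramRes k a b ^ (1 + e) *
      (paramRes k a b ^ (2 * (i + j + k) - 1)) ^ (1 + e) := by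
    rw [← pow_mul, ← pow_mul, ← pow_add]
    congr 1
    obtain ⟨m, hm⟩ := Nat.exists_eq_add_of_le hn
    rw [hm, show 2 * (1 + m) - 1 = 1 + 2 * m by omega]
    ring
  rw [this, pow_add _ 1 e, mul_pow, pow_add _ 1 e]
  ring

end Param

section Sign

open UniqueFactorizationMonoid

variable {F : Type*} [Field F] [Fintype F] [DecidableEq F] {i j k : ℕ}

lemma exists_quadraticChar_derivResultant_eq (hF : ringChar F ≠ 2) (m : ℕ) :
    ∃ s : ℤ, |s| = 1 ∧ ∀ f : F[X], f.Monic → f.natDegree = m →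
      quadraticChar F (derivResultant f m) = s * moebius f := by
  refine ⟨(-1) ^ m * quadraticChar F (choiceSign F m), ?_, fun f hf hm => ?_⟩
  · have : choiceSign F m ≠ 0 := pow_ne_zero _ (neg_ne_zero.2 one_ne_zero)
    rw [abs_mul, abs_pow, abs_neg, abs_one, one_pow, one_mul]
    rcases quadraticChar_dichotomy this with h | h <;> simp [h]
  · have h1 : quadraticChar F (choiceSign F m) * quadraticChar F (choiceSign F m) = 1 := by
      have : choiceSign F m ≠ 0 := pow_ne_zero _ (neg_ne_zero.2 one_ne_zero)
      rcases quadraticChar_dichotomy this with h | h <;> simp [h]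
    have h2 : ((-1 : ℤ) ^ m) * (-1) ^ m = 1 := by rw [← mul_pow]; simp
    have h3 : ((-1 : ℤ) ^ m) * (-1) ^ m *
        (quadraticChar F (choiceSign F m) * quadraticChar F (choiceSign F m)) = 1 := by
      rw [h1, h2, one_mul]
    rw [moebius_eq_quadraticChar hF hf, monicDisc, map_mul, ← derivResultant_eq_of_monic hf, hm]
    linear_combination (-(quadraticChar F (derivResultant f m))) * h3

open scoped Classical in
lemma exists_quadraticChar_paramDisc_eq (hF : ringChar F ≠ 2) (e : ℕ) {A : F[X]} (hk : 1 ≤ k)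
    (hA : A.degree < (i + j + k : ℕ)) :
    ∃ s : ℤ, |s| = 1 ∧ ∀ (a : Fin i → F) (b : Fin j → F) (l : Fin k → F),
      quadraticChar F (paramDisc e A a b l) =
        s * if IsCoprime (monicOf a) (monicOf b) then
          moebius (monicOf a) * moebius (monicOf b) *
            (moebius (crtPoly A a b l) * moebius (crtPoly A a b l + A) ^ e) else 0 := by
  obtain ⟨s1, hs1, h1⟩ := exists_quadraticChar_derivResultant_eq hF i
  obtain ⟨s2, hs2, h2⟩ := exists_quadraticChar_derivResultant_eq hF j
  obtain ⟨s3, hs3, h3⟩ := exists_quadraticChar_derivResultant_eq hF (i + j + k)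
  refine ⟨s1 * s2 * (s3 * s3 ^ e), by simp [abs_mul, abs_pow, hs1, hs2, hs3], fun a b l => ?_⟩
  split_ifs with h
  · have hρ := (paramRes_ne_zero_iff k a b).2 h
    obtain ⟨h4, h5⟩ := natDegree_add_of_monic (by rwa [natDegree_crtPoly A a b l])
      (monic_crtPoly A a b l)
    rw [paramDisc_eq e A l hk hρ]
    simp only [map_mul, map_pow]
    rw [← map_pow (quadraticChar F), quadraticChar_sq_one (pow_ne_zero _ hρ),
      h1 _ (monic_monicOf a) (natDegree_monicOf a), h2 _ (monic_monicOf b) (natDegree_monicOf b),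
      h3 _ h4 (h5.trans (natDegree_crtPoly A a b l)),
      h3 _ (monic_crtPoly A a b l) (natDegree_crtPoly A a b l), mul_pow]
    ring
  · have hρ : paramRes k a b = 0 := by
      by_contra h'
      exact h ((paramRes_ne_zero_iff k a b).1 h')
    rw [paramDisc, hρ, zero_pow (by omega)]
    simp

end Sign

section Dual

open TrivSqZeroExt

variable {F : Type*} [Field F] {i j k : ℕ}

lemma snd_eval₂_eps (p : F[X]) :
    snd (eval₂ (inlHom F F) DualNumber.eps p) = p.coeff 1 := by
  induction p using Polynomial.induction_on' with
  | add p q hp hq => rw [eval₂_add, snd_add, hp, hq, coeff_add]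
  | monomial n c =>
    rw [eval₂_monomial, coeff_monomial]
    match n with
    | 0 => simp
    | 1 => simp
    | n + 2 => rw [pow_add, pow_two, DualNumber.eps_mul_eps]; simp

lemma snd_eval₂_eq_coeff_one {σ : Type*} (D : MvPolynomial σ F) (x v : σ → F) :
    snd (MvPolynomial.eval₂ (inlHom F F)
      (fun s => inl (x s) + inl (v s) * DualNumber.eps) D) = (lineRestrict D x v).coeff 1 := by
  rw [← snd_eval₂_eps, lineRestrict, MvPolynomial.aeval_def]
  have := MvPolynomial.hom_eval₂ D (algebraMap F F[X])
    (eval₂RingHom (inlHom F F) (DualNumber.eps : DualNumber F))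
    (fun s => C (x s) + C (v s) * X)
  rw [coe_eval₂RingHom] at this
  rw [this]
  congr 2
  · ext c
    · simp
    · simp
  · funext s
    simp

lemma monicOf_add_eps (l : Fin k → F) (hk : 0 < k) :
    monicOf (fun r => inl (l r) + inl ((Pi.single (⟨0, hk⟩ : Fin k) (1 : F) : Fin k → F) r) *
      DualNumber.eps) = (monicOf l).map (inlHom F F) + C (DualNumber.eps : DualNumber F) := by
  rw [map_monicOf, monicOf, monicOf, add_assoc]
  congr 1
  ext t : 1
  rw [coeff_add, coeff_lowPoly, coeff_lowPoly, coeff_C]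
  split_ifs with h1 h2 h2
  · subst h2; simp
  · have : (⟨t, h1⟩ : Fin k) ≠ ⟨0, hk⟩ := fun h => h2 (by simpa using h)
    simp [this]
  · omega
  · simp

lemma snd_paramDisc_ne_zero [PerfectField F] (h2 : (2 : F) ≠ 0) {e : ℕ} {A : F[X]} (hk : 0 < k)
    (hA : A.degree < (i + j + k : ℕ)) {a : Fin i → F} {b : Fin j → F} (l : Fin k → F)
    (hcop : IsCoprime (monicOf a) (monicOf b)) (ha : Squarefree (monicOf a))
    (hb : Squarefree (monicOf b)) {E : F[X]} {τ : F} (hE : E.Monic) (hEsq : Squarefree E)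
    (hEτ : E.eval τ ≠ 0) (haτ : (monicOf a).eval τ ≠ 0) (hbτ : (monicOf b).eval τ ≠ 0)
    (hcrt : crtPoly A a b l = (X - C τ) ^ 2 * E)
    (hsq : Squarefree (crtPoly A a b l + A)) :
    snd (paramDisc e (A.map (inlHom F F)) (inlHom F F ∘ a) (inlHom F F ∘ b)
      (fun r => inl (l r) + inl ((Pi.single (⟨0, hk⟩ : Fin k) (1 : F) : Fin k → F) r) *
      DualNumber.eps)) ≠ 0 := by
  have hρ := (paramRes_ne_zero_iff k a b).2 hcop
  set l' : Fin k → DualNumber F := fun r => inl (l r) +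
    inl ((Pi.single (⟨0, hk⟩ : Fin k) (1 : F) : Fin k → F) r) * DualNumber.eps with hl'
  set g := monicOf a * monicOf b with hg
  have hgm : g.Monic := (monic_monicOf a).mul (monic_monicOf b)
  have hgd : g.degree < ((X - C τ) ^ 2 * E).degree := by
    rw [← hcrt, degree_eq_natDegree (monic_crtPoly A a b l).ne_zero, natDegree_crtPoly,
      degree_eq_natDegree hgm.ne_zero, (monic_monicOf a).natDegree_mul (monic_monicOf b),
      natDegree_monicOf, natDegree_monicOf]
    norm_cast
    omega
  have hpoly : paramPoly (A.map (inlHom F F)) (inlHom F F ∘ a) (inlHom F F ∘ b) l' =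
      C (inlHom F F (paramRes k a b)) * ((crtPoly A a b l).map (inlHom F F) +
        C DualNumber.eps * g.map (inlHom F F)) := by
    rw [mul_add, ← Polynomial.map_C, ← Polynomial.map_mul, ← paramPoly_eq_C_mul_crtPoly A l hρ,
      map_paramPoly, paramPoly, paramPoly, hl', monicOf_add_eps, map_monicOf, hg,
      Polynomial.map_mul, map_monicOf, map_monicOf, Polynomial.map_C,
      ← map_paramRes (inlHom F F) k a b]
    ring
  have hn : 1 ≤ i + j + k := by omega
  rw [paramDisc, ← map_paramRes, hpoly, ← mul_add, derivResultant_C_mul _ _ hn,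
    derivResultant_C_mul _ _ hn, ← map_monicOf, ← map_monicOf, ← map_derivResultant,
    ← map_derivResultant, ← mul_assoc]
  have hdeg : i + j + k = ((X - C τ) ^ 2 * E).natDegree := by
    rw [← hcrt, natDegree_crtPoly]
  have hfst : fst (derivResultant ((crtPoly A a b l).map (inlHom F F) +
      C DualNumber.eps * g.map (inlHom F F)) (i + j + k)) = 0 := by
    have hm := monic_crtPoly A a b l
    have hd := natDegree_crtPoly A a b l
    rw [fst_derivResultant, map_fst_add_eps, ← hd, derivResultant_eq_of_monic hm,
      resultant_eq_zero_iff]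
    refine ⟨Or.inl hm.ne_zero, fun h => ?_⟩
    have := (separable_def _).2 h
    rw [hcrt] at this
    exact (irreducible_X_sub_C τ).not_isUnit (this.squarefree (X - C τ) ⟨E, by ring⟩)
  rw [snd_mul_of_fst_eq_zero _ _ hfst]
  refine mul_ne_zero ?_ ?_
  · have h3 : derivResultant (crtPoly A a b l + A) (i + j + k) ≠ 0 := by
      have h0 := natDegree_add_of_monic (by rwa [natDegree_crtPoly A a b l])
        (monic_crtPoly A a b l)
      have := derivResultant_ne_zero_of_squarefree h0.1 hsq
      rwa [h0.2, natDegree_crtPoly] at this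
    have h4 := derivResultant_ne_zero_of_squarefree (monic_monicOf a) ha
    have h5 := derivResultant_ne_zero_of_squarefree (monic_monicOf b) hb
    rw [natDegree_monicOf] at h4 h5
    have h6 : (crtPoly A a b l).map (inlHom F F) + C DualNumber.eps * g.map (inlHom F F) +
        A.map (inlHom F F) = (crtPoly A a b l + A).map (inlHom F F) +
        C DualNumber.eps * g.map (inlHom F F) := by
      rw [Polynomial.map_add]; ring
    rw [h6]
    simp only [fst_mul, fst_pow, fst_derivResultant, map_fst_add_eps, inlHom_apply, fst_inl]
    have := pow_ne_zero (1 + e) hρ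
    have := pow_ne_zero (2 * (i + j + k) - 1) hρ
    have := pow_ne_zero e (mul_ne_zero this h3)
    positivity
  · rw [hdeg, hcrt]
    refine snd_derivResultant_ne_zero h2 hE hEsq hEτ hgd ?_
    rw [hg, eval_mul]
    exact mul_ne_zero haτ hbτ

end Dual

section CharSum

open UniqueFactorizationMonoid TrivSqZeroExt

variable {F : Type*} [Field F] [Fintype F] [DecidableEq F]

open scoped Classical in
/-- Correlation of Möbius values over all coprime pairs `(G, G')` and all monic `f` of degree `n`
with `G ∣ f` and `G' ∣ f + A`. -/
noncomputable def moebiusCorr (e : ℕ) (A : F[X]) (i j n : ℕ) : ℤ :=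
  ∑ p ∈ (monics F i ×ˢ monics F j).filter (fun p => IsCoprime p.1 p.2),
    ∑ f ∈ (monics F n).filter (fun f => p.1 ∣ f ∧ p.2 ∣ f + A),
      moebius p.1 * moebius p.2 * (moebius f * moebius (f + A) ^ e)

/-- Existence of a monic `f` of degree `n` with exactly one double root and no further multiple
factor, such that `f + A` is squarefree, and such that both have divisors of prescribed degrees. -/
def HasNodalPoint (A : F[X]) (i j n : ℕ) : Prop :=
  ∃ (τ : F) (E G G' : F[X]), E.Monic ∧ Squarefree E ∧ E.eval τ ≠ 0 ∧ G ∈ monics F i ∧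
    G' ∈ monics F j ∧ (X - C τ) ^ 2 * E ∈ monics F n ∧ G ∣ E ∧ G' ∣ (X - C τ) ^ 2 * E + A ∧
    A.eval τ ≠ 0 ∧ IsCoprime E A ∧ Squarefree ((X - C τ) ^ 2 * E + A)

omit [DecidableEq F] in
lemma ringChar_ne_two_of_odd (hq : Odd (Fintype.card F)) : ringChar F ≠ 2 := by
  intro h
  have := FiniteField.even_card_of_char_two h
  rw [Nat.odd_iff] at hq
  omega

theorem card_mul_abs_moebiusCorr_le (hq : Odd (Fintype.card F)) {e : ℕ} (he : e ≤ 1) {A : F[X]}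
    {i j n : ℕ} (hij : i + j < n) (hA : A.degree < n) (hnod : HasNodalPoint A i j n) :
    (Fintype.card F : ℝ) * |(moebiusCorr e A i j n : ℝ)| ≤
      94 * (20 * n ^ 2) * √(Fintype.card F : ℝ) * Fintype.card F ^ n := by
  obtain ⟨k, hk, rfl⟩ : ∃ k, 0 < k ∧ n = i + j + k := ⟨n - (i + j), by omega, by omega⟩
  have hchar := ringChar_ne_two_of_odd hq
  obtain ⟨M, hM⟩ := hq
  have h2 : (2 : F) ≠ 0 := Ring.two_ne_zero hchar
  set x : Fin i ⊕ Fin j ⊕ Fin k → MvPolynomial (Fin i ⊕ Fin j ⊕ Fin k) F := MvPolynomial.X with hx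
  set D : MvPolynomial (Fin i ⊕ Fin j ⊕ Fin k) F := paramDisc e (A.map MvPolynomial.C)
    (fun r => x (.inl r)) (fun r => x (.inr (.inl r))) (fun r => x (.inr (.inr r))) with hD
  have hdeg : D.totalDegree ≤ 20 * (i + j + k) ^ 2 :=
    totalDegree_paramDisc_le he (fun _ => (MvPolynomial.totalDegree_X _).le)
      (fun _ => (MvPolynomial.totalDegree_X _).le) fun _ => (MvPolynomial.totalDegree_X _).le
  have hev : ∀ y, MvPolynomial.eval y D = paramDisc e A (fun r => y (.inl r))
      (fun r => y (.inr (.inl r))) fun r => y (.inr (.inr r)) := by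
    intro y
    rw [hD, map_paramDisc, Polynomial.map_map]
    have : (MvPolynomial.eval y).comp MvPolynomial.C = RingHom.id F := by ext c; simp
    rw [this, Polynomial.map_id]
    congr 1 <;> funext r <;> simp [hx]
  obtain ⟨s, hs, hχ⟩ := exists_quadraticChar_paramDisc_eq (i := i) (j := j) hchar e hk hA
  have hsum : ∑ y : Fin i ⊕ Fin j ⊕ Fin k → F, quadraticChar F (MvPolynomial.eval y D) =
      s * moebiusCorr e A i j (i + j + k) := by
    simp only [hev]
    rw [← (Equiv.sumArrowEquivProdArrow _ _ _).symm.sum_comp, Fintype.sum_prod_type]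
    simp only [Equiv.sumArrowEquivProdArrow_symm_apply_inl, 
      Equiv.sumArrowEquivProdArrow_symm_apply_inr]
    rw [moebiusCorr, Finset.sum_filter, Finset.sum_product, sum_monics, Finset.mul_sum]
    refine Finset.sum_congr rfl fun a _ => ?_
    rw [← (Equiv.sumArrowEquivProdArrow _ _ _).symm.sum_comp, Fintype.sum_prod_type]
    simp only [Equiv.sumArrowEquivProdArrow_symm_apply_inl,
      Equiv.sumArrowEquivProdArrow_symm_apply_inr]
    rw [sum_monics, Finset.mul_sum]
    refine Finset.sum_congr rfl fun b _ => ?_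
    simp only [hχ]
    split_ifs with h
    · rw [sum_filter_dvd_eq_sum_crtPoly hA h, Finset.mul_sum]
    · simp
  obtain ⟨τ, E, G, G', hE, hEsq, hEτ, hG, hG', hf, hGE, hG'E, hAτ, hEA, hsq⟩ := hnod
  rw [mem_monics] at hG hG' hf
  set a : Fin i → F := fun r => G.coeff r with ha
  set b : Fin j → F := fun r => G'.coeff r with hb
  have haG : monicOf a = G := monicOf_coeff hG.1 hG.2
  have hbG : monicOf b = G' := monicOf_coeff hG'.1 hG'.2
  have hcop : IsCoprime (monicOf a) (monicOf b) := by
    have h1 : IsCoprime E (A + E * (X - C τ) ^ 2) := IsCoprime.add_mul_left_right hEA _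
    rw [haG, hbG]
    refine IsCoprime.of_isCoprime_of_dvd_left (IsCoprime.of_isCoprime_of_dvd_right h1 ?_) hGE
    convert hG'E using 1
    ring
  obtain ⟨l, hl⟩ : ∃ l : Fin k → F, crtPoly A a b l = (X - C τ) ^ 2 * E := by
    classical
    have : (X - C τ) ^ 2 * E ∈ (monics F (i + j + k)).filter
        (fun f => monicOf a ∣ f ∧ monicOf b ∣ f + A) := by
      rw [Finset.mem_filter, mem_monics, haG, hbG]
      exact ⟨hf, hGE.mul_left _, hG'E⟩
    have h3 := filter_dvd_eq_image_crtPoly hA hcop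
    have h4 : (X - C τ) ^ 2 * E ∈ Finset.univ.image (crtPoly A a b : (Fin k → F) → F[X]) := by
      rw [← h3]
      convert this
    simpa using h4
  have hGτ : (monicOf a).eval τ ≠ 0 := by
    rw [haG]
    intro h
    exact hEτ (eval_eq_zero_of_dvd_of_eval_eq_zero hGE h)
  have hG'τ : (monicOf b).eval τ ≠ 0 := by
    rw [hbG]
    intro h
    have := eval_eq_zero_of_dvd_of_eval_eq_zero hG'E h
    simp at this
    exact hAτ this
  have hsnd := snd_paramDisc_ne_zero (e := e) h2 hk hA l hcop
    (by rw [haG]; exact hEsq.squarefree_of_dvd hGE)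
    (by rw [hbG]; exact hsq.squarefree_of_dvd hG'E) hE hEsq hEτ hGτ hG'τ hl (by rw [hl]; exact hsq)
  set x0 : Fin i ⊕ Fin j ⊕ Fin k → F := Sum.elim a (Sum.elim b l) with hx0
  set v : Fin i ⊕ Fin j ⊕ Fin k → F :=
    Sum.elim 0 (Sum.elim 0 (Pi.single (⟨0, hk⟩ : Fin k) (1 : F))) with hv
  have hmain := card_mul_abs_sum_quadraticChar_le hM D _ hdeg x0 v ?_ ?_
  · have hcast : (∑ y : Fin i ⊕ Fin j ⊕ Fin k → F,
        (quadraticChar F (MvPolynomial.eval y D) : ℝ)) = s * moebiusCorr e A i j (i + j + k) := by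
      exact_mod_cast hsum
    rw [hcast, abs_mul, show |(s : ℝ)| = 1 by exact_mod_cast hs, one_mul] at hmain
    simpa [add_assoc] using hmain
  · have h5 : quadraticChar F (MvPolynomial.eval x0 D) = 0 := by
      rw [hev, hχ]
      have : moebius (crtPoly A a b l) = 0 := by
        refine moebius_of_not_squarefree fun h => ?_
        rw [hl] at h
        exact (irreducible_X_sub_C τ).not_isUnit (h (X - C τ) ⟨E, by ring⟩)
      simp only [hx0, Sum.elim_inl, Sum.elim_inr]
      simp [this]
    exact quadraticChar_eq_zero_iff.1 h5
  · rw [← snd_eval₂_eq_coeff_one]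
    have h6 : MvPolynomial.eval₂ (inlHom F F)
        (fun s => inl (x0 s) + inl (v s) * DualNumber.eps) D = paramDisc e (A.map (inlHom F F))
          (inlHom F F ∘ a) (inlHom F F ∘ b) (fun r => inl (l r) +
          inl ((Pi.single (⟨0, hk⟩ : Fin k) (1 : F) : Fin k → F) r) * DualNumber.eps) := by
      rw [← MvPolynomial.coe_eval₂Hom, hD, map_paramDisc, Polynomial.map_map]
      congr 1
      · congr 1
        ext c <;> simp
      · funext r; simp [hx, hx0, hv]
      · funext r; simp [hx, hx0, hv]
      · funext r
        simp only [hx, Function.comp_apply, MvPolynomial.coe_eval₂Hom, MvPolynomial.eval₂_X]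
        rfl
    rw [h6]
    exact hsnd

end CharSum

section Nodal

open scoped Classical in
lemma card_filter_product {α β : Type*} (s : Finset α) (t : Finset β) (p : α × β → Prop) :
    ((s ×ˢ t).filter p).card = ∑ a ∈ s, (t.filter fun b => p (a, b)).card := by
  rw [Finset.card_filter, Finset.sum_product]
  exact Finset.sum_congr rfl fun a _ => (Finset.card_filter _ _).symm

variable {F : Type*} [Field F] [Fintype F] [DecidableEq F]

open scoped Classical in
lemma card_mul_card_not_squarefree_pencil_le {A : F[X]} {τ : F} (hτ : A.eval τ ≠ 0)
    (h2 : (2 : F) ≠ 0) {m : ℕ} (hm : 1 ≤ m) (hA : A.degree < (m + 2 : ℕ)) :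
    Fintype.card F * ((monics F m).filter
      fun E => ¬ Squarefree ((X - C τ) ^ 2 * E + A)).card ≤ 2 ^ (m + 2) * Fintype.card F ^ m := by
  set bad : F[X] → Prop := fun E => ¬ Squarefree ((X - C τ) ^ 2 * E + A) with hbad
  have hshift : ∀ c : F, ((monics F m).filter bad).card =
      ∑ E ∈ monics F m, if bad (E + C c) then 1 else 0 := by
    intro c
    rw [Finset.card_filter]
    refine (Finset.sum_equiv (Equiv.addRight (C c)) (fun E => ?_) fun E _ => rfl).symm
    have key : ∀ (E : F[X]) (c : F), E ∈ monics F m → E + C c ∈ monics F m := by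
      intro E c hE
      rw [mem_monics] at hE ⊢
      have hd : (C c : F[X]).degree < E.natDegree := by
        refine degree_C_le.trans_lt ?_
        rw [hE.2]; exact_mod_cast hm
      have := natDegree_add_of_monic hd hE.1
      exact ⟨this.1, this.2.trans hE.2⟩
    refine ⟨key E c, fun h => ?_⟩
    have := key _ (-c) h
    simpa using this
  have hpt : ∀ E ∈ monics F m, ∑ c : F, (if bad (E + C c) then 1 else 0) ≤ 2 ^ (m + 2) := by
    intro E hE
    rw [mem_monics] at hE
    rw [← Finset.card_filter]
    set B := (X - C τ) ^ 2 * E + A with hB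
    set W := (X - C τ) * derivative B - 2 * B with hW
    have hWτ : W.eval τ ≠ 0 := by
      rw [hW, hB]
      simp
      exact ⟨h2, hτ⟩
    have hW0 : W ≠ 0 := by
      rintro h; rw [h] at hWτ; simp at hWτ
    have hQm : ((X - C τ) ^ 2 : F[X]).Monic := (monic_X_sub_C τ).pow 2
    have hBd : B.natDegree ≤ m + 2 := by
      refine natDegree_add_le_of_degree_le ?_ (natDegree_le_of_degree_le hA.le)
      rw [hQm.natDegree_mul hE.1, hE.2]
      simp
      omega
    have hWd : W.natDegree ≤ m + 2 := by
      refine (natDegree_sub_le _ _).trans (max_le ?_ ?_)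
      · refine natDegree_mul_le.trans ?_
        have := natDegree_derivative_le B
        rw [natDegree_X_sub_C]
        omega
      · refine natDegree_mul_le.trans ?_
        have : (2 : F[X]).natDegree = 0 := natDegree_ofNat 2
        omega
    have hB0 : ∀ c, (X - C τ) ^ 2 * (E + C c) + A ≠ 0 := by
      intro c h
      have := congrArg (eval τ) h
      simp at this
      exact hτ this
    have hex : ∀ c : F, ∃ P : F[X], bad (E + C c) → P.Monic ∧ Irreducible P ∧
        P ∣ (X - C τ) ^ 2 * (E + C c) + A ∧ P ∣ W := by
      intro c
      by_cases hc : bad (E + C c)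
      · obtain ⟨P, hP, hPi, w, hw⟩ := exists_monic_sq_dvd_of_not_squarefree (hB0 c) hc
        refine ⟨P, fun _ => ⟨hP, hPi, ⟨P * w, by rw [hw]; ring⟩, ?_⟩⟩
        have hWc : W = (X - C τ) * derivative (P ^ 2 * w) - 2 * (P ^ 2 * w) := by
          rw [← hw, hW, hB]
          simp only [pow_two, derivative_add, derivative_mul, derivative_sub, derivative_X,
            derivative_C]
          ring
        refine ⟨(X - C τ) * (2 * derivative P * w + P * derivative w) - 2 * (P * w), ?_⟩
        rw [hWc]
        simp only [pow_two, derivative_mul]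
        ring
      · exact ⟨0, fun h => absurd h hc⟩
    choose P hP using hex
    refine le_trans (Finset.card_le_card_of_injOn P (t := monicDivisors W) ?_ ?_)
      ((card_monicDivisors_le_of_ne_zero hW0).trans (Nat.pow_le_pow_right (by norm_num) hWd))
    · intro c hc
      have hc' : bad (E + C c) := by simpa using hc
      have := hP c hc'
      exact (mem_monicDivisors hW0).2 ⟨this.1, this.2.2.2⟩
    · intro c hc d hd hcd
      have hc' := hP c (by simpa using hc)
      have hd' := hP d (by simpa using hd)
      rw [← hcd] at hd'
      by_contra hne
      have h1 : P c ∣ (X - C τ) ^ 2 * C (c - d) := by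
        have := dvd_sub hc'.2.2.1 hd'.2.2.1
        convert this using 1
        rw [C_sub]; ring
      rcases (hc'.2.1.prime.dvd_or_dvd h1) with h | h
      · have h3 := hc'.2.1.prime.dvd_of_dvd_pow h
        have h4 : Associated (P c) (X - C τ) :=
          (irreducible_X_sub_C τ).dvd_irreducible_iff_associated hc'.2.1 |>.1 (by
            exact ((hc'.2.1.dvd_irreducible_iff_associated (irreducible_X_sub_C τ)).1 h3).symm.dvd)
            |>.symm
        have h5 : (X - C τ) ∣ W := h4.symm.dvd.trans hc'.2.2.2
        exact hWτ (dvd_iff_isRoot.1 h5)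
      · have h3 : IsUnit (C (c - d) : F[X]) := isUnit_C.2 (isUnit_iff_ne_zero.2 (sub_ne_zero.2 hne))
        exact hc'.2.1.not_isUnit (isUnit_of_dvd_unit h h3)
  calc Fintype.card F * ((monics F m).filter bad).card
      = ∑ c : F, ((monics F m).filter bad).card := by simp
    _ = ∑ E ∈ monics F m, ∑ c : F, (if bad (E + C c) then 1 else 0) := by
        rw [Finset.sum_congr rfl fun c _ => hshift c, Finset.sum_comm]
    _ ≤ ∑ E ∈ monics F m, 2 ^ (m + 2) := Finset.sum_le_sum hpt
    _ = _ := by rw [Finset.sum_const, card_monics, smul_eq_mul, mul_comm]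

open scoped Classical in
lemma pow_le_card_filter_dvd_mul_add {A H : F[X]} {j k : ℕ} {G : F[X]} (hG : G ∈ monics F j)
    (hH : IsCoprime H G) :
    Fintype.card F ^ k ≤ ((monics F (j + k)).filter fun Y => G ∣ H * Y + A).card := by
  rw [mem_monics] at hG
  obtain ⟨u, v, huv⟩ := hH
  set A' := (A * u) %ₘ G with hA'
  have hA'd : A'.degree < (0 + j + k : ℕ) := by
    refine (degree_modByMonic_lt _ hG.1).trans_le ?_
    rw [degree_eq_natDegree hG.1.ne_zero, hG.2]
    norm_cast
    omega
  set b : Fin j → F := fun r => G.coeff r with hb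
  have hbG : monicOf b = G := monicOf_coeff hG.1 hG.2
  have hcop : IsCoprime (monicOf (Fin.elim0 : Fin 0 → F)) (monicOf b) := by
    have : monicOf (Fin.elim0 : Fin 0 → F) = 1 := by simp [monicOf, lowPoly]
    rw [this]; exact isCoprime_one_left
  have h1 := sum_filter_dvd_eq_sum_crtPoly (k := k) hA'd hcop fun _ => 1
  rw [← Finset.card_eq_sum_ones, ← Finset.card_eq_sum_ones, Finset.card_univ, Fintype.card_fun,
    Fintype.card_fin] at h1
  rw [← h1, hbG]
  refine Finset.card_le_card fun Y hY => ?_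
  rw [Finset.mem_filter] at hY ⊢
  refine ⟨by simpa using hY.1, ?_⟩
  obtain ⟨w, hw⟩ := hY.2.2
  have h3 : A' = A * u - G * ((A * u) /ₘ G) := eq_sub_of_add_eq (modByMonic_add_div _ _)
  refine ⟨H * w + H * ((A * u) /ₘ G) + A * v, ?_⟩
  linear_combination H * hw - H * h3 - A * huv

open scoped Classical in
set_option maxHeartbeats 1000000 in
lemma exists_mul_not_mem_bad {A : F[X]} {τ : F} {j k s n : ℕ} (hn : j + k + s + 2 = n)
    (hA : A.degree < n) {bad : Finset F[X]}
    (hbad : 4 ^ n * (Fintype.card F * bad.card) + n * Fintype.card F ^ (j + k + s) <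
      Fintype.card F ^ (j + k + s + 1)) :
    ∃ Y ∈ monics F (j + k), ∃ Z ∈ monics F s, ∃ G ∈ monics F j,
      G ∣ (X - C τ) ^ 2 * (Y * Z) + A ∧ Y * Z ∉ bad := by
  by_contra! H
  set q := Fintype.card F with hq
  set Q : F[X] := (X - C τ) ^ 2 with hQ
  have hQm : Q.Monic := (monic_X_sub_C τ).pow 2
  have hq0 : 0 < q := Fintype.card_pos
  set T := ((monics F s ×ˢ monics F j) ×ˢ monics F (j + k)).filter
    fun t => t.1.2 ∣ Q * (t.2 * t.1.1) + A with hT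
  set cop := (monics F s ×ˢ monics F j).filter fun p => IsCoprime (Q * p.1) p.2 with hcop
  have hlow : cop.card * q ^ k ≤ T.card := by
    have hTc : T.card = ∑ p ∈ monics F s ×ˢ monics F j,
        ((monics F (j + k)).filter fun Y => p.2 ∣ Q * (Y * p.1) + A).card := by
      exact card_filter_product _ _ _
    rw [hTc]
    calc cop.card * q ^ k = ∑ p ∈ cop, q ^ k := by simp
      _ ≤ ∑ p ∈ cop, ((monics F (j + k)).filter fun Y => p.2 ∣ Q * (Y * p.1) + A).card := by
          refine Finset.sum_le_sum fun p hp => ?_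
          rw [hcop, Finset.mem_filter, Finset.mem_product] at hp
          refine (pow_le_card_filter_dvd_mul_add (A := A) (k := k) hp.1.2 hp.2).trans_eq ?_
          congr 1
          refine Finset.filter_congr fun Y _ => ?_
          rw [mul_assoc, mul_comm p.1]
      _ ≤ _ := Finset.sum_le_sum_of_subset (Finset.filter_subset _ _)
  have hup : T.card ≤ 4 ^ n * bad.card := by
    refine Finset.card_le_mul_card_image_of_maps_to (f := fun t => t.2 * t.1.1) (fun t ht => ?_) _
      fun E hE => ?_
    · rw [hT, Finset.mem_filter, Finset.mem_product, Finset.mem_product] at ht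
      exact H _ ht.1.2 _ ht.1.1.1 _ ht.1.1.2 ht.2
    · by_cases hne : (T.filter fun t => t.2 * t.1.1 = E).Nonempty
      · obtain ⟨t0, ht0⟩ := hne
        rw [Finset.mem_filter, hT, Finset.mem_filter, Finset.mem_product, Finset.mem_product,
          mem_monics, mem_monics, mem_monics] at ht0
        have hEm : E.Monic := ht0.2 ▸ ht0.1.1.2.1.mul ht0.1.1.1.1.1
        have hEd : E.natDegree = j + k + s := by
          rw [← ht0.2, ht0.1.1.2.1.natDegree_mul ht0.1.1.1.1.1, ht0.1.1.2.2, ht0.1.1.1.1.2]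
        have hQd : (Q * E).natDegree = n := by
          rw [hQm.natDegree_mul hEm, hEd, hQ]
          simp
          omega
        obtain ⟨hfm, hfd⟩ := natDegree_add_of_monic (A := A) (f := Q * E) (by rwa [hQd])
          (hQm.mul hEm)
        have h1 : (T.filter fun t => t.2 * t.1.1 = E).card ≤
            (monicDivisors E ×ˢ monicDivisors (Q * E + A)).card := by
          refine Finset.card_le_card_of_injOn (fun t => (t.2, t.1.2)) ?_ ?_
          · intro t ht
            rw [Finset.mem_coe, Finset.mem_filter, hT, Finset.mem_filter, Finset.mem_product,
              Finset.mem_product, mem_monics, mem_monics, mem_monics] at ht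
            rw [Finset.mem_coe, Finset.mem_product, mem_monicDivisors hEm.ne_zero,
              mem_monicDivisors hfm.ne_zero]
            exact ⟨⟨ht.1.1.2.1, ⟨_, ht.2.symm⟩⟩, ht.1.1.1.2.1, ht.2 ▸ ht.1.2⟩
          · intro t ht u hu htu
            rw [Finset.mem_coe, Finset.mem_filter] at ht hu
            simp only [Prod.mk.injEq] at htu
            have h0 : t.2 ≠ 0 := by
              intro h
              rw [h, zero_mul] at ht
              exact hEm.ne_zero ht.2.symm
            have h2 : t.1.1 = u.1.1 := by
              refine mul_left_cancel₀ h0 ?_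
              rw [ht.2, htu.1, hu.2]
            exact Prod.ext (Prod.ext h2 htu.2) htu.1
        refine h1.trans ?_
        rw [Finset.card_product]
        refine (Nat.mul_le_mul (card_monicDivisors_le hEm) (card_monicDivisors_le hfm)).trans ?_
        rw [hfd, hQd, hEd, show 4 = 2 * 2 by norm_num, mul_pow]
        exact Nat.mul_le_mul_right _ (Nat.pow_le_pow_right (by norm_num) (by omega))
      · rw [Finset.not_nonempty_iff_eq_empty.1 hne]
        simp
  have hcard : q * q ^ (s + j) ≤ q * cop.card + (s + 2) * q ^ (s + j) := by
    have h1 : (monics F s ×ˢ monics F j).card ≤ cop.card +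
        (((monics F s ×ˢ monics F j).filter fun p => ¬ IsCoprime p.1 p.2).card +
        (monics F s ×ˢ (monics F j).filter (¬ IsCoprime · (X - C τ))).card) := by
      refine le_trans (Finset.card_le_card ?_) ((Finset.card_union_le _ _).trans
        (Nat.add_le_add_left (Finset.card_union_le _ _) _))
      intro p hp
      simp only [hcop, Finset.mem_union, Finset.mem_filter, Finset.mem_product] at hp ⊢
      by_cases h1 : IsCoprime p.1 p.2
      · by_cases h2 : IsCoprime p.2 (X - C τ)
        · exact Or.inl ⟨hp, IsCoprime.mul_left (IsCoprime.pow_left h2.symm) h1⟩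
        · exact Or.inr (Or.inr ⟨hp.1, hp.2, h2⟩)
      · exact Or.inr (Or.inl ⟨hp, h1⟩)
    have h2 := card_mul_card_pairs_not_isCoprime_le (F := F) s j
    have h3 := card_mul_card_not_isCoprime_le (X_sub_C_ne_zero τ) j
    rw [natDegree_X_sub_C, pow_one] at h3
    rw [Finset.card_product, Finset.card_product, card_monics, card_monics, ← pow_add] at h1
    have h4 : q * (q ^ s * ((monics F j).filter (¬ IsCoprime · (X - C τ))).card) ≤
        2 * q ^ (s + j) := by
      calc _ = q ^ s * (q * ((monics F j).filter (¬ IsCoprime · (X - C τ))).card) := by ring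
        _ ≤ q ^ s * (2 * q ^ j) := Nat.mul_le_mul_left _ h3
        _ = _ := by rw [pow_add]; ring
    calc q * q ^ (s + j) ≤ q * _ := Nat.mul_le_mul_left _ h1
      _ ≤ _ := by rw [mul_add, mul_add]; nlinarith
  have hfinal : q ^ (j + k + s + 1) ≤ q * (cop.card * q ^ k) + n * q ^ (j + k + s) := by
    calc q ^ (j + k + s + 1) = q ^ k * (q * q ^ (s + j)) := by ring
      _ ≤ q ^ k * (q * cop.card + (s + 2) * q ^ (s + j)) := Nat.mul_le_mul_left _ hcard
      _ = q * (cop.card * q ^ k) + (s + 2) * q ^ (j + k + s) := by ring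
      _ ≤ _ := by gcongr; omega
  have h9 := Nat.mul_le_mul_left q (hlow.trans hup)
  have h8 : q * (4 ^ n * bad.card) = 4 ^ n * (q * bad.card) := by ring
  rw [h8] at h9
  exact absurd (hfinal.trans (Nat.add_le_add_right h9 _)) hbad.not_ge

open scoped Classical in
theorem hasNodalPoint (h2 : (2 : F) ≠ 0) {A : F[X]} (hA0 : A ≠ 0) {i j n : ℕ} (hn : 2 ≤ n)
    (hA : A.degree < n) (hi : 2 * i < n) (hj : 2 * j < n) (hq : 5 * 8 ^ n ≤ Fintype.card F) :
    HasNodalPoint A i j n := by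
  set q := Fintype.card F with hqdef
  have hAd : A.natDegree < n := (natDegree_lt_iff_degree_lt hA0).2 hA
  have h8 : n < 8 ^ n := Nat.lt_pow_self (by norm_num)
  rcases hn.eq_or_lt with rfl | hn3
  · obtain rfl : i = 0 := by omega
    obtain rfl : j = 0 := by omega
    set a := A.coeff 1 with ha
    set b := A.coeff 0 with hb
    have hAl : A = C a * X + C b := eq_X_add_C_of_natDegree_le_one (by omega)
    have h4 : (4 : F) ≠ 0 := by
      rw [show (4 : F) = 2 * 2 by norm_num]
      exact mul_ne_zero h2 h2
    have hR : A * (C (a ^ 2) - C 4 * A) ≠ 0 := by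
      refine mul_ne_zero hA0 fun h => hA0 ?_
      have h1 : C 4 * A = C (a ^ 2) := (sub_eq_zero.1 h).symm
      have h3 := congrArg (fun p => p.coeff 1) h1
      simp only [coeff_C_mul, coeff_C_succ] at h3
      have ha0 : a = 0 := (mul_eq_zero.1 h3).resolve_left h4
      rw [ha0, zero_pow two_ne_zero, C_0] at h1
      exact (mul_eq_zero.1 h1).resolve_left (C_ne_zero.2 h4)
    have hRd : (A * (C (a ^ 2) - C 4 * A)).natDegree < q := by
      refine lt_of_le_of_lt (natDegree_mul_le.trans (Nat.add_le_add (Nat.le_of_lt_succ hAd)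
        ((natDegree_sub_le _ _).trans (max_le (by simp) ((natDegree_C_mul_le _ _).trans
        (Nat.le_of_lt_succ hAd)))))) ?_
      omega
    obtain ⟨τ, hτ⟩ := exists_eval_ne_zero_of_natDegree_lt_card _ hR (by simpa using hRd)
    rw [eval_mul, mul_ne_zero_iff] at hτ
    have hsq : Squarefree ((X - C τ) ^ 2 * 1 + A) := by
      refine Separable.squarefree ?_
      have hc : eval τ (C (a ^ 2) - C 4 * A) = a ^ 2 - 4 * (a * τ + b) := by
        rw [hAl]; simp
      set c := a ^ 2 - 4 * (a * τ + b) with hcdef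
      rw [hc] at hτ
      have hd : derivative ((X - C τ) ^ 2 * 1 + A) = 2 * (X - C τ) + C a := by
        rw [hAl]; simp [pow_two]; ring
      rw [Separable, hd]
      have hcc : C (c⁻¹) * C c = (1 : F[X]) := by
        rw [← C_mul, inv_mul_cancel₀ hτ.2, C_1]
      refine ⟨-4 * C c⁻¹, (2 * (X - C τ) + C a) * C c⁻¹, ?_⟩
      have hcC : (C c : F[X]) = C a ^ 2 - 4 * (C a * C τ + C b) := by
        rw [hcdef, C_sub, C_pow, C_mul, C_add, C_mul, show (C 4 : F[X]) = 4 from rfl]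
      linear_combination hcc - C c⁻¹ * hcC - 4 * C c⁻¹ * hAl
    refine ⟨τ, 1, 1, 1, monic_one, squarefree_one, by simp, by simp [mem_monics],
      by simp [mem_monics], ?_, one_dvd _, one_dvd _, hτ.1, isCoprime_one_left, hsq⟩
    rw [mem_monics]
    exact ⟨by simpa using (monic_X_sub_C τ).pow 2, by simp⟩
  · obtain ⟨m, rfl⟩ : ∃ m, n = m + 2 := ⟨n - 2, by omega⟩
    have h8' : m + 2 < 2 ^ (m + 2) := Nat.lt_pow_self (by norm_num)
    have hm8 : (8 : ℕ) ^ (m + 2) = 4 ^ (m + 2) * 2 ^ (m + 2) := by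
      rw [← mul_pow]; norm_num
    obtain ⟨τ, hτ⟩ := exists_eval_ne_zero_of_natDegree_lt_card A hA0
      (by rw [Cardinal.mk_fintype]; exact_mod_cast (by omega : A.natDegree < q))
    set b1 := (monics F m).filter (¬ Squarefree ·) with hb1
    set b2 := (monics F m).filter (¬ IsCoprime · A) with hb2
    set b3 := (monics F m).filter (¬ IsCoprime · (X - C τ)) with hb3
    set b4 := (monics F m).filter fun E => ¬ Squarefree ((X - C τ) ^ 2 * E + A) with hb4
    have hc1 : q * b1.card ≤ m * q ^ m := card_mul_card_not_squarefree_le m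
    have hc2 : q * b2.card ≤ 2 ^ A.natDegree * q ^ m := card_mul_card_not_isCoprime_le hA0 m
    have hc3 : q * b3.card ≤ 2 * q ^ m := by
      have := card_mul_card_not_isCoprime_le (X_sub_C_ne_zero τ) m
      rwa [natDegree_X_sub_C, pow_one] at this
    have hc4 : q * b4.card ≤ 2 ^ (m + 2) * q ^ m :=
      card_mul_card_not_squarefree_pencil_le hτ h2 (by omega) hA
    have hc : q * (b1 ∪ b2 ∪ b3 ∪ b4).card ≤ 4 * 2 ^ (m + 2) * q ^ m := by
      have hu : (b1 ∪ b2 ∪ b3 ∪ b4).card ≤ b1.card + b2.card + b3.card + b4.card :=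
        (Finset.card_union_le _ _).trans (Nat.add_le_add_right ((Finset.card_union_le _ _).trans
          (Nat.add_le_add_right (Finset.card_union_le _ _) _)) _)
      have h2d : 2 ^ A.natDegree ≤ 2 ^ (m + 2) := Nat.pow_le_pow_right (by norm_num) hAd.le
      calc q * (b1 ∪ b2 ∪ b3 ∪ b4).card ≤ q * (b1.card + b2.card + b3.card + b4.card) :=
            Nat.mul_le_mul_left _ hu
        _ = q * b1.card + q * b2.card + q * b3.card + q * b4.card := by ring
        _ ≤ m * q ^ m + 2 ^ A.natDegree * q ^ m + 2 * q ^ m + 2 ^ (m + 2) * q ^ m := by gcongr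
        _ = (m + 2 ^ A.natDegree + 2 + 2 ^ (m + 2)) * q ^ m := by ring
        _ ≤ 4 * 2 ^ (m + 2) * q ^ m := Nat.mul_le_mul_right _ (by omega)
    have hbad : ∀ N, N = m → 4 ^ (m + 2) * (q * (b1 ∪ b2 ∪ b3 ∪ b4).card) + (m + 2) * q ^ N <
        q ^ (N + 1) := by
      rintro N rfl
      have hqp : 0 < q ^ N := pow_pos Fintype.card_pos _
      calc _ ≤ 4 ^ (N + 2) * (4 * 2 ^ (N + 2) * q ^ N) + (N + 2) * q ^ N := by gcongr
        _ = (4 * 8 ^ (N + 2) + (N + 2)) * q ^ N := by rw [hm8]; ring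
        _ < q * q ^ N := Nat.mul_lt_mul_of_pos_right (by omega) hqp
        _ = _ := by ring
    have key : ∀ k s, j + k + s = m → (i = j + k ∨ i = s) → HasNodalPoint A i j (m + 2) := by
      intro k s hks his
      obtain ⟨Y, hY, Z, hZ, G', hG', hdvd, hnb⟩ := exists_mul_not_mem_bad (τ := τ)
        (show j + k + s + 2 = m + 2 by omega) hA (hbad _ hks)
      have hY' := mem_monics.1 hY
      have hZ' := mem_monics.1 hZ
      have hEm : (Y * Z).Monic := hY'.1.mul hZ'.1
      have hE : Y * Z ∈ monics F m := by
        rw [mem_monics]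
        exact ⟨hEm, by rw [hY'.1.natDegree_mul hZ'.1, hY'.2, hZ'.2, hks]⟩
      simp only [Finset.mem_union, hb1, hb2, hb3, hb4, Finset.mem_filter, hE, true_and, not_or,
        not_not] at hnb
      obtain ⟨⟨⟨hn1, hn2⟩, hn3⟩, hn4⟩ := hnb
      have hQ : (X - C τ) ^ 2 * (Y * Z) ∈ monics F (m + 2) := by
        rw [mem_monics] at hE ⊢
        refine ⟨((monic_X_sub_C τ).pow 2).mul hEm, ?_⟩
        rw [((monic_X_sub_C τ).pow 2).natDegree_mul hEm, hE.2]
        simp [add_comm]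
      have hev : eval τ (Y * Z) ≠ 0 := by
        obtain ⟨u, v, huv⟩ := hn3
        intro h
        have := congrArg (eval τ) huv
        rw [eval_add, eval_mul, h] at this
        simp at this
      rcases his with his | his
      · exact ⟨τ, Y * Z, Y, G', hEm, hn1, hev, his ▸ hY, hG', hQ, Dvd.intro _ rfl, hdvd, hτ, hn2,
          hn4⟩
      · exact ⟨τ, Y * Z, Z, G', hEm, hn1, hev, his ▸ hZ, hG', hQ, Dvd.intro_left _ rfl, hdvd, hτ,
          hn2, hn4⟩
    rcases le_total (m - i) i with h | h
    · exact key (i - j) (m - i) (by omega) (by omega)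
    · exact key (m - i - j) i (by omega) (by omega)

end Nodal

section MainSum

variable {F : Type*} [Field F] [Fintype F] [DecidableEq F]

open UniqueFactorizationMonoid (moebius)

open scoped Classical in
/-- The contribution of the monic divisors of degree `i` to the Moebius sum over divisors. -/
noncomputable def moebiusDivSum (f : F[X]) (i : ℕ) : ℤ :=
  ∑ G ∈ (monics F i).filter (· ∣ f), moebius G

open scoped Classical in
lemma sum_monicDivisors_filter {f : F[X]} (hf : f.Monic) {n : ℕ} (hn : f.natDegree = n)
    (φ : F[X] → ℤ) :
    ∑ G ∈ (monicDivisors f).filter (2 * ·.natDegree < f.natDegree), φ G =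
      ∑ i ∈ (Finset.range n).filter (2 * · < n), ∑ G ∈ (monics F i).filter (· ∣ f), φ G := by
  rw [← Finset.sum_fiberwise_of_maps_to (t := (Finset.range n).filter (2 * · < n))
    (g := fun G => G.natDegree)]
  · refine Finset.sum_congr rfl fun i hi => Finset.sum_congr ?_ fun _ _ => rfl
    ext G
    simp only [Finset.mem_filter, Finset.mem_range] at hi
    simp only [Finset.mem_filter, mem_monicDivisors hf.ne_zero, mem_monics]
    constructor
    · rintro ⟨⟨⟨h1, h2⟩, -⟩, h4⟩
      exact ⟨⟨h1, h4⟩, h2⟩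
    · rintro ⟨⟨h1, h4⟩, h2⟩
      exact ⟨⟨⟨h1, h2⟩, by omega⟩, h4⟩
  · intro G hG
    simp only [Finset.mem_filter, Finset.mem_range] at hG ⊢
    omega

open scoped Classical in
lemma two_mul_natDegree_mul_irreducible_eq {f : F[X]} (hf : f.Monic) {n : ℕ}
    (hn : f.natDegree = n) (hn0 : n ≠ 0) :
    (if Irreducible f then 2 * (n : ℤ) else 0) = (moebius f ^ 2 - moebius f) *
      ∑ i ∈ (Finset.range n).filter (2 * · < n), ((n : ℤ) - 2 * i) * moebiusDivSum f i := by
  have h1 : f ≠ 1 := by rintro rfl; simp at hn; exact hn0 hn.symm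
  have h := two_mul_natDegree_mul_irreducible hf h1
  rw [sum_monicDivisors_filter hf hn, hn] at h
  rw [h]
  congr 1
  refine Finset.sum_congr rfl fun i _ => ?_
  rw [moebiusDivSum, Finset.mul_sum]
  refine Finset.sum_congr rfl fun G hG => ?_
  rw [(mem_monics.1 (Finset.mem_filter.1 hG).1).2]

open scoped Classical in
lemma sum_card_filter_dvd_le {f : F[X]} (hf : f.Monic) {n : ℕ} (hn : f.natDegree = n) :
    ∑ i ∈ (Finset.range n).filter (2 * · < n), (((monics F i).filter (· ∣ f)).card : ℤ) ≤
      2 ^ n := by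
  have h := sum_monicDivisors_filter hf hn fun _ => 1
  simp only [Finset.sum_const, nsmul_eq_mul, mul_one] at h
  rw [← h]
  have h2 := (Finset.card_filter_le (monicDivisors f) (2 * ·.natDegree < f.natDegree)).trans
    (card_monicDivisors_le hf)
  conv_rhs at h2 => rw [hn]
  exact_mod_cast h2

omit [Fintype F] [DecidableEq F] in
lemma abs_moebius_le_one (f : F[X]) : |moebius f| ≤ 1 := by
  by_cases h : Squarefree f
  · rw [Squarefree.moebius_eq h]
    simp
  · rw [UniqueFactorizationMonoid.moebius_of_not_squarefree h]
    simp

open scoped Classical in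
/-- The sum of `moebius G * moebius G'` over coprime monic divisors `G` of `f` and `G'` of `g`
of the given degrees. -/
noncomputable def coprimeDivSum (f g : F[X]) (i j : ℕ) : ℤ :=
  ∑ p ∈ (monics F i ×ˢ monics F j).filter (fun p => IsCoprime p.1 p.2 ∧ p.1 ∣ f ∧ p.2 ∣ g),
    moebius p.1 * moebius p.2

lemma coprimeDivSum_eq {f g : F[X]} (h : IsCoprime f g) (i j : ℕ) :
    coprimeDivSum f g i j = moebiusDivSum f i * moebiusDivSum g j := by
  classical
  rw [coprimeDivSum, moebiusDivSum, moebiusDivSum, Finset.sum_mul_sum, ← Finset.sum_product']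
  refine Finset.sum_congr ?_ fun _ _ => rfl
  ext p
  simp only [Finset.mem_filter, Finset.mem_product]
  constructor
  · rintro ⟨⟨h1, h2⟩, -, h3, h4⟩
    exact ⟨⟨h1, h3⟩, h2, h4⟩
  · rintro ⟨⟨h1, h3⟩, h2, h4⟩
    exact ⟨⟨h1, h2⟩, (h.of_isCoprime_of_dvd_left h3).of_isCoprime_of_dvd_right h4, h3, h4⟩

open scoped Classical in
lemma abs_coprimeDivSum_le (f g : F[X]) (i j : ℕ) :
    |coprimeDivSum f g i j| ≤ ((monics F i).filter (· ∣ f)).card *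
      ((monics F j).filter (· ∣ g)).card := by
  rw [coprimeDivSum]
  refine (Finset.abs_sum_le_sum_abs _ _).trans ?_
  refine (Finset.sum_le_card_nsmul _ _ 1 fun p _ => ?_).trans ?_
  · rw [abs_mul]
    exact mul_le_one₀ (abs_moebius_le_one _) (abs_nonneg _) (abs_moebius_le_one _)
  · rw [nsmul_one, ← Nat.cast_mul, ← Finset.card_product]
    refine Nat.cast_le.2 (Finset.card_le_card fun p hp => ?_)
    simp only [Finset.mem_filter, Finset.mem_product] at hp ⊢
    exact ⟨⟨hp.1.1, hp.2.2.1⟩, hp.1.2, hp.2.2.2⟩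

/-- The sieve expression that agrees with the twin prime indicator at all `f` for which `f` and
`f + A` are coprime and squarefree. -/
noncomputable def sieveTerm (A : F[X]) (n : ℕ) (f : F[X]) : ℤ :=
  (1 - moebius f) * (1 - moebius (f + A)) *
    ∑ i ∈ (Finset.range n).filter (2 * · < n), ∑ j ∈ (Finset.range n).filter (2 * · < n),
      ((n : ℤ) - 2 * i) * (n - 2 * j) * coprimeDivSum f (f + A) i j

lemma abs_sieveTerm_le {A f : F[X]} {n : ℕ} (hf : f.Monic) (hfn : f.natDegree = n)
    (hg : (f + A).Monic) (hgn : (f + A).natDegree = n) :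
    |sieveTerm A n f| ≤ 4 * (n : ℤ) ^ 2 * 4 ^ n := by
  classical
  have h1 : ∀ f : F[X], |1 - moebius f| ≤ 2 := fun f => by
    have := abs_le.1 (abs_moebius_le_one f)
    rw [abs_le]; constructor <;> linarith [this.1, this.2]
  have hw : ∀ i ∈ (Finset.range n).filter (2 * · < n), |(n : ℤ) - 2 * i| ≤ n := by
    intro i hi
    rw [Finset.mem_filter] at hi
    rw [abs_le]; constructor <;> omega
  set J := (Finset.range n).filter (2 * · < n)
  set a : ℕ → ℤ := fun i => ((monics F i).filter (· ∣ f)).card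
  set b : ℕ → ℤ := fun i => ((monics F i).filter (· ∣ f + A)).card
  have hsum : |∑ i ∈ J, ∑ j ∈ J,
      ((n : ℤ) - 2 * i) * (n - 2 * j) * coprimeDivSum f (f + A) i j| ≤
      (n : ℤ) ^ 2 * (2 ^ n * 2 ^ n) := by
    calc _ ≤ ∑ i ∈ J, ∑ j ∈ J, (n : ℤ) ^ 2 * (a i * b j) := by
          refine (Finset.abs_sum_le_sum_abs _ _).trans (Finset.sum_le_sum fun i hi =>
            (Finset.abs_sum_le_sum_abs _ _).trans (Finset.sum_le_sum fun j hj => ?_))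
          rw [abs_mul, abs_mul, pow_two]
          have := hw i hi
          have := hw j hj
          have := abs_coprimeDivSum_le f (f + A) i j
          gcongr
      _ = (n : ℤ) ^ 2 * ((∑ i ∈ J, a i) * ∑ j ∈ J, b j) := by
          rw [Finset.sum_mul_sum, Finset.mul_sum]
          simp_rw [Finset.mul_sum]
      _ ≤ _ := by
          have h2 : ∑ i ∈ J, a i ≤ 2 ^ n := sum_card_filter_dvd_le hf hfn
          have h3 : ∑ i ∈ J, b i ≤ 2 ^ n := sum_card_filter_dvd_le hg hgn
          have h4 : 0 ≤ ∑ i ∈ J, b i := Finset.sum_nonneg fun i _ => Nat.cast_nonneg _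
          gcongr
  rw [sieveTerm, abs_mul, abs_mul]
  calc _ ≤ 2 * 2 * ((n : ℤ) ^ 2 * (2 ^ n * 2 ^ n)) := by
        have := h1 f
        have := h1 (f + A)
        gcongr
    _ = _ := by rw [← mul_pow]; norm_num; ring

open scoped Classical in
lemma sieveTerm_eq {A f : F[X]} {n : ℕ} (hn0 : n ≠ 0) (hf : f.Monic) (hfn : f.natDegree = n)
    (hg : (f + A).Monic) (hgn : (f + A).natDegree = n) (hsf : Squarefree f)
    (hsg : Squarefree (f + A)) (hc : IsCoprime f A) :
    sieveTerm A n f = if Irreducible f ∧ Irreducible (f + A) then 4 * (n : ℤ) ^ 2 else 0 := by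
  have hc' : IsCoprime f (f + A) := by
    have := hc.add_mul_left_right 1
    rwa [mul_one, add_comm] at this
  have hs : ∀ f : F[X], Squarefree f → moebius f ^ 2 = 1 := fun f h => by
    rw [Squarefree.moebius_eq h, ← pow_mul, mul_comm, pow_mul]
    simp
  have h1 := two_mul_natDegree_mul_irreducible_eq hf hfn hn0
  have h2 := two_mul_natDegree_mul_irreducible_eq hg hgn hn0
  rw [hs _ hsf] at h1
  rw [hs _ hsg] at h2
  have h3 : (if Irreducible f ∧ Irreducible (f + A) then 4 * (n : ℤ) ^ 2 else 0) =
      (if Irreducible f then 2 * (n : ℤ) else 0) *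
      (if Irreducible (f + A) then 2 * (n : ℤ) else 0) := by
    by_cases hi : Irreducible f <;> by_cases hj : Irreducible (f + A) <;> simp [hi, hj]
    ring
  rw [h3, h1, h2, sieveTerm, mul_mul_mul_comm, Finset.sum_mul_sum]
  congr 1
  refine Finset.sum_congr rfl fun i _ => Finset.sum_congr rfl fun j _ => ?_
  rw [coprimeDivSum_eq hc']
  ring

open scoped Classical in
lemma card_mul_abs_sub_sum_sieveTerm_le {A : F[X]} (hA0 : A ≠ 0) {n : ℕ} (hA : A.degree < n) :
    (Fintype.card F : ℤ) * |4 * (n : ℤ) ^ 2 *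
      ((monics F n).filter fun f => Irreducible f ∧ Irreducible (f + A)).card -
      ∑ f ∈ monics F n, sieveTerm A n f| ≤ 24 * (n : ℤ) ^ 2 * 8 ^ n * Fintype.card F ^ n := by
  set q := Fintype.card F with hq
  have hn0 : n ≠ 0 := by
    rintro rfl
    exact hA0 (degree_eq_bot.1 (Nat.WithBot.lt_zero_iff.1 hA))
  have hadd : ∀ f ∈ monics F n, (f + A).Monic ∧ (f + A).natDegree = n := fun f hf => by
    rw [mem_monics] at hf
    have := natDegree_add_of_monic (A := A) (f := f) (by rwa [hf.2]) hf.1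
    rwa [hf.2] at this
  set B1 := (monics F n).filter (¬ Squarefree ·) with hB1
  set B2 := (monics F n).filter fun f => ¬ Squarefree (f + A) with hB2
  set B3 := (monics F n).filter (¬ IsCoprime · A) with hB3
  set B := B1 ∪ B2 ∪ B3 with hB
  have hBs : B ⊆ monics F n :=
    Finset.union_subset (Finset.union_subset (Finset.filter_subset _ _) (Finset.filter_subset _ _))
      (Finset.filter_subset _ _)
  have h21 : B2.card ≤ B1.card := by
    refine Finset.card_le_card_of_injOn (· + A) (fun f hf => ?_)
      (fun x _ y _ h => add_right_cancel h)
    rw [Finset.mem_coe, hB2, Finset.mem_filter] at hf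
    rw [Finset.mem_coe, hB1, Finset.mem_filter, mem_monics]
    exact ⟨hadd f hf.1, hf.2⟩
  have hBc : q * B.card ≤ 3 * 2 ^ n * q ^ n := by
    have h1 : q * B1.card ≤ n * q ^ n := card_mul_card_not_squarefree_le n
    have h3 : q * B3.card ≤ 2 ^ A.natDegree * q ^ n := card_mul_card_not_isCoprime_le hA0 n
    have hu : B.card ≤ B1.card + B2.card + B3.card :=
      (Finset.card_union_le _ _).trans (Nat.add_le_add_right (Finset.card_union_le _ _) _)
    have h2d : 2 ^ A.natDegree ≤ 2 ^ n :=
      Nat.pow_le_pow_right (by norm_num) ((natDegree_lt_iff_degree_lt hA0).2 hA).le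
    have hn2 : n < 2 ^ n := Nat.lt_pow_self (by norm_num)
    calc q * B.card ≤ q * (B1.card + B1.card + B3.card) := Nat.mul_le_mul_left _ (by omega)
      _ = q * B1.card + q * B1.card + q * B3.card := by ring
      _ ≤ n * q ^ n + n * q ^ n + 2 ^ A.natDegree * q ^ n := by gcongr
      _ = (n + n + 2 ^ A.natDegree) * q ^ n := by ring
      _ ≤ 3 * 2 ^ n * q ^ n := Nat.mul_le_mul_right _ (by omega)
  set I : F[X] → ℤ :=
    fun f => if Irreducible f ∧ Irreducible (f + A) then 4 * (n : ℤ) ^ 2 else 0 with hI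
  have hN : 4 * (n : ℤ) ^ 2 *
      ((monics F n).filter fun f => Irreducible f ∧ Irreducible (f + A)).card =
      ∑ f ∈ monics F n, I f := by
    rw [hI, ← Finset.sum_filter, Finset.sum_const, nsmul_eq_mul, mul_comm]
  have hsub : ∑ f ∈ monics F n, I f - ∑ f ∈ monics F n, sieveTerm A n f =
      ∑ f ∈ B, (I f - sieveTerm A n f) := by
    rw [← Finset.sum_sub_distrib]
    refine (Finset.sum_subset hBs fun f hf hfB => ?_).symm
    simp only [hB, hB1, hB2, hB3, Finset.mem_union, Finset.mem_filter, hf, true_and, not_or,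
      not_not] at hfB
    rw [mem_monics] at hf
    rw [sieveTerm_eq hn0 hf.1 hf.2 (hadd f (mem_monics.2 hf)).1 (hadd f (mem_monics.2 hf)).2
      hfB.1.1 hfB.1.2 hfB.2, sub_self]
  have hbound : |∑ f ∈ B, (I f - sieveTerm A n f)| ≤ B.card * (8 * (n : ℤ) ^ 2 * 4 ^ n) := by
    refine (Finset.abs_sum_le_sum_abs _ _).trans ?_
    rw [← nsmul_eq_mul]
    refine Finset.sum_le_card_nsmul _ _ _ fun f hf => ?_
    have hf' := mem_monics.1 (hBs hf)
    have h1 := abs_sieveTerm_le hf'.1 hf'.2 (hadd f (hBs hf)).1 (hadd f (hBs hf)).2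
    have h4 : (1 : ℤ) ≤ 4 ^ n := one_le_pow₀ (by norm_num)
    have h2 : |I f| ≤ 4 * (n : ℤ) ^ 2 * 4 ^ n := by
      rw [hI]
      dsimp only
      split_ifs
      · rw [abs_of_nonneg (by positivity)]
        nlinarith [sq_nonneg (n : ℤ)]
      · rw [abs_zero]; positivity
    linarith [abs_sub (I f) (sieveTerm A n f)]
  rw [hN, hsub]
  have hBc' : (q : ℤ) * B.card ≤ 3 * 2 ^ n * q ^ n := by exact_mod_cast hBc
  calc _ ≤ (q : ℤ) * (B.card * (8 * (n : ℤ) ^ 2 * 4 ^ n)) := by gcongr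
    _ = (q * B.card) * (8 * (n : ℤ) ^ 2 * 4 ^ n) := by ring
    _ ≤ (3 * 2 ^ n * q ^ n) * (8 * (n : ℤ) ^ 2 * 4 ^ n) := by gcongr
    _ = 24 * (n : ℤ) ^ 2 * (2 ^ n * 4 ^ n) * q ^ n := by ring
    _ = _ := by rw [← mul_pow]; norm_num

end MainSum

section Assembly

variable {F : Type*} [Field F] [Fintype F] [DecidableEq F]

open UniqueFactorizationMonoid (moebius)

open scoped Classical in
/-- The sum of `moebius G * moebius G'` over coprime monic `G`, `G'` of degrees `i`, `j`. -/
noncomputable def coprimeMoebiusSum (F : Type*) [Field F] [Fintype F] [DecidableEq F]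
    (i j : ℕ) : ℤ :=
  ∑ p ∈ (monics F i ×ˢ monics F j).filter (fun p => IsCoprime p.1 p.2), moebius p.1 * moebius p.2

open scoped Classical in
lemma moebiusCorr_zero_neg {A : F[X]} {n : ℕ} (hA : A.degree < n) (i j : ℕ) :
    moebiusCorr 0 (-A) j i n = ∑ p ∈ (monics F i ×ˢ monics F j).filter (fun p => IsCoprime p.1 p.2),
      ∑ f ∈ (monics F n).filter (fun f => p.1 ∣ f ∧ p.2 ∣ f + A),
        moebius p.1 * moebius p.2 * moebius (f + A) := by
  have hadd : ∀ B : F[X], B.degree < n → ∀ f ∈ monics F n, f + B ∈ monics F n := by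
    intro B hB f hf
    rw [mem_monics] at hf ⊢
    have := natDegree_add_of_monic (A := B) (f := f) (by rwa [hf.2]) hf.1
    rwa [hf.2] at this
  rw [moebiusCorr]
  refine Finset.sum_bij' (fun p _ => p.swap) (fun p _ => p.swap) ?_ ?_ (fun _ _ => rfl)
    (fun _ _ => rfl) ?_
  · intro p hp
    simp only [Finset.mem_filter, Finset.mem_product] at hp ⊢
    exact ⟨⟨hp.1.2, hp.1.1⟩, hp.2.symm⟩
  · intro p hp
    simp only [Finset.mem_filter, Finset.mem_product] at hp ⊢
    exact ⟨⟨hp.1.2, hp.1.1⟩, hp.2.symm⟩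
  · intro p _
    refine Finset.sum_bij' (fun f _ => f + -A) (fun f _ => f + A) ?_ ?_ (fun _ _ => by ring)
      (fun _ _ => by ring) ?_
    · intro f hf
      simp only [Finset.mem_filter, Prod.fst_swap, Prod.snd_swap] at hf ⊢
      refine ⟨hadd _ (by rwa [degree_neg]) f hf.1, hf.2.2, ?_⟩
      simpa using hf.2.1
    · intro f hf
      simp only [Finset.mem_filter, Prod.fst_swap, Prod.snd_swap] at hf ⊢
      refine ⟨hadd _ hA f hf.1, hf.2.2, ?_⟩
      simpa using hf.2.1
    · intro f _
      simp only [Prod.fst_swap, Prod.snd_swap, pow_zero, mul_one, neg_add_cancel_right]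
      ring

open scoped Classical in
lemma card_filter_dvd_eq {A : F[X]} {i j n : ℕ} (hij : i + j ≤ n) (hA : A.degree < n)
    {G G' : F[X]} (hG : G ∈ monics F i) (hG' : G' ∈ monics F j) (h : IsCoprime G G') :
    ((monics F n).filter fun f => G ∣ f ∧ G' ∣ f + A).card = Fintype.card F ^ (n - (i + j)) := by
  obtain ⟨k, rfl⟩ := Nat.exists_eq_add_of_le hij
  rw [mem_monics] at hG hG'
  have h1 : monicOf (fun r : Fin i => G.coeff r) = G := monicOf_coeff hG.1 hG.2
  have h2 : monicOf (fun r : Fin j => G'.coeff r) = G' := monicOf_coeff hG'.1 hG'.2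
  rw [← h1, ← h2] at h
  have := sum_filter_dvd_eq_sum_crtPoly (k := k) hA h fun _ => 1
  rw [h1, h2] at this
  rw [Finset.card_eq_sum_ones, this]
  simp

lemma sum_sieveTerm_eq {A : F[X]} {n : ℕ} (hA : A.degree < n) :
    ∑ f ∈ monics F n, sieveTerm A n f =
      ∑ i ∈ (Finset.range n).filter (2 * · < n), ∑ j ∈ (Finset.range n).filter (2 * · < n),
        ((n : ℤ) - 2 * i) * (n - 2 * j) *
          ((Fintype.card F : ℤ) ^ (n - (i + j)) * coprimeMoebiusSum F i j
            - moebiusCorr 0 A i j n - moebiusCorr 0 (-A) j i n + moebiusCorr 1 A i j n) := by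
  classical
  have key : ∀ i j : ℕ, 2 * i < n → 2 * j < n →
      ∑ f ∈ monics F n, (1 - moebius f) * (1 - moebius (f + A)) * coprimeDivSum f (f + A) i j =
      (Fintype.card F : ℤ) ^ (n - (i + j)) * coprimeMoebiusSum F i j
            - moebiusCorr 0 A i j n - moebiusCorr 0 (-A) j i n + moebiusCorr 1 A i j n := by
    intro i j hi hj
    have h1 : (Fintype.card F : ℤ) ^ (n - (i + j)) * coprimeMoebiusSum F i j =
        ∑ p ∈ (monics F i ×ˢ monics F j).filter (fun p => IsCoprime p.1 p.2),
        ∑ f ∈ (monics F n).filter (fun f => p.1 ∣ f ∧ p.2 ∣ f + A),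
          moebius p.1 * moebius p.2 := by
      rw [coprimeMoebiusSum, Finset.mul_sum]
      refine Finset.sum_congr rfl fun p hp => ?_
      rw [Finset.mem_filter, Finset.mem_product] at hp
      rw [Finset.sum_const, card_filter_dvd_eq (by omega) hA hp.1.1 hp.1.2 hp.2, nsmul_eq_mul,
        Nat.cast_pow]
    rw [h1, moebiusCorr_zero_neg hA, moebiusCorr, moebiusCorr]
    simp only [← Finset.sum_sub_distrib, ← Finset.sum_add_distrib]
    have h2 : ∀ f : F[X], coprimeDivSum f (f + A) i j =
        ∑ p ∈ (monics F i ×ˢ monics F j).filter (fun p => IsCoprime p.1 p.2),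
          if p.1 ∣ f ∧ p.2 ∣ f + A then moebius p.1 * moebius p.2 else 0 := by
      intro f
      rw [coprimeDivSum, ← Finset.filter_filter, Finset.sum_filter]
    simp only [h2, Finset.mul_sum]
    rw [Finset.sum_comm]
    refine Finset.sum_congr rfl fun p _ => ?_
    rw [Finset.sum_filter]
    refine Finset.sum_congr rfl fun f _ => ?_
    split_ifs
    · ring
    · ring
  simp only [sieveTerm, Finset.mul_sum]
  rw [Finset.sum_comm]
  refine Finset.sum_congr rfl fun i hi => ?_
  rw [Finset.sum_comm]
  refine Finset.sum_congr rfl fun j hj => ?_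
  rw [Finset.mem_filter] at hi hj
  rw [← key i j hi.2 hj.2, Finset.mul_sum]
  exact Finset.sum_congr rfl fun f _ => by ring

lemma card_mul_abs_coprimeMoebiusSum_sub_le (i j : ℕ) :
    (Fintype.card F : ℤ) * |coprimeMoebiusSum F i j -
      (∑ G ∈ monics F i, moebius G) * ∑ G ∈ monics F j, moebius G| ≤
      i * (Fintype.card F : ℤ) ^ (i + j) := by
  classical
  have h := card_mul_card_pairs_not_isCoprime_le (F := F) i j
  rw [Finset.sum_mul_sum, ← Finset.sum_product', coprimeMoebiusSum, abs_sub_comm,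
    ← Finset.sum_filter_add_sum_filter_not (monics F i ×ˢ monics F j)
      (fun p => IsCoprime p.1 p.2), add_sub_cancel_left]
  have h2 : |∑ p ∈ (monics F i ×ˢ monics F j).filter (fun p => ¬ IsCoprime p.1 p.2),
      moebius p.1 * moebius p.2| ≤
      ((monics F i ×ˢ monics F j).filter (fun p => ¬ IsCoprime p.1 p.2)).card := by
    refine (Finset.abs_sum_le_sum_abs _ _).trans ?_
    refine (Finset.sum_le_card_nsmul _ _ 1 fun p _ => ?_).trans (by rw [nsmul_one])
    rw [abs_mul]
    exact mul_le_one₀ (abs_moebius_le_one _) (abs_nonneg _) (abs_moebius_le_one _)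
  refine (mul_le_mul_of_nonneg_left h2 (Nat.cast_nonneg _)).trans ?_
  exact_mod_cast h

lemma sum_sum_main_term {n : ℕ} (hn : 2 ≤ n) :
    ∑ i ∈ (Finset.range n).filter (2 * · < n), ∑ j ∈ (Finset.range n).filter (2 * · < n),
        ((n : ℤ) - 2 * i) * (n - 2 * j) * ((Fintype.card F : ℤ) ^ (n - (i + j)) *
          ((∑ G ∈ monics F i, moebius G) * ∑ G ∈ monics F j, moebius G)) =
      4 * (Fintype.card F : ℤ) ^ n := by
  classical
  set q : ℤ := (Fintype.card F : ℤ) with hq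
  set c : ℕ → ℤ := fun i => if i = 0 then 1 else if i = 1 then -1 else 0 with hc
  have hm : ∀ i, (∑ G ∈ monics F i, moebius G : ℤ) = c i * q ^ i := by
    intro i
    rw [sum_monics_moebius]
    rcases i with _ | _ | i <;> simp [hc, hq]
  have hs : ∑ i ∈ (Finset.range n).filter (2 * · < n), ((n : ℤ) - 2 * i) * c i = 2 := by
    rw [Finset.sum_filter]
    obtain ⟨m, rfl⟩ : ∃ m, n = m + 2 := ⟨n - 2, by omega⟩
    rw [Finset.sum_range_succ', Finset.sum_range_succ']
    have h0 : ∀ i : ℕ, c (i + 1 + 1) = 0 := fun i => by simp [hc]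
    simp only [h0, mul_zero, ite_self, Finset.sum_const_zero]
    rcases m with _ | m
    · simp [hc]
    · have h1 : 2 * (0 + 1) < m + 1 + 2 := by omega
      rw [if_pos h1]
      simp [hc]
      ring
  calc _ = ∑ i ∈ (Finset.range n).filter (2 * · < n), ∑ j ∈ (Finset.range n).filter (2 * · < n),
        (((n : ℤ) - 2 * i) * c i) * ((n - 2 * j) * c j) * q ^ n := by
        refine Finset.sum_congr rfl fun i hi => Finset.sum_congr rfl fun j hj => ?_
        rw [Finset.mem_filter] at hi hj
        have : q ^ n = q ^ (n - (i + j)) * (q ^ i * q ^ j) := by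
          rw [← pow_add, ← pow_add]
          congr 1
          omega
        rw [hm, hm, this]
        ring
    _ = (∑ i ∈ (Finset.range n).filter (2 * · < n), ((n : ℤ) - 2 * i) * c i) *
        (∑ i ∈ (Finset.range n).filter (2 * · < n), ((n : ℤ) - 2 * i) * c i) * q ^ n := by
        rw [Finset.sum_mul_sum, Finset.sum_mul]
        simp_rw [Finset.sum_mul]
    _ = _ := by rw [hs]; ring

lemma card_mul_abs_sum_sieveTerm_sub_le (hq : Odd (Fintype.card F)) {A : F[X]} (hA0 : A ≠ 0)
    {n : ℕ} (hn : 2 ≤ n) (hA : A.degree < n) (hqn : 5 * 8 ^ n ≤ Fintype.card F) :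
    (Fintype.card F : ℝ) * |((∑ f ∈ monics F n, sieveTerm A n f : ℤ) : ℝ)
      - 4 * (Fintype.card F : ℝ) ^ n| ≤
      5641 * (n : ℝ) ^ 6 * √(Fintype.card F) * (Fintype.card F : ℝ) ^ n := by
  have h2 : (2 : F) ≠ 0 := by
    intro h
    refine ringChar_ne_two_of_odd hq ?_
    exact ringChar.eq_iff.2 (CharTwo.of_one_ne_zero_of_two_eq_zero one_ne_zero h)
  have hmain := congrArg (Int.cast : ℤ → ℝ) (sum_sum_main_term (F := F) hn)
  push_cast at hmain
  rw [sum_sieveTerm_eq hA, ← hmain]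
  push_cast
  set q : ℝ := (Fintype.card F : ℝ) with hqdef
  have hq1 : 1 ≤ q := Nat.one_le_cast.2 Fintype.card_pos
  have hq0 : 0 ≤ q := by linarith
  have hsq1 : 1 ≤ √q := Real.one_le_sqrt.2 hq1
  have hn1 : (1 : ℝ) ≤ n := Nat.one_le_cast.2 (by omega)
  set J := (Finset.range n).filter (2 * · < n) with hJ
  have hJn : (J.card : ℝ) ≤ n := by
    exact_mod_cast (Finset.card_filter_le _ _).trans_eq (Finset.card_range n)
  rw [← Finset.sum_sub_distrib]
  simp_rw [← Finset.sum_sub_distrib]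
  have hterm : ∀ i ∈ J, ∀ j ∈ J, q * |((n : ℝ) - 2 * i) * (n - 2 * j) *
      (q ^ (n - (i + j)) * (coprimeMoebiusSum F i j : ℝ) - (moebiusCorr 0 A i j n : ℝ) -
        (moebiusCorr 0 (-A) j i n : ℝ) + (moebiusCorr 1 A i j n : ℝ)) -
      ((n : ℝ) - 2 * i) * (n - 2 * j) * (q ^ (n - (i + j)) *
        ((∑ G ∈ monics F i, (moebius G : ℝ)) * ∑ G ∈ monics F j, (moebius G : ℝ)))| ≤
      n ^ 2 * (5641 * n ^ 2 * √q * q ^ n) := by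
    intro i hi j hj
    rw [hJ, Finset.mem_filter, Finset.mem_range] at hi hj
    have hi' : (2 : ℝ) * i ≤ n := by exact_mod_cast hi.2.le
    have hj' : (2 : ℝ) * j ≤ n := by exact_mod_cast hj.2.le
    have hi0 : (0 : ℝ) ≤ i := Nat.cast_nonneg _
    have hj0 : (0 : ℝ) ≤ j := Nat.cast_nonneg _
    have hb := card_mul_abs_moebiusCorr_le hq (e := 0) (by omega) (by omega) hA
      (hasNodalPoint h2 hA0 hn hA hi.2 hj.2 hqn)
    have hd := card_mul_abs_moebiusCorr_le hq (e := 1) le_rfl (by omega) hA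
      (hasNodalPoint h2 hA0 hn hA hi.2 hj.2 hqn)
    have hg := card_mul_abs_moebiusCorr_le hq (e := 0) (by omega) (by omega)
      (by rwa [degree_neg] : (-A).degree < n)
      (hasNodalPoint h2 (neg_ne_zero.2 hA0) hn (by rwa [degree_neg]) hj.2 hi.2 hqn)
    have ha := card_mul_abs_coprimeMoebiusSum_sub_le (F := F) i j
    have ha' : q * |(coprimeMoebiusSum F i j : ℝ) -
        (∑ G ∈ monics F i, (moebius G : ℝ)) * ∑ G ∈ monics F j, (moebius G : ℝ)| ≤
        i * q ^ (i + j) := by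
      have h := (Int.cast_le (R := ℝ)).2 ha
      push_cast at h
      exact h
    rw [← hqdef] at hb hd hg
    set a := (coprimeMoebiusSum F i j : ℝ)
    set m := (∑ G ∈ monics F i, (moebius G : ℝ)) * ∑ G ∈ monics F j, (moebius G : ℝ)
    set b := (moebiusCorr 0 A i j n : ℝ)
    set g := (moebiusCorr 0 (-A) j i n : ℝ)
    set d := (moebiusCorr 1 A i j n : ℝ)
    have hpow : q ^ n = q ^ (n - (i + j)) * q ^ (i + j) := by
      rw [← pow_add]
      congr 1
      omega
    have hA1 : q * |q ^ (n - (i + j)) * (a - m)| ≤ n ^ 2 * √q * q ^ n := by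
      rw [abs_mul, abs_of_nonneg (by positivity : 0 ≤ q ^ (n - (i + j)))]
      calc _ = q ^ (n - (i + j)) * (q * |a - m|) := by ring
        _ ≤ q ^ (n - (i + j)) * (i * q ^ (i + j)) := by gcongr
        _ = i * q ^ n := by rw [hpow]; ring
        _ ≤ n ^ 2 * √q * q ^ n := by
          gcongr
          nlinarith
    have hE : |(q ^ (n - (i + j)) * a - b - g + d) - q ^ (n - (i + j)) * m| ≤
        |q ^ (n - (i + j)) * (a - m)| + |b| + |g| + |d| := by
      rw [show (q ^ (n - (i + j)) * a - b - g + d) - q ^ (n - (i + j)) * m =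
        q ^ (n - (i + j)) * (a - m) - b - g + d by ring]
      refine (abs_add_le _ _).trans (add_le_add_left ?_ _)
      refine (abs_sub _ _).trans (add_le_add_left ?_ _)
      exact abs_sub _ _
    have hE' : q * |(q ^ (n - (i + j)) * a - b - g + d) - q ^ (n - (i + j)) * m| ≤
        5641 * n ^ 2 * √q * q ^ n := by
      refine (mul_le_mul_of_nonneg_left hE hq0).trans ?_
      linarith
    have hw1 : |(n : ℝ) - 2 * i| ≤ n := by rw [abs_le]; constructor <;> linarith
    have hw2 : |(n : ℝ) - 2 * j| ≤ n := by rw [abs_le]; constructor <;> linarith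
    rw [← mul_sub, abs_mul, abs_mul, pow_two (n : ℝ), mul_left_comm]
    rw [pow_two] at hE'
    gcongr
  calc _ ≤ ∑ i ∈ J, ∑ j ∈ J, (n : ℝ) ^ 2 * (5641 * n ^ 2 * √q * q ^ n) := by
        refine (mul_le_mul_of_nonneg_left ((Finset.abs_sum_le_sum_abs _ _).trans
          (Finset.sum_le_sum fun i _ => Finset.abs_sum_le_sum_abs _ _)) hq0).trans ?_
        rw [Finset.mul_sum]
        refine Finset.sum_le_sum fun i hi => ?_
        rw [Finset.mul_sum]
        exact Finset.sum_le_sum fun j hj => hterm i hi j hj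
    _ = (J.card : ℝ) * J.card * ((n : ℝ) ^ 2 * (5641 * n ^ 2 * √q * q ^ n)) := by
        simp only [Finset.sum_const, nsmul_eq_mul]
        ring
    _ ≤ (n : ℝ) * n * ((n : ℝ) ^ 2 * (5641 * n ^ 2 * √q * q ^ n)) := by gcongr
    _ = _ := by ring

end Assembly

section Final

lemma pow_four_le_mul_sq_factorial (n : ℕ) : n ^ 4 ≤ 4 * n.factorial ^ 2 := by
  have h : n ^ 2 ≤ 2 * n.factorial := by
    rcases n with _ | _ | n
    · simp
    · simp
    · induction n with
      | zero => decide
      | succ n ih =>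
        rw [Nat.factorial_succ]
        have h1 : (n + 1 + 1 + 1) ^ 2 ≤ (n + 1 + 1 + 1) * (n + 1 + 1) ^ 2 := by
          rw [pow_two]
          exact Nat.mul_le_mul_left _ (by nlinarith)
        nlinarith
  calc n ^ 4 = (n ^ 2) ^ 2 := by ring
    _ ≤ (2 * n.factorial) ^ 2 := Nat.pow_le_pow_left h 2
    _ = _ := by ring

lemma eight_pow_le_two_pow_choose {n : ℕ} (hn : 1 ≤ n) : 8 ^ n ≤ 2 ^ Nat.choose (n + 2) 2 := by
  have h : 3 * n ≤ Nat.choose (n + 2) 2 := by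
    rw [Nat.choose_two_right, Nat.le_div_iff_mul_le two_pos, Nat.add_succ_sub_one]
    rcases n with _ | _ | n
    · omega
    · norm_num
    · nlinarith
  calc 8 ^ n = 2 ^ (3 * n) := by rw [pow_mul]; norm_num
    _ ≤ _ := Nat.pow_le_pow_right two_pos h

variable {F : Type*} [Field F] [Fintype F]

lemma card_twin_irreducible_le (A : F[X]) (n : ℕ) :
    Nat.card {f : F[X] // f.Monic ∧ f.natDegree = n ∧ Irreducible f ∧ Irreducible (f + A)} ≤
      Fintype.card F ^ n := by
  classical
  rw [← card_monics, Nat.subtype_card ((monics F n).filter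
    fun f => Irreducible f ∧ Irreducible (f + A)) fun f => by
      rw [Finset.mem_filter, mem_monics, and_assoc]]
  exact Finset.card_filter_le _ _

lemma card_twin_irreducible_one {A : F[X]} (hA : A.natDegree < 1) :
    Nat.card {f : F[X] // f.Monic ∧ f.natDegree = 1 ∧ Irreducible f ∧ Irreducible (f + A)} =
      Fintype.card F := by
  classical
  rw [Nat.subtype_card (monics F 1) fun f => ?_, card_monics, pow_one]
  rw [mem_monics]
  refine ⟨fun h => ⟨h.1, h.2, ?_, ?_⟩, fun h => ⟨h.1, h.2.1⟩⟩
  · exact irreducible_of_degree_eq_one (by rw [degree_eq_natDegree h.1.ne_zero, h.2]; rfl)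
  · have hA' : A.degree < f.natDegree := by
      rw [h.2]
      exact (natDegree_eq_zero_iff_degree_le_zero.1 (by omega)).trans_lt (by norm_num)
    obtain ⟨h1, h2⟩ := natDegree_add_of_monic hA' h.1
    exact irreducible_of_degree_eq_one (by rw [degree_eq_natDegree h1.ne_zero, h2, h.2]; rfl)

lemma abs_card_twin_irreducible_sub_le (hq : Odd (Fintype.card F)) {A : F[X]} (hA0 : A ≠ 0)
    {n : ℕ} (hn : 2 ≤ n) (hA : A.natDegree < n) (hqn : 5 * 8 ^ n ≤ Fintype.card F) :
    (Fintype.card F : ℝ) * |(Nat.card {f : F[X] // f.Monic ∧ f.natDegree = n ∧ Irreducible f ∧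
      Irreducible (f + A)} : ℝ) - (Fintype.card F : ℝ) ^ n / (n : ℝ) ^ 2| ≤
      6 * 8 ^ n * (Fintype.card F : ℝ) ^ n +
        1411 * (n : ℝ) ^ 4 * √(Fintype.card F) * (Fintype.card F : ℝ) ^ n := by
  classical
  have hAd : A.degree < n := (natDegree_lt_iff_degree_lt hA0).1 hA
  have h1 := (Int.cast_le (R := ℝ)).2 (card_mul_abs_sub_sum_sieveTerm_le hA0 hAd)
  have h2 := card_mul_abs_sum_sieveTerm_sub_le hq hA0 hn hAd hqn
  have hN : Nat.card {f : F[X] // f.Monic ∧ f.natDegree = n ∧ Irreducible f ∧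
      Irreducible (f + A)} =
      ((monics F n).filter fun f => Irreducible f ∧ Irreducible (f + A)).card :=
    Nat.subtype_card _ fun f => by rw [Finset.mem_filter, mem_monics, and_assoc]
  rw [hN]
  push_cast at h1 h2
  set N : ℝ := (((monics F n).filter fun f => Irreducible f ∧ Irreducible (f + A)).card : ℝ)
  set S : ℝ := ∑ f ∈ monics F n, (sieveTerm A n f : ℝ)
  set q : ℝ := (Fintype.card F : ℝ)
  have hq0 : 0 ≤ q := Nat.cast_nonneg _
  have hn0 : (0 : ℝ) < n := Nat.cast_pos.2 (by omega)
  have h3 : 4 * (n : ℝ) ^ 2 * |N - q ^ n / (n : ℝ) ^ 2| ≤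
      |4 * (n : ℝ) ^ 2 * N - S| + |S - 4 * q ^ n| := by
    rw [← abs_of_pos (show (0 : ℝ) < 4 * (n : ℝ) ^ 2 by positivity), ← abs_mul,
      abs_of_pos (show (0 : ℝ) < 4 * (n : ℝ) ^ 2 by positivity)]
    refine le_trans (le_of_eq ?_) (abs_add_le _ _)
    congr 1
    field_simp
    ring
  have h4 : 4 * (n : ℝ) ^ 2 * (q * |N - q ^ n / (n : ℝ) ^ 2|) ≤
      4 * (n : ℝ) ^ 2 * (6 * 8 ^ n * q ^ n + 1411 * (n : ℝ) ^ 4 * √q * q ^ n) := by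
    have h5 := mul_le_mul_of_nonneg_left h3 hq0
    have h6 : (0 : ℝ) ≤ (n : ℝ) ^ 6 * √q * q ^ n := by positivity
    linarith
  exact le_of_mul_le_mul_left h4 (by positivity)

end Final

end TwinPrime

/-- **Theorem 3 (twin prime count).**  Let `F_q` be a finite field of odd cardinality `q`,
let `n` be a natural number, and let `A ∈ F_q[t]` be nonzero of degree smaller than `n`.
Then, with absolute constants `C₁, C₂ > 0`,
`|π₂(n;A,q) − q^n/n²| ≤ C₁·(n!)²·q^(n−1/2) + C₂·n·2^(C(n+2,2))·q^(n−1)`,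
where `π₂(n;A,q)` counts monic `F` of degree `n` with `F` and `F + A` both irreducible. -/
theorem twin_prime_count :
    ∃ C₁ C₂ : ℝ, 0 < C₁ ∧ 0 < C₂ ∧
      ∀ (Fq : Type) [Field Fq] [Fintype Fq], Odd (Fintype.card Fq) →
      ∀ (n : ℕ) (A : Polynomial Fq), A ≠ 0 → A.natDegree < n →
      |(Nat.card {F : Polynomial Fq //
            F.Monic ∧ F.natDegree = n ∧ Irreducible F ∧ Irreducible (F + A)} : ℝ)
          - (Fintype.card Fq : ℝ) ^ n / (n : ℝ) ^ 2|
        ≤ C₁ * (n.factorial : ℝ) ^ 2 * (Fintype.card Fq : ℝ) ^ ((n : ℝ) - 1 / 2)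
          + C₂ * n * 2 ^ (Nat.choose (n + 2) 2) * (Fintype.card Fq : ℝ) ^ (n - 1) := by
  refine ⟨5644, 6, by norm_num, by norm_num, ?_⟩
  intro Fq _ _ hodd n A hA0 hA
  have hq1 : (1 : ℝ) ≤ Fintype.card Fq := Nat.one_le_cast.2 Fintype.card_pos
  have hcard := TwinPrime.card_twin_irreducible_le A n
  have hn1 : (1 : ℝ) ≤ n := Nat.one_le_cast.2 (by omega)
  have h8 : (8 : ℝ) ^ n ≤ 2 ^ Nat.choose (n + 2) 2 := by
    exact_mod_cast TwinPrime.eight_pow_le_two_pow_choose (by omega : 1 ≤ n)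
  have h8' : (8 : ℝ) ^ n ≤ n * 2 ^ Nat.choose (n + 2) 2 :=
    h8.trans (le_mul_of_one_le_left (by positivity) hn1)
  have hpow : (Fintype.card Fq : ℝ) ^ n =
      Fintype.card Fq * (Fintype.card Fq : ℝ) ^ (n - 1) := by
    rw [← pow_succ', Nat.sub_add_cancel (by omega)]
  have hrpow : (Fintype.card Fq : ℝ) ^ ((n : ℝ) - 1 / 2) * Fintype.card Fq =
      √(Fintype.card Fq) * (Fintype.card Fq : ℝ) ^ n := by
    have hq0 : (0 : ℝ) < Fintype.card Fq := by linarith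
    rw [Real.sqrt_eq_rpow, ← Real.rpow_natCast, ← Real.rpow_add hq0, ← Real.rpow_add_one hq0.ne']
    congr 1
    ring
  rcases lt_or_ge (Fintype.card Fq) (5 * 8 ^ n) with hlt | hge
  · have hcard' : (Nat.card {F : Polynomial Fq // F.Monic ∧ F.natDegree = n ∧
        Irreducible F ∧ Irreducible (F + A)} : ℝ) ≤ (Fintype.card Fq : ℝ) ^ n := by
      exact_mod_cast hcard
    have hlt' : (Fintype.card Fq : ℝ) ≤ 5 * 8 ^ n := by exact_mod_cast hlt.le
    have hdiv : (Fintype.card Fq : ℝ) ^ n / (n : ℝ) ^ 2 ≤ (Fintype.card Fq : ℝ) ^ n :=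
      div_le_self (by positivity) (one_le_pow₀ hn1)
    have hdiv0 : 0 ≤ (Fintype.card Fq : ℝ) ^ n / (n : ℝ) ^ 2 := by positivity
    have hN0 : (0 : ℝ) ≤ Nat.card {F : Polynomial Fq // F.Monic ∧ F.natDegree = n ∧
        Irreducible F ∧ Irreducible (F + A)} := Nat.cast_nonneg _
    calc _ ≤ (Fintype.card Fq : ℝ) ^ n := by rw [abs_le]; constructor <;> linarith
      _ ≤ 6 * n * 2 ^ (Nat.choose (n + 2) 2) * (Fintype.card Fq : ℝ) ^ (n - 1) := by
        rw [hpow]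
        gcongr
        linarith
      _ ≤ _ := le_add_of_nonneg_left (by positivity)
  · rcases (show 1 ≤ n by omega).eq_or_lt with rfl | hn2
    · rw [TwinPrime.card_twin_irreducible_one hA]
      simp only [pow_one, Nat.cast_one, div_one, one_pow, sub_self, abs_zero]
      positivity
    · have h := TwinPrime.abs_card_twin_irreducible_sub_le hodd hA0 hn2 hA hge
      have hf : (n : ℝ) ^ 4 ≤ 4 * (n.factorial : ℝ) ^ 2 := by
        exact_mod_cast TwinPrime.pow_four_le_mul_sq_factorial n
      refine le_of_mul_le_mul_left (h.trans ?_) (by linarith : (0 : ℝ) < Fintype.card Fq)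
      calc _ ≤ 6 * (n * 2 ^ Nat.choose (n + 2) 2) * (Fintype.card Fq : ℝ) ^ n +
            1411 * (4 * (n.factorial : ℝ) ^ 2) * √(Fintype.card Fq) *
              (Fintype.card Fq : ℝ) ^ n := by gcongr
        _ = 6 * (n * 2 ^ Nat.choose (n + 2) 2) *
            (Fintype.card Fq * (Fintype.card Fq : ℝ) ^ (n - 1)) +
            5644 * (n.factorial : ℝ) ^ 2 *
            (√(Fintype.card Fq) * (Fintype.card Fq : ℝ) ^ n) := by rw [← hpow]; ring
        _ = _ := by rw [← hrpow]; ring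
end

section
/- Let F_q be a finite field and n ≥ 2. For every monic polynomial g ∈ F_q[t] of degree n−1, the number N_g of ordered pairs (f, b), where f ∈ 𝓕 (the family of bivariate polynomials f(x,t) ∈ F_q[x,t] of total degree n−1 such that f(t+b,t) is a monic polynomial of degree n−1 in t for every b ∈ F_q), b ∈ F_q, and f(t+b,t) = g(t), equals q^(binomial(n+1,2) − (n−1)). -/
open Polynomial

section

variable {R : Type*} [CommRing R]

/-- The substitution `f(x, t) ↦ f(t + b, t)`. -/
noncomputable def shiftEval (b : R) : MvPolynomial (Fin 2) R →ₐ[R] R[X] :=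
  MvPolynomial.aeval ![X + C b, X]

lemma natDegree_shiftEval_le (b : R) {f : MvPolynomial (Fin 2) R} {m : ℕ}
    (hf : f.totalDegree ≤ m) : (shiftEval b f).natDegree ≤ m := by
  have h := MvPolynomial.aeval_natDegree_le f hf ![X + C b, X] (n := 1) (by
    intro i
    fin_cases i
    · exact natDegree_add_C.trans_le natDegree_X_le
    · exact natDegree_X_le)
  simpa [shiftEval] using h

lemma coeff_X_add_C_pow_mul_X_pow (b : R) {i j m : ℕ} (h : i + j ≤ m) :
    ((X + C b) ^ i * X ^ j : R[X]).coeff m = if i + j = m then 1 else 0 := by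
  obtain ⟨k, rfl⟩ : ∃ k, m = k + j := ⟨m - j, by omega⟩
  rw [coeff_mul_X_pow, coeff_X_add_C_pow]
  rcases eq_or_lt_of_le (show i ≤ k by omega) with rfl | hk
  · simp
  · simp [Nat.choose_eq_zero_of_lt hk, hk.ne]

lemma coeff_shiftEval (b : R) {f : MvPolynomial (Fin 2) R} {m : ℕ} (hf : f.totalDegree ≤ m) :
    (shiftEval b f).coeff m =
      ∑ d ∈ f.support, f.coeff d * if d 0 + d 1 = m then 1 else 0 := by
  rw [shiftEval, MvPolynomial.aeval_def, MvPolynomial.eval₂_eq', finsetSum_coeff]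
  refine Finset.sum_congr rfl fun d hd ↦ ?_
  have hdm : d 0 + d 1 ≤ m := by
    have := (MvPolynomial.le_totalDegree hd).trans hf
    rwa [Finsupp.sum_fintype _ _ (fun _ ↦ rfl), Fin.sum_univ_two] at this
  rw [algebraMap_eq, coeff_C_mul, Fin.prod_univ_two]
  simp [coeff_X_add_C_pow_mul_X_pow b hdm]

lemma totalDegree_aeval_X_one_le [Nontrivial R] (g : R[X]) :
    (aeval (MvPolynomial.X 1 : MvPolynomial (Fin 2) R) g).totalDegree ≤ g.natDegree := by
  rw [aeval_eq_sum_range]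
  refine MvPolynomial.totalDegree_finsetSum_le fun i hi ↦ ?_
  refine (MvPolynomial.totalDegree_smul_le _ _).trans ((MvPolynomial.totalDegree_pow _ _).trans ?_)
  simpa [Nat.lt_succ_iff] using hi

lemma shiftEval_aeval_X_one (b : R) (g : R[X]) :
    shiftEval b (aeval (MvPolynomial.X 1) g) = g := by
  rw [← aeval_algHom_apply]
  simp [shiftEval]

lemma shiftEval_monic_of_monic [Nontrivial R] {b : R} {f : MvPolynomial (Fin 2) R} {m : ℕ}
    (hf : f.totalDegree ≤ m) (hb : (shiftEval b f).Monic) (hm : (shiftEval b f).natDegree = m)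
    (c : R) : (shiftEval c f).Monic ∧ (shiftEval c f).natDegree = m := by
  have hc : (shiftEval c f).coeff m = 1 := by
    rw [coeff_shiftEval c hf, ← coeff_shiftEval b hf, ← hm]
    exact hb
  exact ⟨monic_of_natDegree_le_of_coeff_eq_one m (natDegree_shiftEval_le c hf) hc,
    le_antisymm (natDegree_shiftEval_le c hf) (le_natDegree_of_ne_zero (by simp [hc]))⟩

/-- Bivariate polynomials of total degree at most `m` have dimension `(m + 2).choose 2`. -/
lemma MvPolynomial.finrank_restrictTotalDegree_fin_two [Nontrivial R] (m : ℕ) :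
    Module.finrank R (MvPolynomial.restrictTotalDegree (Fin 2) R m) = (m + 2).choose 2 := by
  let e : {d : Fin 2 →₀ ℕ | (d.sum fun _ k ↦ k) ≤ m} ≃
      (Finset.range (m + 1)).sigma fun k ↦ Finset.HasAntidiagonal.antidiagonal k :=
    { toFun := fun d ↦ ⟨⟨d.1 0 + d.1 1, (d.1 0, d.1 1)⟩, by
        have := d.2
        rw [Set.mem_ofPred_eq, Finsupp.sum_fintype _ _ (fun _ ↦ rfl), Fin.sum_univ_two] at this
        simpa [Nat.lt_succ_iff] using this⟩
      invFun := fun p ↦ ⟨Finsupp.equivFunOnFinite.symm ![p.1.2.1, p.1.2.2], by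
        have := p.2
        rw [Finset.mem_sigma, Finset.mem_range, Finset.HasAntidiagonal.mem_antidiagonal] at this
        rw [Set.mem_ofPred_eq, Finsupp.sum_fintype _ _ (fun _ ↦ rfl), Fin.sum_univ_two]
        simp
        omega⟩
      left_inv := fun d ↦ by
        ext i
        fin_cases i <;> rfl
      right_inv := fun ⟨⟨k, i, j⟩, h⟩ ↦ by
        rw [Finset.mem_sigma, Finset.HasAntidiagonal.mem_antidiagonal] at h
        obtain rfl : i + j = k := h.2
        rfl }
  rw [MvPolynomial.restrictTotalDegree,
    Module.finrank_eq_nat_card_basis (MvPolynomial.basisRestrictSupport R _), Nat.card_congr e,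
    Nat.card_eq_fintype_card, Fintype.card_coe, Finset.card_sigma]
  simp only [Finset.Nat.card_antidiagonal]
  induction m with
  | zero => rfl
  | succ m ih =>
    rw [Finset.sum_range_succ, ih, Nat.choose_succ_succ' (m + 2) 1, Nat.choose_one_right]
    exact Nat.add_comm _ _

end

section

variable {K : Type*} [Field K]

lemma range_shiftEval_domRestrict (b : K) (m : ℕ) :
    ((shiftEval b).toLinearMap.domRestrict
      (MvPolynomial.restrictTotalDegree (Fin 2) K m)).range = degreeLT K (m + 1) := by
  ext g
  have hdeg : g ∈ degreeLT K (m + 1) ↔ g.natDegree ≤ m := by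
    rw [mem_degreeLT, degree_lt_iff_coeff_zero, natDegree_le_iff_coeff_eq_zero]
    rfl
  rw [hdeg]
  constructor
  · rintro ⟨f, rfl⟩
    exact natDegree_shiftEval_le b ((MvPolynomial.mem_restrictTotalDegree _ _ _).1 f.2)
  · intro hg
    exact ⟨⟨aeval (MvPolynomial.X 1) g, (MvPolynomial.mem_restrictTotalDegree _ _ _).2
      ((totalDegree_aeval_X_one_le g).trans hg)⟩, shiftEval_aeval_X_one b g⟩

/-- Each polynomial of degree at most `m` has the same number of preimages of total degree at
most `m` under `f(x, t) ↦ f(t + b, t)`. -/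
lemma card_shiftEval_fiber [Finite K] (b : K) {m : ℕ} {g : K[X]} (hg : g.natDegree ≤ m) :
    Nat.card {f : MvPolynomial (Fin 2) K // f.totalDegree ≤ m ∧ shiftEval b f = g} =
      Nat.card K ^ ((m + 2).choose 2 - (m + 1)) := by
  let V := MvPolynomial.restrictTotalDegree (Fin 2) K m
  let φ : V →ₗ[K] K[X] := (shiftEval b).toLinearMap.domRestrict V
  have hV : Module.finrank K V = (m + 2).choose 2 :=
    MvPolynomial.finrank_restrictTotalDegree_fin_two m
  have hr : Module.finrank K φ.range = m + 1 := by
    rw [range_shiftEval_domRestrict, (degreeLTEquiv K (m + 1)).finrank_eq]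
    simp
  have hk : Module.finrank K φ.ker = (m + 2).choose 2 - (m + 1) := by
    have := φ.finrank_range_add_finrank_ker
    omega
  let s : V := ⟨aeval (MvPolynomial.X 1) g, (MvPolynomial.mem_restrictTotalDegree _ _ _).2
    ((totalDegree_aeval_X_one_le g).trans hg)⟩
  have hs : φ s = g := shiftEval_aeval_X_one b g
  let e₁ : {f : MvPolynomial (Fin 2) K // f.totalDegree ≤ m ∧ shiftEval b f = g} ≃
      {f : V // φ f = g} :=
    { toFun := fun f ↦ ⟨⟨f.1, (MvPolynomial.mem_restrictTotalDegree _ _ _).2 f.2.1⟩, f.2.2⟩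
      invFun := fun f ↦ ⟨f.1.1, (MvPolynomial.mem_restrictTotalDegree _ _ _).1 f.1.2, f.2⟩
      left_inv := fun _ ↦ rfl
      right_inv := fun _ ↦ rfl }
  let e₂ : {f : V // φ f = g} ≃ φ.ker :=
    (Equiv.subRight s).subtypeEquiv fun f ↦ by
      simp [hs, sub_eq_zero]
  rw [Nat.card_congr (e₁.trans e₂), Module.natCard_eq_pow_finrank (K := K), hk]

end



/-- **Lemma 1.**  Let `F_q` be a finite field and `n ≥ 2`.  For every monic `g ∈ F_q[t]` of
degree `n−1`, the number `N_g` of pairs `(f, b)` with `f ∈ 𝓕` (bivariate polynomials of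
total degree `n−1` such that `f(t+b,t)` is monic of degree `n−1` for every `b ∈ F_q`),
`b ∈ F_q`, and `f(t+b,t) = g`, equals `q^(C(n+1,2) − (n−1))`. -/
theorem count_pairs_deg_pred (Fq : Type) [Field Fq] [Fintype Fq] (n : ℕ) (hn : 2 ≤ n)
    (g : Polynomial Fq) (hg : g.Monic) (hgdeg : g.natDegree = n - 1) :
    Nat.card {p : MvPolynomial (Fin 2) Fq × Fq //
        p.1.totalDegree = n - 1 ∧
        (∀ b : Fq,
          (MvPolynomial.aeval ![Polynomial.X + Polynomial.C b, Polynomial.X] p.1 :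
              Polynomial Fq).Monic ∧
          (MvPolynomial.aeval ![Polynomial.X + Polynomial.C b, Polynomial.X] p.1 :
              Polynomial Fq).natDegree = n - 1) ∧
        (MvPolynomial.aeval ![Polynomial.X + Polynomial.C p.2, Polynomial.X] p.1 :
            Polynomial Fq) = g}
      = Fintype.card Fq ^ (Nat.choose (n + 1) 2 - (n - 1)) := by
  obtain ⟨m, rfl⟩ : ∃ m, n = m + 1 := ⟨n - 1, by omega⟩
  rw [Nat.add_sub_cancel] at hgdeg ⊢
  change Nat.card {p : MvPolynomial (Fin 2) Fq × Fq // p.1.totalDegree = m ∧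
    (∀ b, (shiftEval b p.1).Monic ∧ (shiftEval b p.1).natDegree = m) ∧
      shiftEval p.2 p.1 = g} = _
  have key (p : MvPolynomial (Fin 2) Fq × Fq) : (p.1.totalDegree = m ∧
      (∀ b, (shiftEval b p.1).Monic ∧ (shiftEval b p.1).natDegree = m) ∧
        shiftEval p.2 p.1 = g) ↔ p.1.totalDegree ≤ m ∧ shiftEval p.2 p.1 = g := by
    refine ⟨fun h ↦ ⟨h.1.le, h.2.2⟩, fun ⟨h, hpg⟩ ↦ ⟨h.antisymm ?_, ?_, hpg⟩⟩
    · rw [← hgdeg, ← hpg]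
      exact natDegree_shiftEval_le _ le_rfl
    · exact shiftEval_monic_of_monic h (hpg ▸ hg) (hpg ▸ hgdeg)
  let e : {p : MvPolynomial (Fin 2) Fq × Fq // p.1.totalDegree ≤ m ∧ shiftEval p.2 p.1 = g} ≃
      Σ b : Fq, {f : MvPolynomial (Fin 2) Fq // f.totalDegree ≤ m ∧ shiftEval b f = g} :=
    { toFun := fun p ↦ ⟨p.1.2, p.1.1, p.2⟩
      invFun := fun p ↦ ⟨(p.2.1, p.1), p.2.2⟩
      left_inv := fun _ ↦ rfl
      right_inv := fun _ ↦ rfl }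
  have hfin (b : Fq) :
      Finite {f : MvPolynomial (Fin 2) Fq // f.totalDegree ≤ m ∧ shiftEval b f = g} := by
    refine Nat.finite_of_card_ne_zero ?_
    rw [card_shiftEval_fiber b hgdeg.le]
    exact pow_ne_zero _ Nat.card_pos.ne'
  have hle : m + 1 ≤ (m + 2).choose 2 := by
    rw [Nat.choose_succ_succ' (m + 1) 1, Nat.choose_one_right]
    exact Nat.le_add_right _ _
  rw [Nat.card_congr (Equiv.subtypeEquivRight key), Nat.card_congr e, Nat.card_sigma]
  simp only [card_shiftEval_fiber _ hgdeg.le, Finset.sum_const, Finset.card_univ, smul_eq_mul,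
    Nat.card_eq_fintype_card]
  rw [← pow_succ']
  rw [show m + 1 + 1 = m + 2 from rfl]
  congr 1
  omega
end
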